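/- Let k be a positive integer. Define S_k to be the collection of canonical plumbing graphs G such that G fails Property X_k and every subgraph of G induced by a proper subset of V(G) satisfies Property X_k. Then: (1) a canonical plumbing graph fails Property X_k if and only if some element of S_k occurs as an induced subgraph of it; (2) every vertex v of every element of S_k satisfies |w(v)| ≤ 2k + 7; (3) every element of S_k has at most 13k vertices. In particular, S_k contains only finitely many configurations up to weight-preserving graph isomorphism. -/

import Mathlib

namespace LensPaper

/-- A finite weighted simple graph: the combinatorial data underlying a configuration
(a disjoint union of weighted linear graphs).  The fact that every connected component
is a path is recorded separately by `Config.IsLinear`. -/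
structure Config where
  V : Type
  fin : Fintype V
  deq : DecidableEq V
  graph : SimpleGraph V
  adjDec : DecidableRel graph.Adj
  w : V → ℤ

attribute [instance] Config.fin Config.deq Config.adjDec

namespace Config

/-- The degree of a vertex. -/
noncomputable def deg (C : Config) (v : C.V) : ℕ := (C.graph.neighborSet v).ncard

/-- A configuration: every component is a path, i.e. all degrees are at most `2` and the
graph is acyclic. -/
def IsLinear (C : Config) : Prop :=
  (∀ v : C.V, C.deg v ≤ 2) ∧ C.graph.IsAcyclic

/-- The adjusted weight `w'(v) = w(v) - deg(v)`. -/
noncomputable def adjw (C : Config) (v : C.V) : ℤ := C.w v - C.deg v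

/-- A vertex is bad if it is adjacent to two distinct vertices of positive adjusted
weight. -/
def IsBad (C : Config) (x : C.V) : Prop :=
  ∃ u v : C.V, u ≠ v ∧ C.graph.Adj x u ∧ C.graph.Adj x v ∧ 0 < C.adjw u ∧ 0 < C.adjw v

/-- A leaf: a vertex of degree at most one. -/
def IsLeaf (C : Config) (v : C.V) : Prop := C.deg v ≤ 1

/-- `v 0, v 1, …, v m` is a chain of consecutive (distinct) vertices. -/
def IsChain (C : Config) (m : ℕ) (v : ℕ → C.V) : Prop :=
  (∀ i ≤ m, ∀ j ≤ m, v i = v j → i = j) ∧ ∀ i < m, C.graph.Adj (v i) (v (i + 1))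

/-- The chain `v 0, …, v m` has the list `p` as its sequence of adjusted weights. -/
def ChainPattern (C : Config) (m : ℕ) (v : ℕ → C.V) (p : List ℤ) : Prop :=
  C.IsChain m v ∧ m + 1 = p.length ∧ ∀ i : Fin p.length, C.adjw (v i) = p.get i

/-- `Γ` contains a chain of consecutive vertices whose adjusted weights, read in order,
form the list `p`. -/
def HasPattern (C : Config) (p : List ℤ) : Prop := ∃ m v, C.ChainPattern m v p

/-- A chain realizing a bad-part pattern `p` (each entry of `p` is an adjusted weight
together with a flag marking the bad positions): the chain has the prescribed adjusted
weights, and the bad vertices of the configuration are exactly the vertices of the chain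
in the flagged positions. -/
def IsBadPartChain (C : Config) (p : List (ℤ × Bool)) (m : ℕ) (v : ℕ → C.V) : Prop :=
  C.IsChain m v ∧ m + 1 = p.length ∧
  (∀ i : Fin p.length, C.adjw (v i) = (p.get i).1) ∧
  (∀ x : C.V, C.IsBad x ↔ ∃ i : Fin p.length, (p.get i).2 = true ∧ v i = x)

end Config

/-- The chains of adjusted weights forbidden by Working Condition VI. -/
def forbiddenPatterns : List (List ℤ) :=
  [[1, 0, 0, 2], [1, 0, 0, 3], [1, 0, 0, 0, 3], [1, 1, 0, 0, 1, 2], [3, 1, 0, 0, 1],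
   [1, 0, 1, 2], [1, 0, 1, 3], [1, 1, 0, 2], [1, 1, 0, 1, 1, 2]]

/-- The bad-part patterns of Working Condition VII; `true` marks the bad positions. -/
def badPatterns : List (List (ℤ × Bool)) :=
  [[(1, false), (0, true), (1, false)],
   [(1, false), (0, true), (2, false)],
   [(1, false), (0, true), (3, false)],
   [(1, false), (1, true), (1, false)],
   [(1, false), (1, true), (2, false)],
   [(1, false), (2, true), (1, false)],
   [(1, false), (0, true), (1, false), (0, true), (1, false)],
   [(1, false), (0, true), (1, false), (0, true), (2, false)],
   [(1, false), (0, true), (1, false), (1, true), (1, false)],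
   [(1, false), (0, true), (1, false), (1, true), (2, false)],
   [(1, false), (1, true), (1, true), (1, false)],
   [(1, false), (1, true), (1, true), (1, true), (1, false)],
   [(1, false), (1, true), (2, true), (1, false)]]

namespace Config

/-- The Working Conditions (I)–(VII). -/
def WorkingConditions (C : Config) : Prop :=
  (∀ v : C.V, 2 ≤ C.w v) ∧
  (∀ v : C.V, C.adjw v ≤ 3) ∧
  (∀ u v : C.V, 1 < C.adjw u → 1 < C.adjw v → u = v) ∧
  (∀ v x : C.V, 1 < C.adjw v → C.IsBad x → C.adjw x = 1 → C.graph.Adj x v) ∧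
  ((∃ v : C.V, C.adjw v = 3) →
     ∀ u u' : C.V, C.graph.Adj u u' → C.adjw u = 1 → C.adjw u' = 1 → False) ∧
  (∀ u v x : C.V, C.graph.Adj u v → C.adjw u = 1 → C.adjw v = 1 →
     C.IsBad x → C.adjw x = 2 → C.graph.Adj x u ∨ C.graph.Adj x v) ∧
  (∀ p ∈ forbiddenPatterns, ¬ C.HasPattern p) ∧
  ((∃ x : C.V, C.IsBad x) → ∃ p ∈ badPatterns, ∃ m v, C.IsBadPartChain p m v)

end Config

/-- The standard inner product on `ℤ^N`. -/
def dot {N : ℕ} (x y : Fin N → ℤ) : ℤ := ∑ i, x i * y i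

/-- The support of a vector of `ℤ^N` with respect to the standard orthonormal basis. -/
def supp {N : ℕ} (x : Fin N → ℤ) : Finset (Fin N) :=
  Finset.univ.filter fun i => x i ≠ 0

namespace Config

/-- An embedding of a configuration into `ℤ^N`. -/
def IsEmbedding (C : Config) (N : ℕ) (φ : C.V → Fin N → ℤ) : Prop :=
  ∀ u v : C.V, dot (φ u) (φ v) =
    if u = v then C.w u else if C.graph.Adj u v then -1 else 0

/-- The restriction of `φ` to `S` is standard. -/
def IsStandardOn (C : Config) (N : ℕ) (φ : C.V → Fin N → ℤ) (S : Set C.V) : Prop :=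
  ∀ u ∈ S, ∀ v ∈ S,
    ((supp (φ u) ∩ supp (φ v)).card : ℤ) =
      if u = v then C.w v else if C.graph.Adj u v then 1 else 0

/-- A standard embedding. -/
def IsStandard (C : Config) (N : ℕ) (φ : C.V → Fin N → ℤ) : Prop :=
  C.IsStandardOn N φ Set.univ

/-- The restriction of `φ` to `S` is semi-standard at `x`. -/
def IsSemiStandardAtOn (C : Config) (N : ℕ) (φ : C.V → Fin N → ℤ) (x : C.V)
    (S : Set C.V) : Prop :=
  (∀ u ∈ S, ∀ v ∈ S,
    ((supp (φ u) ∩ supp (φ v)).card : ℤ) =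
      if u = v then C.w v
      else if C.graph.Adj u v then 1
      else if C.graph.Adj x u ∧ C.graph.Adj x v then 2
      else 0) ∧
  (∀ u ∈ S, ∀ v ∈ S, u ≠ v → C.graph.Adj x u → C.graph.Adj x v →
    (supp (φ u) ∩ supp (φ x) ∩ supp (φ v)).card = 1)

/-- A semi-standard embedding: semi-standard at some bad vertex. -/
def IsSemiStandard (C : Config) (N : ℕ) (φ : C.V → Fin N → ℤ) : Prop :=
  ∃ x : C.V, C.IsBad x ∧ C.IsSemiStandardAtOn N φ x Set.univ

/-- A candidate for the extended bad part: a chain containing the bad part whose two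
ends are either leaves or preceded by two consecutive vertices of vanishing adjusted
weight. -/
def IsEBPCand (C : Config) (m : ℕ) (v : ℕ → C.V) : Prop :=
  C.IsChain m v ∧
  (∀ p ∈ badPatterns, ∀ mb vb, C.IsBadPartChain p mb vb →
     ∀ i ≤ mb, ∃ j ≤ m, v j = vb i) ∧
  (C.IsLeaf (v 0) ∨ (2 ≤ m ∧ C.adjw (v 1) = 0 ∧ C.adjw (v 2) = 0)) ∧
  (C.IsLeaf (v m) ∨ (2 ≤ m ∧ C.adjw (v (m - 1)) = 0 ∧ C.adjw (v (m - 2)) = 0))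

/-- The extended bad part: a candidate with the fewest vertices. -/
def IsExtBadPart (C : Config) (m : ℕ) (v : ℕ → C.V) : Prop :=
  C.IsEBPCand m v ∧ ∀ m' v', C.IsEBPCand m' v' → m ≤ m'

/-- The set of vertices of the chain `v 0, …, v m`. -/
def ebpSet (C : Config) (m : ℕ) (v : ℕ → C.V) : Set C.V := {y | ∃ i ≤ m, v i = y}

/-- The outside part of `Γ` relative to the extended bad part `v 0, …, v m`. -/
def OutsidePart (C : Config) (m : ℕ) (v : ℕ → C.V) : Set C.V :=
  {x | ∀ i ≤ m, v i ≠ x}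
  ∪ {x | ¬ C.IsLeaf (v 0) ∧ (x = v 0 ∨ x = v 1 ∨ x = v 2)}
  ∪ {x | ¬ C.IsLeaf (v m) ∧ (x = v m ∨ x = v (m - 1) ∨ x = v (m - 2))}

/-- A screw at the front end of the extended bad part. -/
def IsFrontScrew (C : Config) (N : ℕ) (φ : C.V → Fin N → ℤ) (m : ℕ) (v : ℕ → C.V)
    (e : Fin N) : Prop :=
  ¬ C.IsLeaf (v 0) ∧ 3 ≤ m ∧ φ (v 2) e ≠ 0 ∧ φ (v 3) e ≠ 0

/-- A screw at the back end of the extended bad part. -/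
def IsBackScrew (C : Config) (N : ℕ) (φ : C.V → Fin N → ℤ) (m : ℕ) (v : ℕ → C.V)
    (e : Fin N) : Prop :=
  ¬ C.IsLeaf (v m) ∧ 3 ≤ m ∧ φ (v (m - 2)) e ≠ 0 ∧ φ (v (m - 3)) e ≠ 0

/-- All screws of `Γ` (with respect to `φ`) are clean. -/
def AllScrewsClean (C : Config) (N : ℕ) (φ : C.V → Fin N → ℤ) (m : ℕ)
    (v : ℕ → C.V) : Prop :=
  (∀ e : Fin N, C.IsFrontScrew N φ m v e →
    ∀ u : C.V, u ≠ v 2 → u ≠ v 3 → φ u e = 0) ∧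
  (∀ e : Fin N, C.IsBackScrew N φ m v e →
    ∀ u : C.V, u ≠ v (m - 2) → u ≠ v (m - 3) → φ u e = 0)

end Config
/-- The path graph on the disjoint union of the components encoded by a list of lists:
two vertices are adjacent iff they lie in the same component in consecutive
positions. -/
def ofListGraph (L : List (List ℤ)) :
    SimpleGraph ((i : Fin L.length) × Fin (L.get i).length) where
  Adj a b := a.1 = b.1 ∧ ((a.2 : ℕ) + 1 = (b.2 : ℕ) ∨ (b.2 : ℕ) + 1 = (a.2 : ℕ))
  symm := ⟨fun a b h => ⟨h.1.symm, h.2.symm⟩⟩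
  loopless := by
    constructor
    intro a h
    rcases h with ⟨-, h | h⟩ <;> omega

instance ofListGraphDec (L : List (List ℤ)) : DecidableRel (ofListGraph L).Adj :=
  fun a b => decidable_of_iff
    (a.1 = b.1 ∧ ((a.2 : ℕ) + 1 = (b.2 : ℕ) ∨ (b.2 : ℕ) + 1 = (a.2 : ℕ))) Iff.rfl

/-- The configuration (disjoint union of weighted paths) encoded by a list of
components, each component being the list of its weights read along the path. -/
def ofList (L : List (List ℤ)) : Config where
  V := (i : Fin L.length) × Fin (L.get i).length
  fin := inferInstance
  deq := inferInstance
  graph := ofListGraph L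
  adjDec := ofListGraphDec L
  w := fun a => (L.get a.1).get a.2

/-- `A` occurs as an induced subgraph of `B`: an injective, weight-preserving map
that preserves and reflects adjacency. -/
def IsInducedSubgraph (A B : Config) : Prop :=
  ∃ f : A.V → B.V, Function.Injective f ∧
    (∀ v, B.w (f v) = A.w v) ∧
    (∀ u v, A.graph.Adj u v ↔ B.graph.Adj (f u) (f v))

/-- `A` is (isomorphic to) the subgraph of `B` induced by the vertex set `S`. -/
def IsInducedOn (A B : Config) (S : Set B.V) : Prop :=
  ∃ f : A.V → B.V, Function.Injective f ∧
    (∀ v, B.w (f v) = A.w v) ∧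
    (∀ u v, A.graph.Adj u v ↔ B.graph.Adj (f u) (f v)) ∧
    Set.range f = S

/-- Negative continued fraction `[a₁,…,aₙ]⁻ = a₁ - 1/[a₂,…,aₙ]⁻` (the empty list is
sent to `0`; with the junk value `1/0 = 0` this gives `[aₙ]⁻ = aₙ`). -/
def negCF : List ℤ → ℚ
  | [] => 0
  | a :: l => (a : ℚ) - 1 / negCF l

/-- The (positive) sequences `a` and `b` are dual: for some coprime `p > q > 0`,
`[a]⁻ = p/q` and `[b]⁻ = p/(p-q)`. -/
def DualSeqs (a b : List ℤ) : Prop :=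
  a ≠ [] ∧ b ≠ [] ∧ (∀ x ∈ a, 2 ≤ x) ∧ (∀ x ∈ b, 2 ≤ x) ∧
  ∃ p q : ℤ, 0 < q ∧ q < p ∧ Int.gcd p q = 1 ∧
    negCF a = (p : ℚ) / (q : ℚ) ∧ negCF b = (p : ℚ) / ((p : ℚ) - (q : ℚ))

/-- `P` encodes a canonical plumbing graph (weights `≤ -2`) and `D` encodes its dual:
the components correspond to each other and each pair of weight sequences is dual. -/
def IsDualPair (P D : List (List ℤ)) : Prop :=
  ∃ h : P.length = D.length,
    ∀ i : Fin P.length,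
      DualSeqs ((P.get i).map fun x => -x) (D.get (Fin.cast h i))

/-- The total number of vertices encoded by a list of components. -/
def totalLen (L : List (List ℤ)) : ℕ := (L.map List.length).sum

/-- The canonical plumbing graph encoded by `P`, with dual encoded by `D`, fails
Property `X_k`: its dual admits an embedding into `ℤ^(n-k)`, where
`n = |V(G)| + |V(Γ)|`. -/
def FailsX (k : ℕ) (P D : List (List ℤ)) : Prop :=
  k ≤ totalLen P + totalLen D ∧
  ∃ φ : (ofList D).V → Fin (totalLen P + totalLen D - k) → ℤ,
    (ofList D).IsEmbedding (totalLen P + totalLen D - k) φ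

/-- The seventeen forbidden configurations of Theorem B (iii), encoded as lists of
path components. -/
def forbidden17 : List (List (List ℤ)) :=
  [[[-5, -2]], [[-6, -2, -2]], [[-2], [-2]], [[-3], [-2, -2]], [[-3, -2, -2, -3]],
   [[-3, -5, -3, -2]], [[-2, -2, -3, -5]], [[-4, -3, -2]], [[-3, -4, -2]],
   [[-4, -4, -2, -2]], [[-3, -4, -3, -3, -2]], [[-3, -3], [-2]], [[-3, -2, -3], [-3]],
   [[-4], [-4]], [[-4], [-3, -3]], [[-4], [-3, -2, -3]], [[-3, -3], [-3, -3]]]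

namespace Config

/-- A shallow vertex of a canonical plumbing graph. -/
def IsShallow (C : Config) (v : C.V) : Prop :=
  C.w v = -2 ∨ C.w v = -4 ∨
  (C.w v = -3 ∧ ∃ u, C.graph.Adj v u ∧ C.w u = -2) ∨
  (C.w v = -3 ∧ ∃ u, C.graph.Adj v u ∧ C.w u = -3)

/-- A deep vertex of a canonical plumbing graph. -/
def IsDeep (C : Config) (v : C.V) : Prop :=
  (5 ≤ |C.w v| ∧ ∀ u, C.graph.Adj v u → ¬ C.IsShallow u) ∨
  (C.w v = -3 ∧ ∀ u, ¬ C.graph.Adj v u)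

end Config

/-- Membership in `S_k`: a canonical plumbing graph (with its dual) which fails
Property `X_k` while every subgraph induced by a proper subset of its vertices
satisfies Property `X_k`. -/
def MemSk (k : ℕ) (P D : List (List ℤ)) : Prop :=
  IsDualPair P D ∧ FailsX k P D ∧
  ∀ S : Set (ofList P).V, S ≠ Set.univ →
    ∀ P' D' : List (List ℤ), IsDualPair P' D' →
      IsInducedOn (ofList P') (ofList P) S → ¬ FailsX k P' D'

set_option linter.unusedSectionVars false

section Lattice
open scoped Matrix
open Finset

variable {E : Type} [Fintype E] [DecidableEq E] {ι : Type}

/-- The integer functions on `E` whose sum over `I i` vanishes for every `i ∈ S`. -/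
def Flows (I : ι → Finset E) (S : Set ι) : AddSubgroup (E → ℤ) where
  carrier := {x | ∀ i ∈ S, ∑ e ∈ I i, x e = 0}
  zero_mem' := by intro i _; simp
  add_mem' := by
    intro x y hx hy i hi
    simp [Finset.sum_add_distrib, hx i hi, hy i hi]
  neg_mem' := by
    intro x hx i hi
    simp [hx i hi]

theorem mem_flows {I : ι → Finset E} {S : Set ι} {x : E → ℤ} :
    x ∈ Flows I S ↔ ∀ i ∈ S, ∑ e ∈ I i, x e = 0 := Iff.rfl

theorem flows_anti {I : ι → Finset E} {S T : Set ι} (h : S ⊆ T) : Flows I T ≤ Flows I S :=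
  fun _ hx i hi => hx i (h hi)

/-- `F` preserves the standard inner products of the elements of `Λ`. -/
def IsIsom {J : Type} [Fintype J] (Λ : AddSubgroup (E → ℤ)) (F : (E → ℤ) → J → ℤ) : Prop :=
  ∀ x ∈ Λ, ∀ y ∈ Λ, F x ⬝ᵥ F y = x ⬝ᵥ y

/-- The lattice `Flows I S` embeds isometrically in a standard lattice of rank `|E| - k`. -/
def Fails (k : ℕ) (I : ι → Finset E) (S : Set ι) : Prop :=
  ∃ (J : Type) (_ : Fintype J) (F : (E → ℤ) → J → ℤ),
    Fintype.card J + k = Fintype.card E ∧ IsIsom (Flows I S) F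

theorem Fails.mono {k : ℕ} {I : ι → Finset E} {S T : Set ι} (h : S ⊆ T) (hS : Fails k I S) :
    Fails k I T := by
  obtain ⟨J, hJ, F, hc, hF⟩ := hS
  exact ⟨J, hJ, F, hc, fun x hx y hy => hF x (flows_anti h hx) y (flows_anti h hy)⟩

theorem dotProduct_self_nonneg' {J : Type} [Fintype J] (x : J → ℤ) : 0 ≤ x ⬝ᵥ x :=
  Finset.sum_nonneg fun i _ => mul_self_nonneg (x i)

theorem IsIsom.map_zero {J : Type} [Fintype J] {Λ : AddSubgroup (E → ℤ)} {F : (E → ℤ) → J → ℤ}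
    (hF : IsIsom Λ F) : F 0 = 0 :=
  dotProduct_self_eq_zero.1 (by simpa using hF 0 Λ.zero_mem 0 Λ.zero_mem)

theorem IsIsom.map_add {J : Type} [Fintype J] {Λ : AddSubgroup (E → ℤ)} {F : (E → ℤ) → J → ℤ}
    (hF : IsIsom Λ F) {x y : E → ℤ} (hx : x ∈ Λ) (hy : y ∈ Λ) : F (x + y) = F x + F y := by
  rw [← sub_eq_zero, ← dotProduct_self_eq_zero]
  have hxy := Λ.add_mem hx hy
  simp only [sub_dotProduct, dotProduct_sub, add_dotProduct, dotProduct_add,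
    hF _ hxy _ hxy, hF _ hxy _ hx, hF _ hxy _ hy, hF _ hx _ hxy, hF _ hy _ hxy, hF _ hx _ hy,
    hF _ hy _ hx, hF _ hx _ hx, hF _ hy _ hy]
  ring

theorem IsIsom.map_neg {J : Type} [Fintype J] {Λ : AddSubgroup (E → ℤ)} {F : (E → ℤ) → J → ℤ}
    (hF : IsIsom Λ F) {x : E → ℤ} (hx : x ∈ Λ) : F (-x) = -F x := by
  have h := hF.map_add hx (Λ.neg_mem hx)
  rw [add_neg_cancel, hF.map_zero] at h
  exact (neg_eq_of_add_eq_zero_right h.symm).symm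

/-- Bessel's inequality for orthonormal integer vectors. -/
theorem bessel {J α : Type} [Fintype J] [DecidableEq α] (s : Finset α) (v : α → J → ℤ)
    (hv : ∀ a ∈ s, ∀ b ∈ s, v a ⬝ᵥ v b = if a = b then 1 else 0) (x : J → ℤ) :
    ∑ a ∈ s, (x ⬝ᵥ v a) ^ 2 ≤ x ⬝ᵥ x := by
  have h := dotProduct_self_nonneg' (x - ∑ a ∈ s, (x ⬝ᵥ v a) • v a)
  have h1 : (∑ a ∈ s, (x ⬝ᵥ v a) • v a) ⬝ᵥ x = ∑ a ∈ s, (x ⬝ᵥ v a) ^ 2 := by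
    rw [sum_dotProduct]
    refine Finset.sum_congr rfl fun a _ => ?_
    rw [smul_dotProduct, dotProduct_comm, smul_eq_mul, sq]
  have h2 : (∑ a ∈ s, (x ⬝ᵥ v a) • v a) ⬝ᵥ (∑ a ∈ s, (x ⬝ᵥ v a) • v a)
      = ∑ a ∈ s, (x ⬝ᵥ v a) ^ 2 := by
    rw [sum_dotProduct]
    refine Finset.sum_congr rfl fun a ha => ?_
    rw [dotProduct_sum]
    rw [Finset.sum_eq_single a]
    · rw [smul_dotProduct, dotProduct_smul, hv a ha a ha]; simp [sq]
    · intro b hb hba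
      rw [smul_dotProduct, dotProduct_smul, hv a ha b hb, if_neg hba.symm]; simp
    · exact fun h => absurd ha h
  have h3 : x ⬝ᵥ (∑ a ∈ s, (x ⬝ᵥ v a) • v a) = ∑ a ∈ s, (x ⬝ᵥ v a) ^ 2 := by
    rw [dotProduct_comm, h1]
  rw [sub_dotProduct, dotProduct_sub, dotProduct_sub, h2, h1, h3] at h
  linarith

end Lattice

section Line
open scoped Matrix
open Finset

variable {E : Type} [Fintype E] [DecidableEq E]

/-- `I` models, on the vertices in `V`, a disjoint union of paths of consecutive integers: the
vertex `i` has weight `#(I i)`, and the intersections record the adjacencies. -/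
structure IsLine (I : ℤ → Finset E) (V : Finset ℤ) : Prop where
  two_le : ∀ i ∈ V, 2 ≤ #(I i)
  adj : ∀ i ∈ V, i + 1 ∈ V → #(I i ∩ I (i + 1)) = 1
  far : ∀ i ∈ V, ∀ j ∈ V, i + 1 < j → Disjoint (I i) (I j)

theorem IsLine.mono {I : ℤ → Finset E} {V S : Finset ℤ} (h : IsLine I V) (hS : S ⊆ V) :
    IsLine I S :=
  ⟨fun i hi => h.two_le i (hS hi), fun i hi hj => h.adj i (hS hi) (hS hj),
    fun i hi j hj => h.far i (hS hi) j (hS hj)⟩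

/-- The elements of `I i` lying in no other `I j` with `j ∈ S`. -/
def leaf (I : ℤ → Finset E) (S : Finset ℤ) (i : ℤ) : Finset E :=
  (I i).filter fun e => ∀ j ∈ S, e ∈ I j → j = i

theorem mem_leaf {I : ℤ → Finset E} {S : Finset ℤ} {i : ℤ} {e : E} :
    e ∈ leaf I S i ↔ e ∈ I i ∧ ∀ j ∈ S, e ∈ I j → j = i := by
  simp [leaf]

theorem leaf_anti {I : ℤ → Finset E} {S T : Finset ℤ} (h : S ⊆ T) (i : ℤ) :
    leaf I T i ⊆ leaf I S i := fun e he => by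
  rw [mem_leaf] at he ⊢
  exact ⟨he.1, fun j hj => he.2 j (h hj)⟩

theorem IsLine.eq_or {I : ℤ → Finset E} {V : Finset ℤ} (h : IsLine I V) {i j : ℤ} (hi : i ∈ V)
    (hj : j ∈ V) {e : E} (hei : e ∈ I i) (hej : e ∈ I j) : j = i - 1 ∨ j = i ∨ j = i + 1 := by
  by_contra hc
  rcases lt_or_ge (i + 1) j with h1 | h1
  · exact Finset.disjoint_left.1 (h.far i hi j hj h1) hei hej
  · exact Finset.disjoint_left.1 (h.far j hj i hi (by omega)) hej hei

theorem IsLine.exists_edge {I : ℤ → Finset E} {V : Finset ℤ} (h : IsLine I V) {i : ℤ} (hi : i ∈ V)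
    (hj : i + 1 ∈ V) : ∃ e, I i ∩ I (i + 1) = {e} :=
  Finset.card_eq_one.1 (h.adj i hi hj)

/-- The reflection of a line. -/
theorem IsLine.reflect {I : ℤ → Finset E} {V : Finset ℤ} (h : IsLine I V) :
    IsLine (fun i => I (-i)) (V.image fun i => -i) := by
  have hm : ∀ i, i ∈ V.image (fun i => -i) ↔ -i ∈ V := by
    intro i
    simp only [mem_image]
    exact ⟨fun ⟨a, ha, hai⟩ => by rw [← hai, neg_neg]; exact ha, fun hi => ⟨-i, hi, neg_neg i⟩⟩
  refine ⟨fun i hi => h.two_le _ ((hm i).1 hi), fun i hi hj => ?_, fun i hi j hj hij => ?_⟩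
  · have h1 := (hm _).1 hj
    have := h.adj (-(i + 1)) h1 (by rw [show -(i + 1) + 1 = -i by ring]; exact (hm i).1 hi)
    rwa [show -(i + 1) + 1 = -i by ring, inter_comm] at this
  · exact (h.far _ ((hm j).1 hj) _ ((hm i).1 hi) (by omega)).symm

theorem mem_image_neg {V : Finset ℤ} {i : ℤ} : i ∈ V.image (fun i => -i) ↔ -i ∈ V := by
  simp only [mem_image]
  exact ⟨fun ⟨a, ha, hai⟩ => by rw [← hai, neg_neg]; exact ha, fun hi => ⟨-i, hi, neg_neg i⟩⟩

theorem leaf_reflect (I : ℤ → Finset E) (V : Finset ℤ) (i : ℤ) :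
    leaf (fun i => I (-i)) (V.image fun i => -i) i = leaf I V (-i) := by
  ext e
  simp only [mem_leaf, mem_image_neg]
  refine and_congr_right fun _ => ⟨fun h j hj he => ?_, fun h j hj he => ?_⟩
  · have := h (-j) (by simpa using hj) (by simpa using he)
    omega
  · have := h (-j) hj he
    omega

/-- The vertices of `S` next to `i`. -/
def nbr (S : Finset ℤ) (i : ℤ) : Finset ℤ := S.filter fun j => j = i - 1 ∨ j = i + 1

theorem mem_nbr {S : Finset ℤ} {i j : ℤ} : j ∈ nbr S i ↔ j ∈ S ∧ (j = i - 1 ∨ j = i + 1) := by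
  simp [nbr]

theorem card_nbr_le (S : Finset ℤ) (i : ℤ) : #(nbr S i) ≤ 2 := by
  have : nbr S i ⊆ {i - 1, i + 1} := fun j hj => by
    rw [mem_nbr] at hj; simp [hj.2]
  exact (card_le_card this).trans (card_le_two)

theorem IsLine.edge_nbr {I : ℤ → Finset E} {V : Finset ℤ} (h : IsLine I V) {i j : ℤ} (hi : i ∈ V)
    (hj : j ∈ nbr V i) : ∃ e, I i ∩ I j = {e} := by
  rw [mem_nbr] at hj
  obtain ⟨hj, rfl | rfl⟩ := hj
  · obtain ⟨e, he⟩ := h.exists_edge hj (by simpa using hi)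
    refine ⟨e, ?_⟩
    rw [inter_comm]; simpa using he
  · exact h.exists_edge hi hj

/-- Every weight is the number of leaves plus the number of neighbours. -/
theorem IsLine.card_eq {I : ℤ → Finset E} {V : Finset ℤ} (h : IsLine I V) {i : ℤ} (hi : i ∈ V) :
    #(I i) = #(leaf I V i) + #(nbr V i) := by
  have hdec : I i = leaf I V i ∪ (nbr V i).biUnion fun j => I i ∩ I j := by
    ext e
    simp only [mem_union, mem_leaf, mem_biUnion, mem_inter]
    constructor
    · intro he
      by_cases hl : ∀ j ∈ V, e ∈ I j → j = i
      · exact Or.inl ⟨he, hl⟩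
      · push Not at hl
        obtain ⟨j, hj, hej, hne⟩ := hl
        refine Or.inr ⟨j, ?_, he, hej⟩
        rw [mem_nbr]
        exact ⟨hj, by have := h.eq_or hi hj he hej; tauto⟩
    · rintro (h1 | ⟨j, -, h1, -⟩)
      exacts [h1.1, h1]
  conv_lhs => rw [hdec]
  rw [card_union_of_disjoint, card_biUnion]
  · congr 1
    rw [card_eq_sum_ones]
    refine sum_congr rfl fun j hj => ?_
    obtain ⟨e, he⟩ := h.edge_nbr hi hj
    rw [he, card_singleton]
  · intro j hj j' hj' hne
    rw [mem_coe, mem_nbr] at hj hj'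
    simp only [Function.onFun]
    rw [Finset.disjoint_left]
    intro e he he'
    rw [mem_inter] at he he'
    have := h.eq_or hj.1 hj'.1 he.2 he'.2
    omega
  · rw [Finset.disjoint_left]
    intro e he he'
    rw [mem_leaf] at he
    simp only [mem_biUnion, mem_inter, mem_nbr] at he'
    obtain ⟨j, hj, -, hej⟩ := he'
    have := he.2 j hj.1 hej
    omega

theorem IsLine.of_leaf_empty {I : ℤ → Finset E} {V : Finset ℤ} (h : IsLine I V) {i : ℤ}
    (hi : i ∈ V) (hl : leaf I V i = ∅) : #(I i) = 2 ∧ i - 1 ∈ V ∧ i + 1 ∈ V := by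
  have h1 := h.card_eq hi
  have h2 := h.two_le i hi
  have h3 := card_nbr_le V i
  rw [hl, card_empty, zero_add] at h1
  have h4 : nbr V i = {i - 1, i + 1} := by
    refine eq_of_subset_of_card_le (fun j hj => ?_) ?_
    · rw [mem_nbr] at hj; simp [hj.2]
    · exact card_le_two.trans (by omega)
  have h5 : i - 1 ∈ nbr V i := by rw [h4]; simp
  have h6 : i + 1 ∈ nbr V i := by rw [h4]; simp
  rw [mem_nbr] at h5 h6
  exact ⟨by omega, h5.1, h6.1⟩

/-- The indicator function of an element. -/
def unit (e : E) : E → ℤ := Pi.single e 1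

@[simp] theorem unit_self (e : E) : unit e e = 1 := by simp [unit]

theorem unit_ne {e f : E} (h : f ≠ e) : unit e f = 0 := by simp [unit, h]

theorem unit_apply (e f : E) : unit e f = if f = e then 1 else 0 := by
  simp [unit, Pi.single_apply]

@[simp] theorem unit_dot (e : E) (x : E → ℤ) : unit e ⬝ᵥ x = x e := by simp [unit]

@[simp] theorem dot_unit (e : E) (x : E → ℤ) : x ⬝ᵥ unit e = x e := by simp [unit]

theorem sum_unit (e : E) (s : Finset E) : ∑ f ∈ s, unit e f = if e ∈ s then 1 else 0 := by
  simp [unit_apply]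

theorem unit_sub_mem {I : ℤ → Finset E} {V : Finset ℤ} {i : ℤ} {e f : E} (he : e ∈ leaf I V i)
    (hf : f ∈ leaf I V i) : unit e - unit f ∈ Flows I (V : Set ℤ) := by
  intro j hj
  simp only [Pi.sub_apply, sum_sub_distrib, sum_unit]
  rw [mem_leaf] at he hf
  by_cases hji : j = i
  · subst hji; simp [he.1, hf.1]
  · rw [if_neg fun h => hji (he.2 j hj h), if_neg fun h => hji (hf.2 j hj h), sub_self]

theorem unit_mem {ι : Type} {I : ι → Finset E} {S : Set ι} {e : E} (he : ∀ j ∈ S, e ∉ I j) :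
    unit e ∈ Flows I S := by
  intro j hj
  rw [sum_unit, if_neg (he j hj)]

/-- `x` is the alternating sum along the path of vertices `i, …, j` from the leaf `e` at `i` to the
leaf `e'` at `j`. -/
structure IsPath (I : ℤ → Finset E) (V : Finset ℤ) (i j : ℤ) (e e' : E) (x : E → ℤ) : Prop where
  left : e ∈ leaf I V i
  right : e' ∈ leaf I V j
  le : i ≤ j
  ne : e ≠ e'
  icc : ∀ l, i ≤ l → l ≤ j → l ∈ V
  mem : x ∈ Flows I (V : Set ℤ)
  one : x e = 1
  sq : x e' ^ 2 = 1
  supp : ∀ l ∈ V, l < i ∨ j < l → ∀ f ∈ I l, x f = 0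
  leaf_zero : ∀ l, ∀ f ∈ leaf I V l, f ≠ e → f ≠ e' → x f = 0
  off : ∀ f, (∀ l ∈ V, f ∉ I l) → x f = 0
  norm : x ⬝ᵥ x = j - i + 2

theorem IsLine.exists_path_aux {I : ℤ → Finset E} (n : ℕ) : ∀ {V : Finset ℤ}, IsLine I V →
    ∀ {i j : ℤ} {e e' : E}, j = i + n → e ∈ leaf I V i → e' ∈ leaf I V j → e ≠ e' →
    (∀ l, i ≤ l → l ≤ j → l ∈ V) → (∀ l ∈ V, l ≤ j) → ∃ x, IsPath I V i j e e' x := by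
  induction n with
  | zero =>
    intro V h i j e e' hj he he' hne hV _
    have hij : j = i := by simpa using hj
    subst hij
    refine ⟨unit e - unit e', he, he', le_rfl, hne, hV, unit_sub_mem he he', ?_, ?_, ?_, ?_, ?_, ?_⟩
    · simp [unit_ne hne]
    · simp [unit_ne hne.symm]
    · intro l hl hlj f hf
      rw [mem_leaf] at he he'
      have h1 : f ≠ e := fun hfe => by have := he.2 l hl (hfe ▸ hf); omega
      have h2 : f ≠ e' := fun hfe => by have := he'.2 l hl (hfe ▸ hf); omega
      simp [unit_ne h1, unit_ne h2]
    · intro l f _ h1 h2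
      simp [unit_ne h1, unit_ne h2]
    · intro f hf
      rw [mem_leaf] at he he'
      have hjV := hV j le_rfl le_rfl
      have h1 : f ≠ e := fun hfe => hf j hjV (hfe ▸ he.1)
      have h2 : f ≠ e' := fun hfe => hf j hjV (hfe ▸ he'.1)
      simp [unit_ne h1, unit_ne h2]
    · simp [sub_dotProduct, dotProduct_sub, unit_ne hne, unit_ne hne.symm]
  | succ n ih =>
    intro V h i j e e' hj he he' hne hV hmax
    push_cast at hj
    obtain ⟨hh, hedge⟩ := h.exists_edge (i := j - 1) (hV _ (by omega) (by omega))
      (by simpa using hV j (by omega) le_rfl)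
    rw [sub_add_cancel] at hedge
    have hjV := hV j (by omega) le_rfl
    have hhm : hh ∈ I (j - 1) ∧ hh ∈ I j := by rw [← mem_inter, hedge]; simp
    have hsub : V.filter (· ≤ j - 1) ⊆ V := filter_subset _ _
    have hhl : hh ∈ leaf I (V.filter (· ≤ j - 1)) (j - 1) := by
      rw [mem_leaf]
      refine ⟨hhm.1, fun l hl hhl => ?_⟩
      rw [mem_filter] at hl
      have := h.eq_or hjV hl.1 hhm.2 hhl
      omega
    have heh : e ≠ hh := fun hc => by
      have := (mem_leaf.1 he).2 j hjV (hc ▸ hhm.2)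
      omega
    obtain ⟨x, hx⟩ := ih (h.mono hsub) (i := i) (j := j - 1) (e := e) (e' := hh) (by omega)
      (leaf_anti hsub _ he) hhl heh
      (fun l h1 h2 => mem_filter.2 ⟨hV l h1 (by omega), h2⟩) (fun l hl => (mem_filter.1 hl).2)
    have hoff : ∀ f ∈ I j, f ≠ hh → x f = 0 := by
      intro f hf hfh
      refine hx.off f fun l hl hfl => hfh ?_
      rw [mem_filter] at hl
      have hl' := h.eq_or hjV hl.1 hf hfl
      have : l = j - 1 := by omega
      subst this
      have : f ∈ I (j - 1) ∩ I j := mem_inter.2 ⟨hfl, hf⟩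
      simpa [hedge] using this
    have he'j := (mem_leaf.1 he')
    have hxe' : x e' = 0 := hoff e' he'j.1 fun hc => by
      have := he'j.2 (j - 1) (hV _ (by omega) (by omega)) (hc ▸ hhm.1)
      omega
    have hval : ∀ f, f ≠ e' → (x - x hh • unit e') f = x f := by
      intro f hf
      simp [unit_ne hf]
    have hval' : (x - x hh • unit e') e' = - x hh := by simp [hxe']
    refine ⟨x - x hh • unit e', he, he', by omega, hne, hV, ?_, ?_, ?_, ?_, ?_, ?_, ?_⟩
    · intro l hl
      simp only [Pi.sub_apply, Pi.smul_apply, sum_sub_distrib, ← smul_sum, sum_unit]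
      by_cases hlj : l = j
      · subst hlj
        rw [sum_eq_single_of_mem hh hhm.2 fun f hf hne => hoff f hf hne]
        simp [he'j.1]
      · have h1 := hmax l hl
        rw [if_neg fun hc => hlj (he'j.2 l hl hc),
          hx.mem l (by rw [mem_coe, mem_filter]; exact ⟨hl, by omega⟩)]
        simp
    · rw [hval e hne, hx.one]
    · rw [hval', neg_sq, hx.sq]
    · intro l hl hlij f hf
      have h1 := hmax l hl
      rw [hval f fun hc => by have := he'j.2 l hl (hc ▸ hf); omega]
      exact hx.supp l (mem_filter.2 ⟨hl, by omega⟩) (by omega) f hf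
    · intro l f hf h1 h2
      rw [hval f h2]
      by_cases hfh : f = hh
      · exfalso
        subst hfh
        rw [mem_leaf] at hf
        have h3 := hf.2 _ hjV hhm.2
        have h4 := hf.2 (j - 1) (hV _ (by omega) (by omega)) hhm.1
        omega
      · exact hx.leaf_zero l f (leaf_anti hsub _ hf) h1 hfh
    · intro f hf
      rw [hval f fun hc => hf j hjV (hc ▸ he'j.1)]
      exact hx.off f fun l hl => hf l (hsub hl)
    · simp only [sub_dotProduct, dotProduct_sub, smul_dotProduct, dotProduct_smul, unit_dot,
        dot_unit, hxe', hx.norm, unit_self, smul_eq_mul, mul_zero, sub_zero, mul_one]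
      have := hx.sq
      nlinarith

theorem IsLine.exists_path {I : ℤ → Finset E} {V : Finset ℤ} (h : IsLine I V) {i j : ℤ} {e e' : E}
    (hij : i ≤ j) (he : e ∈ leaf I V i) (he' : e' ∈ leaf I V j) (hne : e ≠ e')
    (hV : ∀ l, i ≤ l → l ≤ j → l ∈ V) : ∃ x, IsPath I V i j e e' x := by
  have hsub : V.filter (· ≤ j) ⊆ V := filter_subset _ _
  obtain ⟨x, hx⟩ := exists_path_aux (j - i).toNat (h.mono hsub) (i := i) (j := j) (e := e)
    (e' := e') (by omega) (leaf_anti hsub _ he) (leaf_anti hsub _ he') hne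
    (fun l h1 h2 => mem_filter.2 ⟨hV l h1 h2, h2⟩) (fun l hl => (mem_filter.1 hl).2)
  have hlt : ∀ l ∈ V, j < l → ∀ f ∈ I l, x f = 0 := by
    intro l hl hjl f hf
    by_cases hc : ∀ m ∈ V.filter (· ≤ j), f ∉ I m
    · exact hx.off f hc
    · push Not at hc
      obtain ⟨m, hm, hfm⟩ := hc
      rw [mem_filter] at hm
      have h1 := h.eq_or hm.1 hl hfm hf
      have hmj : m = j := by omega
      subst hmj
      refine hx.leaf_zero m f ?_ ?_ ?_
      · rw [mem_leaf]
        refine ⟨hfm, fun l' hl' hfl' => ?_⟩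
        rw [mem_filter] at hl'
        have h2 := h.eq_or hl hl'.1 hf hfl'
        omega
      · rintro rfl
        have := (mem_leaf.1 he).2 l hl hf
        omega
      · rintro rfl
        have := (mem_leaf.1 he').2 l hl hf
        omega
  refine ⟨x, he, he', hij, hne, hV, ?_, hx.one, hx.sq, ?_, ?_, ?_, hx.norm⟩
  · intro l hl
    by_cases hlj : l ≤ j
    · exact hx.mem l (by simpa using ⟨hl, hlj⟩)
    · exact sum_eq_zero (hlt l hl (by omega))
  · rintro l hl h1 f hf
    by_cases hlj : l ≤ j
    · exact hx.supp l (mem_filter.2 ⟨hl, hlj⟩) h1 f hf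
    · exact hlt l hl (by omega) f hf
  · exact fun l f hf => hx.leaf_zero l f (leaf_anti hsub _ hf)
  · exact fun f hf => hx.off f fun l hl => hf l (hsub hl)

/-- `i < j` are consecutive vertices with leaves on one component. -/
structure IsGap (I : ℤ → Finset E) (V : Finset ℤ) (i j : ℤ) : Prop where
  lt : i < j
  icc : ∀ l, i ≤ l → l ≤ j → l ∈ V
  left : (leaf I V i).Nonempty
  right : (leaf I V j).Nonempty
  ioo : ∀ l, i < l → l < j → leaf I V l = ∅

theorem IsLine.exists_leafy_left {I : ℤ → Finset E} {V : Finset ℤ} (h : IsLine I V) (m : ℤ)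
    (n : ℕ) : ∀ i, i < m → #(V.filter (· < i)) = n → (∀ l, i ≤ l → l ≤ m → l ∈ V) →
    (∀ l, i < l → l < m → leaf I V l = ∅) →
    ∃ i, i < m ∧ (∀ l, i ≤ l → l ≤ m → l ∈ V) ∧ (leaf I V i).Nonempty ∧
      ∀ l, i < l → l < m → leaf I V l = ∅ := by
  induction n using Nat.strong_induction_on with
  | _ n ih =>
    intro i him hn hV hl
    by_cases hi : (leaf I V i).Nonempty
    · exact ⟨i, him, hV, hi, hl⟩
    · rw [not_nonempty_iff_eq_empty] at hi
      obtain ⟨-, h1, -⟩ := h.of_leaf_empty (hV i le_rfl him.le) hi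
      refine ih _ ?_ (i - 1) (by omega) rfl (fun l h2 h3 => ?_) (fun l h2 h3 => ?_)
      · rw [← hn]
        refine card_lt_card ⟨fun l hl => ?_, fun hc => ?_⟩
        · rw [mem_filter] at hl ⊢
          exact ⟨hl.1, by omega⟩
        · have := hc (mem_filter.2 ⟨h1, by omega⟩)
          simp at this
      · rcases eq_or_lt_of_le h2 with h4 | h4
        · exact h4 ▸ h1
        · exact hV l (by omega) h3
      · rcases eq_or_lt_of_le (show i ≤ l by omega) with h4 | h4
        · exact h4 ▸ hi
        · exact hl l h4 h3

theorem IsLine.exists_gap_left {I : ℤ → Finset E} {V : Finset ℤ} (h : IsLine I V) {m : ℤ}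
    (hm : m ∈ V) (hm1 : m - 1 ∈ V) (hl : (leaf I V m).Nonempty) : ∃ i, IsGap I V i m := by
  obtain ⟨i, h1, h2, h3, h4⟩ := h.exists_leafy_left m _ (m - 1) (by omega) rfl
    (fun l h1 h2 => by
      obtain rfl | rfl : l = m - 1 ∨ l = m := by omega
      exacts [hm1, hm]) (fun l _ _ => by omega)
  exact ⟨i, h1, h2, h3, hl, h4⟩

/-- The flows are generated by the units off the line, the differences of leaves at a vertex, and
one path across each gap. -/
theorem IsLine.flows_le {I : ℤ → Finset E} {V : Finset ℤ} (h : IsLine I V)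
    (K : AddSubgroup (E → ℤ)) (h1 : ∀ e, (∀ i ∈ V, e ∉ I i) → unit e ∈ K)
    (h2 : ∀ i ∈ V, ∀ e ∈ leaf I V i, ∀ e' ∈ leaf I V i, unit e - unit e' ∈ K)
    (h3 : ∀ i j, IsGap I V i j → ∃ e e' x, IsPath I V i j e e' x ∧ x ∈ K) :
    Flows I (V : Set ℤ) ≤ K := by
  have key : ∀ n : ℕ, ∀ x ∈ Flows I (V : Set ℤ), ∀ m : ℤ,
      (∀ l ∈ V, m ≤ l → ∀ f ∈ I l, x f = 0) → #(V.filter (· < m)) = n → x ∈ K := by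
    intro n
    induction n using Nat.strong_induction_on with
    | _ n ih =>
    intro x hx m hm hn
    rcases (V.filter (· < m)).eq_empty_or_nonempty with hemp | hne
    · have hall : ∀ l ∈ V, ∀ f ∈ I l, x f = 0 := fun l hl => hm l hl (by
        by_contra hc
        have : l ∈ V.filter (· < m) := mem_filter.2 ⟨hl, by omega⟩
        simp [hemp] at this)
      have : x = ∑ e, x e • unit e := by
        ext f
        simp [unit_apply]
      rw [this]
      refine K.sum_mem fun e _ => ?_
      by_cases he : ∀ i ∈ V, e ∉ I i
      · exact K.zsmul_mem (h1 e he) _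
      · push Not at he
        obtain ⟨l, hl, hel⟩ := he
        rw [hall l hl e hel, zero_smul]
        exact K.zero_mem
    · set q := (V.filter (· < m)).max' hne with hq
      have hqm := mem_filter.1 (max'_mem _ hne)
      rw [← hq] at hqm
      have hle : ∀ l ∈ V, l < m → l ≤ q := fun l hl hlm =>
        le_max' _ _ (mem_filter.2 ⟨hl, hlm⟩)
      have hlt : ∀ l ∈ V, q < l → ∀ f ∈ I l, x f = 0 := fun l hl hql =>
        hm l hl (by by_contra hc; have := hle l hl (by omega); omega)
      have hcard : #(V.filter (· < q)) < n := by
        rw [← hn]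
        refine card_lt_card ⟨fun l hl => ?_, fun hc => ?_⟩
        · rw [mem_filter] at hl ⊢
          exact ⟨hl.1, by omega⟩
        · have := hc (mem_filter.2 hqm)
          simp at this
      have finish : ∀ y ∈ Flows I (V : Set ℤ), (∀ l ∈ V, q < l → ∀ f ∈ I l, y f = 0) →
          (∀ f ∈ leaf I V q, y f = 0) → y ∈ K := by
        intro y hy hy1 hy2
        refine ih _ hcard y hy q (fun l hl hql f hf => ?_) rfl
        rcases eq_or_lt_of_le hql with hc | hc
        · subst hc
          have h0 : ∀ f ∈ I q, (q - 1 ∈ V → f ∉ I (q - 1)) → y f = 0 := by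
            intro f hf hf1
            by_cases hfl : f ∈ leaf I V q
            · exact hy2 f hfl
            · rw [mem_leaf] at hfl
              push Not at hfl
              obtain ⟨j, hj, hfj, hne⟩ := hfl hf
              have := h.eq_or hqm.1 hj hf hfj
              obtain rfl | rfl : j = q - 1 ∨ j = q + 1 := by omega
              · exact absurd hfj (hf1 hj)
              · exact hy1 _ hj (by omega) f hfj
          by_cases hf1 : q - 1 ∈ V ∧ f ∈ I (q - 1)
          · have hs := hy q hqm.1
            rw [sum_eq_single_of_mem f hf fun g hg hgf => ?_] at hs
            · exact hs
            · refine h0 g hg fun _ hg1 => hgf ?_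
              obtain ⟨e, he⟩ := h.exists_edge hf1.1 (by simpa using hqm.1)
              rw [sub_add_cancel] at he
              have h5 : g ∈ I (q - 1) ∩ I q := mem_inter.2 ⟨hg1, hg⟩
              have h6 : f ∈ I (q - 1) ∩ I q := mem_inter.2 ⟨hf1.2, hf⟩
              rw [he, mem_singleton] at h5 h6
              rw [h5, h6]
          · exact h0 f hf fun h4 h5 => hf1 ⟨h4, h5⟩
        · exact hy1 l hl hc f hf
      rcases (leaf I V q).eq_empty_or_nonempty with hle | hlne
      · exact finish x hx hlt fun f hf => by simp [hle] at hf
      · have reduce : ∀ e₀ ∈ leaf I V q, ∀ y ∈ Flows I (V : Set ℤ),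
            (∀ l ∈ V, q < l → ∀ f ∈ I l, y f = 0) → ∃ z ∈ Flows I (V : Set ℤ),
            (∀ l ∈ V, q < l → ∀ f ∈ I l, z f = 0) ∧ (∀ f ∈ leaf I V q, f ≠ e₀ → z f = 0) ∧
            (z ∈ K → y ∈ K) := by
          intro e₀ he₀ y hy hy1
          set d := ∑ e ∈ leaf I V q, y e • (unit e - unit e₀) with hd
          have hdK : d ∈ K := K.sum_mem fun e he => K.zsmul_mem (h2 q hqm.1 e he e₀ he₀) _
          have hdF : d ∈ Flows I (V : Set ℤ) :=
            AddSubgroup.sum_mem _ fun e he => AddSubgroup.zsmul_mem _ (unit_sub_mem he he₀) _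
          refine ⟨y - d, AddSubgroup.sub_mem _ hy hdF, ?_, ?_, ?_⟩
          · intro l hl hql f hf
            have : d f = 0 := by
              rw [hd, Finset.sum_apply]
              refine sum_eq_zero fun e he => ?_
              have h5 : f ≠ e := fun hc => by
                have := (mem_leaf.1 he).2 l hl (hc ▸ hf); omega
              have h6 : f ≠ e₀ := fun hc => by
                have := (mem_leaf.1 he₀).2 l hl (hc ▸ hf); omega
              simp [unit_ne h5, unit_ne h6]
            rw [Pi.sub_apply, hy1 l hl hql f hf, this, sub_zero]
          · intro f hf hne
            have : d f = y f := by
              rw [hd, Finset.sum_apply, sum_eq_single_of_mem f hf]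
              · simp [unit_ne hne]
              · intro g _ hgf
                simp [unit_ne hne, unit_ne hgf.symm]
            rw [Pi.sub_apply, this, sub_self]
          · intro hz
            have := K.add_mem hz hdK
            rwa [sub_add_cancel] at this
        by_cases hq1 : q - 1 ∈ V
        · obtain ⟨i, hgap⟩ := h.exists_gap_left hqm.1 hq1 hlne
          obtain ⟨e, e', p, hp, hpK⟩ := h3 i q hgap
          obtain ⟨z, hz, hz1, hz2, hzK⟩ := reduce e' hp.right x hx hlt
          refine hzK ?_
          have : z = (z - (z e' * p e') • p) + (z e' * p e') • p := by abel
          rw [this]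
          refine K.add_mem (finish _ ?_ ?_ ?_) (K.zsmul_mem hpK _)
          · exact AddSubgroup.sub_mem _ hz (AddSubgroup.zsmul_mem _ hp.mem _)
          · intro l hl hql f hf
            simp [hz1 l hl hql f hf, hp.supp l hl (Or.inr hql) f hf]
          · intro f hf
            by_cases hfe : f = e'
            · subst hfe
              have := hp.sq
              simp only [Pi.sub_apply, Pi.smul_apply, smul_eq_mul]
              linear_combination (-z f) * this
            · have hfe1 : f ≠ e := fun hc => by
                have h5 := (mem_leaf.1 hf).2 i (hgap.icc i le_rfl hgap.lt.le)
                  (hc ▸ (mem_leaf.1 hp.left).1)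
                have := hgap.lt
                omega
              simp [hz2 f hf hfe, hp.leaf_zero q f hf hfe1 hfe]
        · obtain ⟨e₀, he₀⟩ := hlne
          obtain ⟨z, hz, hz1, hz2, hzK⟩ := reduce e₀ he₀ x hx hlt
          refine hzK (finish z hz hz1 fun f hf => ?_)
          by_cases hfe : f = e₀
          · subst hfe
            have hs := hz q hqm.1
            rwa [sum_eq_single_of_mem f (mem_leaf.1 hf).1 fun g hg hgf => ?_] at hs
            by_cases hgl : g ∈ leaf I V q
            · exact hz2 g hgl hgf
            · rw [mem_leaf] at hgl
              push Not at hgl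
              obtain ⟨j, hj, hgj, hne⟩ := hgl hg
              have := h.eq_or hqm.1 hj hg hgj
              obtain rfl | rfl : j = q - 1 ∨ j = q + 1 := by omega
              · exact absurd hj hq1
              · exact hz1 _ hj (by omega) g hgj
          · exact hz2 f hf hfe
  intro x hx
  rcases V.eq_empty_or_nonempty with hV | hV
  · exact key _ x hx 0 (fun l hl => by simp [hV] at hl) rfl
  · exact key _ x hx (V.max' hV + 1) (fun l hl h4 => by
      have := le_max' V l hl; omega) rfl

end Line

section Star
open scoped Matrix
open Finset

variable {E J : Type} [Fintype E] [DecidableEq E] [Fintype J]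

theorem sq_le_one_of_dot_self_eq_two {A : J → ℤ} (hA : A ⬝ᵥ A = 2) (c : J) : A c ^ 2 ≤ 1 := by
  classical
  have h : A c ^ 2 ≤ 2 := by
    rw [← hA, dotProduct, sq]
    exact single_le_sum (f := fun i => A i * A i) (fun i _ => mul_self_nonneg _) (mem_univ c)
  have h1 : |A c| < 2 := by
    by_contra! h1
    nlinarith [sq_abs (A c)]
  exact (sq_le_one_iff_abs_le_one _).2 (by omega)

/-- Vectors of norm two with pairwise products one share a common unit vector, except possibly for
the edges of a triangle. -/
theorem exists_common_unit {α : Type} [DecidableEq α] (T : Finset α) (A : α → J → ℤ)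
    (h2 : ∀ a ∈ T, A a ⬝ᵥ A a = 2) (h1 : ∀ a ∈ T, ∀ b ∈ T, a ≠ b → A a ⬝ᵥ A b = 1)
    (hT : 2 ≤ #T) (hY : #T ≠ 3 ∨ ∃ Y : J → ℤ, ∀ a ∈ T, Odd (Y ⬝ᵥ A a)) :
    ∃ e : J → ℤ, e ⬝ᵥ e = 1 ∧ ∀ a ∈ T, A a ⬝ᵥ e = 1 := by
  classical
  obtain ⟨a, ha, b, hb, hab⟩ := one_lt_card.1 hT
  obtain ⟨c, -, hc⟩ : ∃ c ∈ univ, 0 < A a c * A b c := by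
    by_contra! hcon
    have := sum_nonpos hcon
    have h := h1 a ha b hb hab
    rw [dotProduct] at h
    omega
  have hac := sq_le_one_of_dot_self_eq_two (h2 a ha) c
  have hbc := sq_le_one_of_dot_self_eq_two (h2 b hb) c
  have hac1 : A a c ^ 2 = 1 := by
    have : A a c ≠ 0 := fun h => by simp [h] at hc
    have := sq_pos_of_ne_zero this
    omega
  have hprod : A a c * A b c = 1 := by nlinarith [sq_nonneg (A a c - A b c)]
  set e : J → ℤ := A a c • Pi.single c 1 with he
  have hde : ∀ x : J → ℤ, x ⬝ᵥ e = A a c * x c := by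
    intro x
    rw [he, dotProduct_smul, dotProduct_single, mul_one, smul_eq_mul]
  have hee : e ⬝ᵥ e = 1 := by
    rw [hde, he]; simp [← sq, hac1]
  have hae : A a ⬝ᵥ e = 1 := by rw [hde, ← sq, hac1]
  have hbe : A b ⬝ᵥ e = 1 := by rw [hde, hprod]
  have hea := hae
  have heb := hbe
  rw [dotProduct_comm] at hea heb
  have hba := h1 b hb a ha hab.symm
  have hab1 := h1 a ha b hb hab
  refine ⟨e, hee, fun d hd => ?_⟩
  by_cases hda : d = a
  · rw [hda, hae]
  by_cases hdb : d = b
  · rw [hdb, hbe]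
  by_contra hne
  have hdA := h1 d hd a ha hda
  have hdB := h1 d hd b hb hdb
  have hAd := h1 a ha d hd (Ne.symm hda)
  have hBd := h1 b hb d hd (Ne.symm hdb)
  have hdd := h2 d hd
  have haa := h2 a ha
  have hbb := h2 b hb
  have hed : e ⬝ᵥ A d = A d ⬝ᵥ e := dotProduct_comm _ _
  generalize ht : A d ⬝ᵥ e = t at *
  have key := dotProduct_self_nonneg' (A d - t • e - (1 - t) • (A a - e) - (1 - t) • (A b - e))
  simp only [sub_dotProduct, dotProduct_sub, smul_dotProduct, dotProduct_smul, smul_eq_mul,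
    hdA, hdB, hAd, hBd, hdd, haa, hbb, hee, hea, heb, hae, hbe, hab1, hba, ht, hed] at key
  have ht0 : t = 0 := by
    have h3 : t < 2 := by nlinarith
    have h4 : -1 < t := by nlinarith
    omega
  subst ht0
  have hD : A d = A a + A b - (2 : ℤ) • e := by
    rw [← sub_eq_zero, ← dotProduct_self_eq_zero]
    simp only [sub_dotProduct, dotProduct_sub, add_dotProduct, dotProduct_add, smul_dotProduct,
      dotProduct_smul, smul_eq_mul, hdA, hdB, hAd, hBd, hdd, haa, hbb, hee, hea, heb, hae, hbe,
      hab1, hba, ht, hed]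
    norm_num
  have hfin : ∀ Y : J → ℤ, Odd (Y ⬝ᵥ A a) → Odd (Y ⬝ᵥ A b) → Odd (Y ⬝ᵥ A d) → False := by
    rintro Y ⟨p, hp⟩ ⟨q, hq⟩ ⟨r, hr⟩
    rw [hD, dotProduct_sub, dotProduct_add, dotProduct_smul, smul_eq_mul] at hr
    omega
  rcases hY with hY | ⟨Y, hY⟩
  · have h3 : #({a, b, d} : Finset α) = 3 := by
      rw [card_eq_three]
      exact ⟨a, b, d, hab, Ne.symm hda, Ne.symm hdb, rfl⟩
    have hss : ({a, b, d} : Finset α) ⊆ T := by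
      intro x hx
      simp only [mem_insert, mem_singleton] at hx
      rcases hx with rfl | rfl | rfl <;> assumption
    obtain ⟨f, hf, hfn⟩ : ∃ f ∈ T, f ∉ ({a, b, d} : Finset α) := by
      by_contra! hcon
      exact hY (by rw [← h3]; exact congrArg card (subset_antisymm hcon hss))
    simp only [mem_insert, mem_singleton, not_or] at hfn
    refine hfin (A f) ?_ ?_ ?_
    · rw [h1 f hf a ha hfn.1]; exact odd_one
    · rw [h1 f hf b hb hfn.2.1]; exact odd_one
    · rw [h1 f hf d hd hfn.2.2]; exact odd_one
  · exact hfin Y (hY a ha) (hY b hb) (hY d hd)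

/-- A unit vector `e₁` playing the role of the image of the leaf `l₁` of `v`. -/
structure IsStar (I : ℤ → Finset E) (V : Finset ℤ) (F : (E → ℤ) → J → ℤ) (v : ℤ) (l₁ : E)
    (e₁ : J → ℤ) : Prop where
  line : IsLine I V
  isom : IsIsom (Flows I (V : Set ℤ)) F
  mem : v ∈ V
  leaf : l₁ ∈ leaf I V v
  unit : e₁ ⬝ᵥ e₁ = 1
  dot : ∀ l ∈ LensPaper.leaf I V v, l ≠ l₁ →
    F (LensPaper.unit l₁ - LensPaper.unit l) ⬝ᵥ e₁ = 1

theorem exists_star {I : ℤ → Finset E} {V : Finset ℤ} {F : (E → ℤ) → J → ℤ} (h : IsLine I V)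
    (hF : IsIsom (Flows I (V : Set ℤ)) F) {v : ℤ} (hv : v ∈ V) (hr : 3 ≤ #(leaf I V v))
    (hx : #(leaf I V v) ≠ 4 ∨ ∃ x ∈ nbr V v, (leaf I V x).Nonempty) :
    ∃ l₁ e₁, IsStar I V F v l₁ e₁ := by
  obtain ⟨l₁, hl₁⟩ : (leaf I V v).Nonempty := card_pos.1 (by omega)
  have hcard := card_erase_of_mem hl₁
  have hm : ∀ l ∈ (leaf I V v).erase l₁, unit l₁ - unit l ∈ Flows I (V : Set ℤ) := fun l hl =>
    unit_sub_mem hl₁ (mem_of_mem_erase hl)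
  suffices hex : ∃ e₁ : J → ℤ, e₁ ⬝ᵥ e₁ = 1 ∧
      ∀ l ∈ (leaf I V v).erase l₁, F (unit l₁ - unit l) ⬝ᵥ e₁ = 1 by
    obtain ⟨e₁, he, hd⟩ := hex
    exact ⟨l₁, e₁, h, hF, hv, hl₁, he, fun l hl hne => hd l (mem_erase.2 ⟨hne, hl⟩)⟩
  refine exists_common_unit ((leaf I V v).erase l₁) (fun l => F (unit l₁ - unit l)) ?_ ?_
    (by omega) ?_
  · intro l hl
    have hne := ne_of_mem_erase hl
    rw [hF _ (hm l hl) _ (hm l hl)]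
    simp [sub_dotProduct, unit_ne hne, unit_ne hne.symm]
  · intro l hl l' hl' hll
    have hne := ne_of_mem_erase hl
    have hne' := ne_of_mem_erase hl'
    rw [hF _ (hm l hl) _ (hm l' hl')]
    simp [sub_dotProduct, unit_ne hne.symm, unit_ne hne', unit_ne hll.symm]
  · rcases hx with hx | ⟨x, hx, e', he'⟩
    · left; omega
    · right
      rw [mem_nbr] at hx
      have hne : l₁ ≠ e' := fun hc => by
        have := (mem_leaf.1 hl₁).2 x hx.1 (hc ▸ (mem_leaf.1 he').1)
        omega
      obtain ⟨y, hy, hy1, hy0⟩ : ∃ y ∈ Flows I (V : Set ℤ), y l₁ ^ 2 = 1 ∧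
          ∀ l ∈ leaf I V v, l ≠ l₁ → y l = 0 := by
        have hne' : ∀ l ∈ leaf I V v, l ≠ e' := fun l hl hc => by
          have := (mem_leaf.1 hl).2 x hx.1 (hc ▸ (mem_leaf.1 he').1)
          omega
        rcases hx.2 with h3 | h3
        · obtain ⟨y, hy⟩ := h.exists_path (i := x) (j := v) (by omega) he' hl₁ hne.symm
            (fun l h1 h2 => by
              obtain rfl | rfl : l = x ∨ l = v := by omega
              exacts [hx.1, hv])
          exact ⟨y, hy.mem, hy.sq, fun l hl h5 => hy.leaf_zero v l hl (hne' l hl) h5⟩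
        · obtain ⟨y, hy⟩ := h.exists_path (i := v) (j := x) (by omega) hl₁ he' hne
            (fun l h1 h2 => by
              obtain rfl | rfl : l = x ∨ l = v := by omega
              exacts [hx.1, hv])
          exact ⟨y, hy.mem, by rw [hy.one]; norm_num,
            fun l hl h5 => hy.leaf_zero v l hl h5 (hne' l hl)⟩
      refine ⟨F y, fun l hl => ?_⟩
      rw [hF _ hy _ (hm l hl), dotProduct_sub, dot_unit, dot_unit,
        hy0 l (mem_of_mem_erase hl) (ne_of_mem_erase hl), sub_zero]
      rcases sq_eq_one_iff.1 hy1 with h3 | h3 <;> rw [h3] <;> decide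

namespace IsStar

variable {I : ℤ → Finset E} {V : Finset ℤ} {F : (E → ℤ) → J → ℤ} {v : ℤ} {l₁ : E} {e₁ : J → ℤ}

/-- The flow of `x` out of `v`. -/
def defect (I : ℤ → Finset E) (v : ℤ) (x : E → ℤ) : ℤ := ∑ e ∈ I v, x e

/-- The extension of `F` to the flows of the line without `v` sending `l₁` to `e₁`. -/
def ext (I : ℤ → Finset E) (F : (E → ℤ) → J → ℤ) (v : ℤ) (l₁ : E) (e₁ : J → ℤ) (x : E → ℤ) :
    J → ℤ :=
  F (x - defect I v x • LensPaper.unit l₁) + defect I v x • e₁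

/-- The failure of the extension to be an isometry. -/
def kap (I : ℤ → Finset E) (F : (E → ℤ) → J → ℤ) (v : ℤ) (l₁ : E) (e₁ : J → ℤ) (x : E → ℤ) : ℤ :=
  ext I F v l₁ e₁ x ⬝ᵥ e₁ - x l₁

theorem defect_add (x y : E → ℤ) : defect I v (x + y) = defect I v x + defect I v y := by
  simp [defect, sum_add_distrib]

theorem defect_sub (x y : E → ℤ) : defect I v (x - y) = defect I v x - defect I v y := by
  simp [defect]

theorem defect_unit (e : E) : defect I v (LensPaper.unit e) = if e ∈ I v then 1 else 0 :=
  sum_unit e (I v)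

theorem sub_mem (s : IsStar I V F v l₁ e₁) {x : E → ℤ}
    (hx : x ∈ Flows I (V.erase v : Set ℤ)) :
    x - defect I v x • LensPaper.unit l₁ ∈ Flows I (V : Set ℤ) := by
  intro j hj
  simp only [Pi.sub_apply, Pi.smul_apply, sum_sub_distrib, ← smul_sum, sum_unit]
  have hl := mem_leaf.1 s.leaf
  by_cases hjv : j = v
  · subst hjv
    rw [if_pos hl.1]
    simp [defect]
  · rw [if_neg fun hc => hjv (hl.2 j hj hc), hx j (by simpa using ⟨hj, hjv⟩)]
    simp

theorem defect_eq_zero (s : IsStar I V F v l₁ e₁) {x : E → ℤ} (hx : x ∈ Flows I (V : Set ℤ)) :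
    defect I v x = 0 := hx v s.mem

theorem flows_erase {x : E → ℤ} (hx : x ∈ Flows I (V : Set ℤ)) :
    x ∈ Flows I (V.erase v : Set ℤ) :=
  flows_anti (by simp) hx

theorem ext_of_mem (s : IsStar I V F v l₁ e₁) {x : E → ℤ} (hx : x ∈ Flows I (V : Set ℤ)) :
    ext I F v l₁ e₁ x = F x := by
  simp [ext, s.defect_eq_zero hx]

theorem ext_add (s : IsStar I V F v l₁ e₁) {x y : E → ℤ} (hx : x ∈ Flows I (V.erase v : Set ℤ))
    (hy : y ∈ Flows I (V.erase v : Set ℤ)) :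
    ext I F v l₁ e₁ (x + y) = ext I F v l₁ e₁ x + ext I F v l₁ e₁ y := by
  simp only [ext, defect_add]
  rw [show x + y - (defect I v x + defect I v y) • LensPaper.unit l₁ =
    (x - defect I v x • LensPaper.unit l₁) + (y - defect I v y • LensPaper.unit l₁) by
      rw [add_smul]; abel, s.isom.map_add (s.sub_mem hx) (s.sub_mem hy), add_smul]
  abel

theorem kap_add (s : IsStar I V F v l₁ e₁) {x y : E → ℤ} (hx : x ∈ Flows I (V.erase v : Set ℤ))
    (hy : y ∈ Flows I (V.erase v : Set ℤ)) :
    kap I F v l₁ e₁ (x + y) = kap I F v l₁ e₁ x + kap I F v l₁ e₁ y := by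
  simp only [kap, s.ext_add hx hy, add_dotProduct, Pi.add_apply]
  ring

theorem kap_zero (s : IsStar I V F v l₁ e₁) : kap I F v l₁ e₁ 0 = 0 := by
  simp [kap, ext, defect, s.isom.map_zero]

theorem kap_neg (s : IsStar I V F v l₁ e₁) {x : E → ℤ} (hx : x ∈ Flows I (V.erase v : Set ℤ)) :
    kap I F v l₁ e₁ (-x) = -kap I F v l₁ e₁ x := by
  have := s.kap_add hx (AddSubgroup.neg_mem _ hx)
  rw [add_neg_cancel, s.kap_zero] at this
  linarith

theorem kap_sub (s : IsStar I V F v l₁ e₁) {x y : E → ℤ} (hx : x ∈ Flows I (V.erase v : Set ℤ))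
    (hy : y ∈ Flows I (V.erase v : Set ℤ)) :
    kap I F v l₁ e₁ (x - y) = kap I F v l₁ e₁ x - kap I F v l₁ e₁ y := by
  rw [sub_eq_add_neg, s.kap_add hx (AddSubgroup.neg_mem _ hy), s.kap_neg hy, sub_eq_add_neg]

/-- The products of the extension are those of the flows up to the terms involving `kap`. -/
theorem ext_dot (s : IsStar I V F v l₁ e₁) {x y : E → ℤ} (hx : x ∈ Flows I (V.erase v : Set ℤ))
    (hy : y ∈ Flows I (V.erase v : Set ℤ)) :
    ext I F v l₁ e₁ x ⬝ᵥ ext I F v l₁ e₁ y = x ⬝ᵥ y + defect I v x * kap I F v l₁ e₁ y +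
      defect I v y * kap I F v l₁ e₁ x := by
  have h := s.isom _ (s.sub_mem hx) _ (s.sub_mem hy)
  simp only [kap, ext, add_dotProduct, dotProduct_add, smul_dotProduct, dotProduct_smul,
    smul_eq_mul, s.unit, h, sub_dotProduct, dotProduct_sub, unit_dot, dot_unit, unit_self,
    dotProduct_comm e₁]
  ring

theorem leaf_erase {l : E} (hl : l ∈ LensPaper.leaf I V v) :
    LensPaper.unit l ∈ Flows I (V.erase v : Set ℤ) :=
  unit_mem fun j hj hlj => by
    simp only [coe_erase, Set.mem_sdiff, mem_coe, Set.mem_singleton_iff] at hj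
    exact hj.2 ((mem_leaf.1 hl).2 j hj.1 hlj)

theorem defect_leaf {l : E} (hl : l ∈ LensPaper.leaf I V v) :
    defect I v (LensPaper.unit l) = 1 := by
  rw [defect_unit, if_pos (mem_leaf.1 hl).1]

theorem kap_leaf (s : IsStar I V F v l₁ e₁) {l : E} (hl : l ∈ LensPaper.leaf I V v) :
    kap I F v l₁ e₁ (LensPaper.unit l) = 0 := by
  by_cases h : l = l₁
  · subst h
    simp [kap, ext, defect_leaf hl, s.isom.map_zero, s.unit]
  · have h1 := s.dot l hl h
    rw [← neg_sub, s.isom.map_neg (unit_sub_mem hl s.leaf), neg_dotProduct] at h1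
    simp only [kap, ext, defect_leaf hl, one_smul, add_dotProduct, s.unit, unit_ne (Ne.symm h)]
    linarith

theorem ext_dot_leaf (s : IsStar I V F v l₁ e₁) {x : E → ℤ}
    (hx : x ∈ Flows I (V.erase v : Set ℤ)) {l : E} (hl : l ∈ LensPaper.leaf I V v) :
    ext I F v l₁ e₁ x ⬝ᵥ ext I F v l₁ e₁ (LensPaper.unit l) = x l + kap I F v l₁ e₁ x := by
  rw [s.ext_dot hx (leaf_erase hl), s.kap_leaf hl, defect_leaf hl, dot_unit]
  ring

theorem ext_leaf_dot_leaf (s : IsStar I V F v l₁ e₁) {l l' : E} (hl : l ∈ LensPaper.leaf I V v)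
    (hl' : l' ∈ LensPaper.leaf I V v) :
    ext I F v l₁ e₁ (LensPaper.unit l) ⬝ᵥ ext I F v l₁ e₁ (LensPaper.unit l') =
      if l = l' then 1 else 0 := by
  rw [s.ext_dot_leaf (leaf_erase hl) hl', s.kap_leaf hl, add_zero, unit_apply]
  simp [eq_comm]

theorem bessel (s : IsStar I V F v l₁ e₁) {x : E → ℤ} (hx : x ∈ Flows I (V.erase v : Set ℤ)) :
    ∑ l ∈ LensPaper.leaf I V v, (x l + kap I F v l₁ e₁ x) ^ 2 ≤
      x ⬝ᵥ x + 2 * (defect I v x * kap I F v l₁ e₁ x) := by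
  have h := LensPaper.bessel (LensPaper.leaf I V v)
    (fun l => ext I F v l₁ e₁ (LensPaper.unit l))
    (fun a ha b hb => s.ext_leaf_dot_leaf ha hb) (ext I F v l₁ e₁ x)
  rw [s.ext_dot hx hx] at h
  rw [sum_congr rfl fun l hl => by rw [← s.ext_dot_leaf hx hl]]
  linarith

theorem bessel_zero (s : IsStar I V F v l₁ e₁) {x : E → ℤ} (hx : x ∈ Flows I (V.erase v : Set ℤ))
    (h0 : ∀ l ∈ LensPaper.leaf I V v, x l = 0) :
    #(LensPaper.leaf I V v) * kap I F v l₁ e₁ x ^ 2 ≤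
      x ⬝ᵥ x + 2 * (defect I v x * kap I F v l₁ e₁ x) := by
  have := s.bessel hx
  rwa [sum_congr rfl fun l hl => by rw [h0 l hl, zero_add], sum_const, nsmul_eq_mul] at this

/-- If the extension is an isometry on generators, then the line without `v` already fails. -/
theorem fails_erase (s : IsStar I V F v l₁ e₁) {k : ℕ} (hJ : Fintype.card J + k = Fintype.card E)
    (hr : 2 ≤ #(LensPaper.leaf I V v))
    (h2 : ∀ i ∈ V, i ≠ v → ∀ e ∈ LensPaper.leaf I (V.erase v) i,
      ∀ e' ∈ LensPaper.leaf I (V.erase v) i, e ≠ e' → kap I F v l₁ e₁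
        (LensPaper.unit e - LensPaper.unit e') = 0)
    (h3 : ∀ i j, IsGap I (V.erase v) i j → ∃ e e' x, IsPath I (V.erase v) i j e e' x ∧
      kap I F v l₁ e₁ x = 0) : Fails k I (V.erase v : Set ℤ) := by
  set Λ := Flows I (V.erase v : Set ℤ) with hΛ
  let K : AddSubgroup (E → ℤ) :=
    { carrier := {x | x ∈ Λ ∧ kap I F v l₁ e₁ x = 0}
      zero_mem' := ⟨Λ.zero_mem, s.kap_zero⟩
      add_mem' := fun {x y} hx hy => ⟨Λ.add_mem hx.1 hy.1, by
        rw [s.kap_add hx.1 hy.1, hx.2, hy.2, add_zero]⟩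
      neg_mem' := fun {x} hx => ⟨Λ.neg_mem hx.1, by rw [s.kap_neg hx.1, hx.2, neg_zero]⟩ }
  have hmK : ∀ x, x ∈ K ↔ x ∈ Λ ∧ kap I F v l₁ e₁ x = 0 := fun x => Iff.rfl
  have hK : Λ ≤ K := by
    refine (s.line.mono (erase_subset v V)).flows_le K ?_ ?_ ?_
    · intro e he
      have hm : LensPaper.unit e ∈ Λ := unit_mem fun j hj => he j hj
      refine ⟨hm, ?_⟩
      by_cases hev : e ∈ I v
      · refine s.kap_leaf (mem_leaf.2 ⟨hev, fun j hj hej => ?_⟩)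
        by_contra hjv
        exact he j (mem_erase.2 ⟨hjv, hj⟩) hej
      · have h := s.bessel_zero hm fun l hl => unit_ne fun hc => hev (hc ▸ (mem_leaf.1 hl).1)
        rw [defect_unit, if_neg hev, unit_dot, unit_self] at h
        generalize kap I F v l₁ e₁ (LensPaper.unit e) = t at *
        have : (2 : ℤ) ≤ #(LensPaper.leaf I V v) := by exact_mod_cast hr
        nlinarith [sq_nonneg t, sq_nonneg (t - 1), sq_nonneg (t + 1),
          mul_le_mul_of_nonneg_right this (sq_nonneg t)]
    · intro i hi e he e' he'
      rw [mem_erase] at hi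
      by_cases hee : e = e'
      · rw [hee, sub_self]; exact K.zero_mem
      · exact ⟨unit_sub_mem he he', h2 i hi.2 hi.1 e he e' he' hee⟩
    · intro i j hij
      obtain ⟨e, e', x, hx, hk⟩ := h3 i j hij
      exact ⟨e, e', x, hx, hx.mem, hk⟩
  refine ⟨J, inferInstance, ext I F v l₁ e₁, hJ, fun x hx y hy => ?_⟩
  rw [s.ext_dot hx hy, (hK hx).2, (hK hy).2]
  ring

end IsStar

end Star

section Savings
open scoped Matrix
open Finset

variable {E : Type} [Fintype E] [DecidableEq E]

/-- The lattice of flows on `S` embeds in a standard lattice of rank `σ` less than the number of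
elements used by `S`. -/
def Sav (σ : ℕ) (I : ℤ → Finset E) (S : Finset ℤ) : Prop :=
  ∃ (J : Type) (_ : Fintype J) (F : (E → ℤ) → J → ℤ), Fintype.card J + σ = #(S.biUnion I) ∧
    ∀ x ∈ Flows I (S : Set ℤ), ∀ y ∈ Flows I (S : Set ℤ),
      F x ⬝ᵥ F y = ∑ e ∈ S.biUnion I, x e * y e

theorem Sav.fails {σ k : ℕ} {I : ℤ → Finset E} {S : Finset ℤ} (h : Sav σ I S) (hk : k ≤ σ) :
    Fails k I (S : Set ℤ) := by
  obtain ⟨J, _, F, hJ, hF⟩ := h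
  refine ⟨J ⊕ ({e // e ∉ S.biUnion I} ⊕ Fin (σ - k)), inferInstance,
    fun x => Sum.elim (F x) (Sum.elim (fun e => x e) 0), ?_, fun x hx y hy => ?_⟩
  · have h1 : Fintype.card {e // e ∉ S.biUnion I} = Fintype.card E - #(S.biUnion I) := by
      rw [Fintype.card_subtype_compl, Fintype.card_coe]
    have h2 := card_le_univ (S.biUnion I)
    simp only [Fintype.card_sum, h1, Fintype.card_fin]
    omega
  · rw [dotProduct, Fintype.sum_sum_type, Fintype.sum_sum_type]
    simp only [Sum.elim_inl, Sum.elim_inr, Pi.zero_apply, mul_zero, sum_const_zero, add_zero]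
    have h1 := hF x hx y hy
    rw [dotProduct] at h1
    rw [h1, dotProduct, ← sum_add_sum_compl (S.biUnion I)]
    congr 1
    rw [← sum_coe_sort (S.biUnion I)ᶜ]
    exact Fintype.sum_equiv (Equiv.subtypeEquivRight fun e => by simp) _ _ fun e => rfl

theorem Sav.zero (I : ℤ → Finset E) (S : Finset ℤ) : Sav 0 I S :=
  ⟨S.biUnion I, inferInstance, fun x e => x e, by rw [Fintype.card_coe, add_zero], fun x _ y _ =>
    sum_coe_sort (S.biUnion I) fun e => x e * y e⟩

theorem Sav.union {σ τ : ℕ} {I : ℤ → Finset E} {S T : Finset ℤ} (hS : Sav σ I S) (hT : Sav τ I T)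
    (hd : Disjoint (S.biUnion I) (T.biUnion I)) : Sav (σ + τ) I (S ∪ T) := by
  obtain ⟨J, _, F, hJ, hF⟩ := hS
  obtain ⟨K, _, G, hK, hG⟩ := hT
  have hu : (S ∪ T).biUnion I = S.biUnion I ∪ T.biUnion I := union_biUnion
  refine ⟨J ⊕ K, inferInstance, fun x => Sum.elim (F x) (G x), ?_, fun x hx y hy => ?_⟩
  · rw [hu, card_union_of_disjoint hd, Fintype.card_sum]
    omega
  · have hS' : ∀ x ∈ Flows I ((S ∪ T : Finset ℤ) : Set ℤ), x ∈ Flows I (S : Set ℤ) := fun x hx =>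
      flows_anti (by simp) hx
    have hT' : ∀ x ∈ Flows I ((S ∪ T : Finset ℤ) : Set ℤ), x ∈ Flows I (T : Set ℤ) := fun x hx =>
      flows_anti (by simp) hx
    rw [hu, sum_union hd, ← hF x (hS' x hx) y (hS' y hy), ← hG x (hT' x hx) y (hT' y hy)]
    simp [dotProduct, Fintype.sum_sum_type]

/-- The flows on `S` restricted to the `n` elements used by `S` are multiples of one sign vector. -/
def Rigid (I : ℤ → Finset E) (S : Finset ℤ) (n : ℕ) (e₀ : E) : Prop :=
  #(S.biUnion I) = n ∧ ∀ x ∈ Flows I (S : Set ℤ), ∀ y ∈ Flows I (S : Set ℤ),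
    ∑ e ∈ S.biUnion I, x e * y e = n * (x e₀ * y e₀)

theorem Rigid.sav {I : ℤ → Finset E} {S : Finset ℤ} {n : ℕ} {e₀ : E} (h : Rigid I S n e₀) :
    Sav (3 * (n / 4)) I S := by
  refine ⟨Fin (n / 4) ⊕ Fin (n % 4), inferInstance,
    fun x => Sum.elim (fun _ => 2 * x e₀) (fun _ => x e₀), ?_, fun x hx y hy => ?_⟩
  · rw [h.1]; simp; omega
  · rw [h.2 x hx y hy]
    have : (n : ℤ) = 4 * ((n / 4 : ℕ) : ℤ) + ((n % 4 : ℕ) : ℤ) := by omega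
    rw [this]
    simp [dotProduct]
    ring

theorem Rigid.sav_pair {I : ℤ → Finset E} {S T : Finset ℤ} {m n : ℕ} {e₀ f₀ : E}
    (hS : Rigid I S m e₀) (hT : Rigid I T n f₀) (hm : 2 ≤ m) (hn : 2 ≤ n)
    (hd : Disjoint (S.biUnion I) (T.biUnion I)) : Sav 2 I (S ∪ T) := by
  have hu : (S ∪ T).biUnion I = S.biUnion I ∪ T.biUnion I := union_biUnion
  refine ⟨Bool ⊕ (Fin (m - 2) ⊕ Fin (n - 2)), inferInstance, fun x =>
    Sum.elim (fun b => bif b then x e₀ + x f₀ else x e₀ - x f₀)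
      (Sum.elim (fun _ => x e₀) (fun _ => x f₀)), ?_, fun x hx y hy => ?_⟩
  · rw [hu, card_union_of_disjoint hd, hS.1, hT.1]; simp; omega
  · have hS' : ∀ x ∈ Flows I ((S ∪ T : Finset ℤ) : Set ℤ), x ∈ Flows I (S : Set ℤ) := fun x hx =>
      flows_anti (by simp) hx
    have hT' : ∀ x ∈ Flows I ((S ∪ T : Finset ℤ) : Set ℤ), x ∈ Flows I (T : Set ℤ) := fun x hx =>
      flows_anti (by simp) hx
    rw [hu, sum_union hd, hS.2 x (hS' x hx) y (hS' y hy), hT.2 x (hT' x hx) y (hT' y hy)]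
    obtain ⟨m, rfl⟩ := Nat.exists_eq_add_of_le hm
    obtain ⟨n, rfl⟩ := Nat.exists_eq_add_of_le hn
    simp [dotProduct]
    ring

theorem IsLine.rigid_run_aux {I : ℤ → Finset E} {V : Finset ℤ} (h : IsLine I V) (s : ℤ) (t : ℕ) :
    (∀ l, s ≤ l → l ≤ s + t → l ∈ V ∧ #(I l) = 2) →
    #((Icc s (s + t)).biUnion I) = t + 2 ∧ ∃ e₀ ∈ I s, ∃ g : E → ℤ,
      (∀ e ∈ (Icc s (s + t)).biUnion I, g e ^ 2 = 1) ∧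
      ∀ x ∈ Flows I (Icc s (s + t) : Set ℤ), ∀ e ∈ (Icc s (s + t)).biUnion I,
        x e = g e * x e₀ := by
  induction t with
  | zero =>
    intro hV
    obtain ⟨a, b, hab, hI⟩ := card_eq_two.1 (hV s le_rfl (by simp)).2
    have hU : (Icc s (s + (0 : ℕ))).biUnion I = {a, b} := by simp [hI]
    refine ⟨by rw [hU, card_pair hab], a, by simp [hI], fun e => if e = a then 1 else -1, ?_, ?_⟩
    · intro e _
      by_cases hea : e = a <;> simp [hea]
    · intro x hx e he
      rw [hU, mem_insert, mem_singleton] at he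
      have h1 := hx s (by simp)
      rw [hI, sum_pair hab] at h1
      rcases he with rfl | rfl
      · simp
      · simp only [if_neg hab.symm]; linarith
  | succ t ih =>
    intro hV
    obtain ⟨hc, e₀, he₀, g, hg, hx⟩ := ih fun l h1 h2 => hV l h1 (by push_cast; omega)
    have hm := hV (s + t) (by omega) (by push_cast; omega)
    have hm1 := hV (s + t + 1) (by omega) (by push_cast; omega)
    obtain ⟨hh, hedge⟩ := h.exists_edge hm.1 hm1.1
    have hhm : hh ∈ I (s + t) ∧ hh ∈ I (s + t + 1) := by rw [← mem_inter, hedge]; simp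
    obtain ⟨e', he'h, hI⟩ : ∃ e', e' ≠ hh ∧ I (s + t + 1) = {hh, e'} := by
      obtain ⟨a, b, hab, hI⟩ := card_eq_two.1 hm1.2
      have := hhm.2
      rw [hI, mem_insert, mem_singleton] at this
      rcases this with rfl | rfl
      · exact ⟨b, hab.symm, hI⟩
      · exact ⟨a, hab, by rw [hI, pair_comm]⟩
    have hS : Icc s (s + (t + 1 : ℕ)) = insert (s + t + 1) (Icc s (s + t)) := by
      ext l; simp only [mem_insert, mem_Icc]; push_cast; omega
    have hhU : hh ∈ (Icc s (s + (t : ℤ))).biUnion I :=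
      mem_biUnion.2 ⟨s + t, by simp, hhm.1⟩
    have he'U : e' ∉ (Icc s (s + (t : ℤ))).biUnion I := by
      intro hc
      obtain ⟨l, hl, hel⟩ := mem_biUnion.1 hc
      rw [mem_Icc] at hl
      have he'I : e' ∈ I (s + t + 1) := by simp [hI]
      have h1 := h.eq_or hm1.1 (hV l hl.1 (by push_cast; omega)).1 he'I hel
      have : l = s + t := by omega
      subst this
      have : e' ∈ I (s + t) ∩ I (s + t + 1) := mem_inter.2 ⟨hel, he'I⟩
      rw [hedge, mem_singleton] at this
      exact he'h this
    have hU : (Icc s (s + (t + 1 : ℕ))).biUnion I = insert e' ((Icc s (s + (t : ℤ))).biUnion I) :=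
      by
      rw [hS, biUnion_insert, hI]
      ext e
      simp only [mem_union, mem_insert, mem_singleton]
      constructor
      · rintro ((rfl | h1) | h1)
        exacts [Or.inr hhU, Or.inl h1, Or.inr h1]
      · rintro (h1 | h1)
        exacts [Or.inl (Or.inr h1), Or.inr h1]
    have hne : ∀ e ∈ (Icc s (s + (t : ℤ))).biUnion I, e ≠ e' := fun e he hc => he'U (hc ▸ he)
    refine ⟨by rw [hU, card_insert_of_notMem he'U, hc], e₀, he₀,
      fun e => if e = e' then - g hh else g e, ?_, ?_⟩
    · intro e he
      rw [hU, mem_insert] at he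
      rcases he with rfl | he
      · simpa using hg hh hhU
      · simpa [hne e he] using hg e he
    · intro x hx' e he
      have hx'' : x ∈ Flows I (Icc s (s + (t : ℤ)) : Set ℤ) := flows_anti (by
        intro l hl
        simp only [coe_Icc, Set.mem_Icc] at hl ⊢
        push_cast; omega) hx'
      rw [hU, mem_insert] at he
      rcases he with rfl | he
      · have h1 := hx' (s + t + 1) (by simp; omega)
        rw [hI, sum_pair he'h.symm, hx x hx'' hh hhU] at h1
        simp only [if_true]
        linarith
      · simpa [hne e he] using hx x hx'' e he

/-- A run of `t + 1` vertices of weight two. -/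
theorem IsLine.rigid_run {I : ℤ → Finset E} {V : Finset ℤ} (h : IsLine I V) {s : ℤ} {t : ℕ}
    (hV : ∀ l, s ≤ l → l ≤ s + t → l ∈ V ∧ #(I l) = 2) :
    ∃ e₀, Rigid I (Icc s (s + t)) (t + 2) e₀ := by
  obtain ⟨hc, e₀, -, g, hg, hx⟩ := h.rigid_run_aux s t hV
  refine ⟨e₀, hc, fun x hx' y hy => ?_⟩
  rw [← hc, sum_congr rfl fun e he => by
    rw [hx x hx' e he, hx y hy e he, show g e * x e₀ * (g e * y e₀) = g e ^ 2 * (x e₀ * y e₀) by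
      ring, hg e he, one_mul], sum_const, nsmul_eq_mul]

theorem sav_four {I : ℤ → Finset E} {i : ℤ} (h : #(I i) = 4) : Sav 1 I {i} := by
  obtain ⟨a, s, has, hI, hs⟩ := card_eq_succ.1 h
  obtain ⟨b, c, d, hbc, hbd, hcd, rfl⟩ := card_eq_three.1 hs
  simp only [mem_insert, mem_singleton, not_or] at has
  refine ⟨Fin 3, inferInstance, fun x => ![x a + x b, x a + x c, x a + x d], ?_, ?_⟩
  · simp [h]
  · intro x hx y hy
    have key : ∀ z : E → ℤ, ∑ e ∈ I i, z e = z a + (z b + (z c + z d)) := by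
      intro z
      rw [← hI, sum_insert (by simp [has]), sum_insert (by simp [hbc, hbd]),
        sum_pair hcd]
    have h1 := hx i (by simp)
    have h2 := hy i (by simp)
    rw [key] at h1 h2
    rw [singleton_biUnion, key (fun e => x e * y e)]
    simp only [dotProduct, Fin.sum_univ_three, Matrix.cons_val]
    linear_combination (x a) * h2 + (y a) * h1

theorem IsLine.sav_three_three {I : ℤ → Finset E} {V : Finset ℤ} (h : IsLine I V) {i : ℤ}
    (hi : i ∈ V) (hi1 : i + 1 ∈ V) (h1 : #(I i) = 3) (h2 : #(I (i + 1)) = 3) :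
    Sav 1 I {i, i + 1} := by
  obtain ⟨p, hp⟩ := h.exists_edge hi hi1
  have hpm : p ∈ I i ∧ p ∈ I (i + 1) := by rw [← mem_inter, hp]; simp
  obtain ⟨a, b, hab, hI⟩ := card_eq_two.1 (show #((I i).erase p) = 2 by
    rw [card_erase_of_mem hpm.1, h1])
  obtain ⟨c, d, hcd, hI'⟩ := card_eq_two.1 (show #((I (i + 1)).erase p) = 2 by
    rw [card_erase_of_mem hpm.2, h2])
  have key : ∀ z : E → ℤ, ∑ e ∈ I i, z e = z p + (z a + z b) := fun z => by
    rw [← add_sum_erase _ _ hpm.1, hI, sum_pair hab]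
  have key' : ∀ z : E → ℤ, ∑ e ∈ I (i + 1), z e = z p + (z c + z d) := fun z => by
    rw [← add_sum_erase _ _ hpm.2, hI', sum_pair hcd]
  have hU : ({i, i + 1} : Finset ℤ).biUnion I = I i ∪ I (i + 1) := by simp
  refine ⟨Fin 4, inferInstance, fun x => ![x a - x d, x a - x c, x p, x p], ?_, ?_⟩
  · have := card_union_add_card_inter (I i) (I (i + 1))
    rw [hp, card_singleton] at this
    rw [hU, Fintype.card_fin]; omega
  · intro x hx y hy
    have a1 := hx i (by simp)
    have a2 := hy i (by simp)
    have b1 := hx (i + 1) (by simp)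
    have b2 := hy (i + 1) (by simp)
    rw [key] at a1 a2
    rw [key'] at b1 b2
    have hs : ∑ e ∈ I i ∪ I (i + 1), x e * y e =
        x p * y p + (x a * y a + x b * y b) + (x c * y c + x d * y d) := by
      have := sum_union_inter (s₁ := I i) (s₂ := I (i + 1)) (f := fun e => x e * y e)
      rw [hp, sum_singleton, key (fun e => x e * y e), key' (fun e => x e * y e)] at this
      linarith
    rw [hU, hs]
    simp only [dotProduct, Fin.sum_univ_four, Matrix.cons_val]
    have e1 : x b = - x p - x a := by linarith
    have e2 : y b = - y p - y a := by linarith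
    have e3 : x d = - x p - x c := by linarith
    have e4 : y d = - y p - y c := by linarith
    rw [e1, e2, e3, e4]
    ring

end Savings

section WeightBound
open scoped Matrix
open Finset

variable {E : Type} [Fintype E] [DecidableEq E]

theorem IsPath.zero_of_leaf {I : ℤ → Finset E} {V : Finset ℤ} {v i j : ℤ} {e e' : E} {x : E → ℤ}
    (hp : IsPath I (V.erase v) i j e e' x) {l : E} (hl : l ∈ leaf I V v) : x l = 0 :=
  hp.off l fun m hm hlm => (mem_erase.1 hm).1 ((mem_leaf.1 hl).2 m (mem_erase.1 hm).2 hlm)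

theorem IsPath.abs_le_one {I : ℤ → Finset E} {V : Finset ℤ} {i j : ℤ} {e e' : E} {x : E → ℤ}
    (hp : IsPath I V i j e e' x) {l : ℤ} {f : E} (hf : f ∈ leaf I V l) : |x f| ≤ 1 := by
  by_cases h1 : f = e
  · rw [h1, hp.one]; simp
  · by_cases h2 : f = e'
    · rw [h2]; exact (sq_le_one_iff_abs_le_one _).1 hp.sq.le
    · rw [hp.leaf_zero l f hf h1 h2]; simp

theorem IsLine.leaf_erase_of_mem {I : ℤ → Finset E} {V : Finset ℤ} (h : IsLine I V) {v : ℤ}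
    (hv : v ∈ V) {l : ℤ} (hl : l ∈ V.erase v) {f : E} (hfv : f ∈ I v) (hfl : f ∈ I l) :
    f ∈ leaf I (V.erase v) l := by
  rw [mem_leaf]
  refine ⟨hfl, fun m hm hfm => ?_⟩
  rw [mem_erase] at hl hm
  have h1 := h.eq_or hv hl.2 hfv hfl
  have h2 := h.eq_or hv hm.2 hfv hfm
  have h3 := h.eq_or hl.2 hm.2 hfl hfm
  omega

/-- Outside the leaves, at most one summand of the flow of a path out of `v` is nonzero. -/
theorem IsLine.abs_defect_le {I : ℤ → Finset E} {V : Finset ℤ} (h : IsLine I V) {v : ℤ}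
    (hv : v ∈ V) {i j : ℤ} {e e' : E} {x : E → ℤ} (hij : i < j)
    (hp : IsPath I (V.erase v) i j e e' x) : |IsStar.defect I v x| ≤ 1 := by
  have hz : ∀ f ∈ I v, f ≠ e → f ≠ e' → x f = 0 := by
    intro f hf h1 h2
    by_cases hc : ∀ l ∈ V.erase v, f ∉ I l
    · exact hp.off f hc
    · push Not at hc
      obtain ⟨l, hl, hfl⟩ := hc
      exact hp.leaf_zero l f (h.leaf_erase_of_mem hv hl hf hfl) h1 h2
  have hi := hp.icc i le_rfl hij.le
  have hj := hp.icc j hij.le le_rfl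
  have hnot : ¬ (e ∈ I v ∧ e' ∈ I v) := by
    rintro ⟨h1, h2⟩
    have h3 := h.eq_or hv (mem_erase.1 hi).2 h1 (mem_leaf.1 hp.left).1
    have h4 := h.eq_or hv (mem_erase.1 hj).2 h2 (mem_leaf.1 hp.right).1
    have h5 := (mem_erase.1 hi).1
    have h6 := (mem_erase.1 hj).1
    have := hp.icc v (by omega) (by omega)
    simp at this
  have h1 := hp.abs_le_one hp.left
  have h2 := hp.abs_le_one hp.right
  rw [IsStar.defect]
  by_cases he : e ∈ I v
  · rw [sum_eq_single_of_mem e he fun f hf hne => hz f hf hne fun hc => hnot ⟨he, hc ▸ hf⟩]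
    exact h1
  · by_cases he' : e' ∈ I v
    · rw [sum_eq_single_of_mem e' he' fun f hf hne => hz f hf (fun hc => he (hc ▸ hf)) hne]
      exact h2
    · rw [sum_eq_zero fun f hf => hz f hf (fun hc => he (hc ▸ hf)) fun hc => he' (hc ▸ hf)]
      simp

theorem IsLine.card_eq_two_of_ioo {I : ℤ → Finset E} {V : Finset ℤ} (h : IsLine I V) {i j l : ℤ}
    (hg : IsGap I V i j) (h1 : i < l) (h2 : l < j) : #(I l) = 2 :=
  (h.of_leaf_empty (hg.icc l h1.le h2.le) (hg.ioo l h1 h2)).1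

theorem IsLine.exists_path_of_gap {I : ℤ → Finset E} {V : Finset ℤ} (h : IsLine I V) {i j : ℤ}
    (hg : IsGap I V i j) : ∃ e e' x, IsPath I V i j e e' x := by
  obtain ⟨e, he⟩ := hg.left
  obtain ⟨e', he'⟩ := hg.right
  obtain ⟨x, hx⟩ := h.exists_path hg.lt.le he he' (fun hc => by
    have := (mem_leaf.1 he).2 j (hg.icc j hg.lt.le le_rfl) (hc ▸ (mem_leaf.1 he').1)
    have := hg.lt
    omega) hg.icc
  exact ⟨e, e', x, hx⟩

/-- A vertex of a minimal failing line has weight at most `2 * k + 7`. -/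
theorem IsLine.weight_le {I : ℤ → Finset E} {V : Finset ℤ} {k : ℕ} (h : IsLine I V)
    (hk : 0 < k) (hf : Fails k I (V : Set ℤ)) (hmin : ∀ S ⊂ V, ¬ Fails k I (S : Set ℤ)) {v : ℤ} (hv
      : v ∈ V) :
    #(I v) ≤ 2 * k + 7 := by
  by_contra! hcon
  obtain ⟨J, _, F, hJ, hF⟩ := hf
  have hcard := h.card_eq hv
  have hnb := card_nbr_le V v
  obtain ⟨l₁, e₁, s⟩ := exists_star h hF hv (by omega) (Or.inl (by omega))
  have hr : (2 * k + 6 : ℤ) ≤ #(leaf I V v) := by exact_mod_cast (by omega)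
  refine hmin _ (erase_ssubset hv) (s.fails_erase hJ (by omega) ?_ ?_)
  · intro i hi hiv e he e' he' hee
    have hm := unit_sub_mem he he'
    have hnl : ∀ f ∈ leaf I (V.erase v) i, ∀ l ∈ leaf I V v, l ≠ f := fun f hf l hl hc =>
      hiv ((mem_leaf.1 hl).2 i hi (hc ▸ (mem_leaf.1 hf).1))
    have hb := s.bessel_zero hm fun l hl => by
      simp [unit_ne (hnl e he l hl), unit_ne (hnl e' he' l hl)]
    have hn : (unit e - unit e') ⬝ᵥ (unit e - unit e') = 2 := by
      simp [sub_dotProduct, unit_ne hee, unit_ne hee.symm]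
    rw [hn, IsStar.defect_sub, IsStar.defect_unit, IsStar.defect_unit] at hb
    generalize IsStar.kap I F v l₁ e₁ (unit e - unit e') = t at *
    have h8 : (8 : ℤ) ≤ #(leaf I V v) := by exact_mod_cast (by omega)
    have h9 := mul_le_mul_of_nonneg_right h8 (sq_nonneg t)
    rcases eq_or_ne t 0 with h0 | h0
    · exact h0
    · have := sq_pos_of_ne_zero h0
      split_ifs at hb <;> nlinarith [sq_nonneg (t - 1), sq_nonneg (t + 1)]
  · intro i j hg
    have hE := h.mono (erase_subset v V)
    obtain ⟨e, e', x, hx⟩ := hE.exists_path_of_gap hg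
    refine ⟨e, e', x, hx, ?_⟩
    by_contra hne
    have hb := s.bessel_zero hx.mem fun l hl => hx.zero_of_leaf hl
    have hd := abs_le.1 (h.abs_defect_le hv hg.lt hx)
    rw [hx.norm] at hb
    generalize IsStar.kap I F v l₁ e₁ x = t at *
    generalize IsStar.defect I v x = b at *
    have h1 : 1 ≤ t ^ 2 := by have := sq_pos_of_ne_zero hne; omega
    have h9 := mul_le_mul_of_nonneg_right hr (sq_nonneg t)
    have hbt : b * t ≤ t ^ 2 := by
      have hbsq : b ^ 2 ≤ 1 := by nlinarith
      nlinarith [sq_nonneg (b - t), sq_nonneg (b * t)]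
    have hlen : (2 * k + 4 : ℤ) ≤ j - i + 2 := by nlinarith
    obtain ⟨t', ht'⟩ : ∃ t' : ℕ, (t' : ℤ) = j - i - 2 := ⟨(j - i - 2).toNat, by omega⟩
    obtain ⟨e₀, hrig⟩ := hE.rigid_run (s := i + 1) (t := t') fun l h1 h2 =>
      ⟨hg.icc l (by omega) (by omega), hE.card_eq_two_of_ioo hg (by omega) (by omega)⟩
    refine hmin (Icc (i + 1) (i + 1 + t')) ?_ (hrig.sav.fails (by omega))
    refine (ssubset_iff_of_subset fun l hl => ?_).2 ⟨v, hv, fun hl => ?_⟩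
    · rw [mem_Icc] at hl
      exact mem_of_mem_erase (hg.icc l (by omega) (by omega))
    · rw [mem_Icc] at hl
      have := hg.icc v (by omega) (by omega)
      simp at this

end WeightBound

section Reduced
open scoped Matrix
open Finset

variable {E J : Type} [Fintype E] [DecidableEq E] [Fintype J]

namespace IsStar

variable {I : ℤ → Finset E} {V : Finset ℤ} {F : (E → ℤ) → J → ℤ} {v : ℤ} {l₁ : E} {e₁ : J → ℤ}

theorem ext_sub (s : IsStar I V F v l₁ e₁) {x y : E → ℤ} (hx : x ∈ Flows I (V.erase v : Set ℤ))
    (hy : y ∈ Flows I (V.erase v : Set ℤ)) :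
    ext I F v l₁ e₁ (x - y) = ext I F v l₁ e₁ x - ext I F v l₁ e₁ y := by
  have h := s.ext_add (AddSubgroup.sub_mem _ hx hy) hy
  rw [sub_add_cancel] at h
  exact eq_sub_of_add_eq h.symm

/-- The component of the extension orthogonal to the leaves of `v`. -/
def red (I : ℤ → Finset E) (V : Finset ℤ) (F : (E → ℤ) → J → ℤ) (v : ℤ) (l₁ : E) (e₁ : J → ℤ)
    (x : E → ℤ) : J → ℤ :=
  ext I F v l₁ e₁ x -
    kap I F v l₁ e₁ x • ∑ l ∈ LensPaper.leaf I V v, ext I F v l₁ e₁ (LensPaper.unit l)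

theorem red_dot (s : IsStar I V F v l₁ e₁) {x y : E → ℤ} (hx : x ∈ Flows I (V.erase v : Set ℤ))
    (hy : y ∈ Flows I (V.erase v : Set ℤ)) (hx0 : ∀ l ∈ LensPaper.leaf I V v, x l = 0)
    (hy0 : ∀ l ∈ LensPaper.leaf I V v, y l = 0) :
    red I V F v l₁ e₁ x ⬝ᵥ red I V F v l₁ e₁ y = x ⬝ᵥ y + defect I v x * kap I F v l₁ e₁ y +
      defect I v y * kap I F v l₁ e₁ x -
      #(LensPaper.leaf I V v) * (kap I F v l₁ e₁ x * kap I F v l₁ e₁ y) := by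
  have hsum : ∀ z ∈ Flows I (V.erase v : Set ℤ), (∀ l ∈ LensPaper.leaf I V v, z l = 0) →
      ext I F v l₁ e₁ z ⬝ᵥ ∑ l ∈ LensPaper.leaf I V v, ext I F v l₁ e₁ (LensPaper.unit l) =
        #(LensPaper.leaf I V v) * kap I F v l₁ e₁ z := by
    intro z hz hz0
    rw [dotProduct_sum, sum_congr rfl fun l hl => by
      rw [s.ext_dot_leaf hz hl, hz0 l hl, zero_add], sum_const, nsmul_eq_mul]
  have hss : (∑ l ∈ LensPaper.leaf I V v, ext I F v l₁ e₁ (LensPaper.unit l)) ⬝ᵥ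
      ∑ l ∈ LensPaper.leaf I V v, ext I F v l₁ e₁ (LensPaper.unit l) =
        #(LensPaper.leaf I V v) := by
    rw [sum_dotProduct, sum_congr rfl fun l hl => by
      rw [dotProduct_sum, sum_congr rfl fun l' hl' => s.ext_leaf_dot_leaf hl hl',
        sum_ite_eq, if_pos hl], sum_const, nsmul_eq_mul, mul_one]
  rw [red, red]
  simp only [sub_dotProduct, dotProduct_sub, smul_dotProduct, dotProduct_smul, smul_eq_mul,
    s.ext_dot hx hy, hsum x hx hx0, hss]
  rw [dotProduct_comm _ (ext I F v l₁ e₁ y), hsum y hy hy0]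
  ring

/-- A flow of norm two at one vertex, not meeting `v`. -/
theorem kap_eq_zero_of_two (s : IsStar I V F v l₁ e₁) (hr : 3 ≤ #(LensPaper.leaf I V v))
    {x : E → ℤ} (hx : x ∈ Flows I (V.erase v : Set ℤ))
    (hx0 : ∀ l ∈ LensPaper.leaf I V v, x l = 0) (hd : defect I v x = 0) (hn : x ⬝ᵥ x = 2) :
    kap I F v l₁ e₁ x = 0 := by
  have h := s.bessel_zero hx hx0
  rw [hd, hn] at h
  by_contra hne
  have h1 := sq_pos_of_ne_zero hne
  have h2 : (3 : ℤ) ≤ #(LensPaper.leaf I V v) := by exact_mod_cast hr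
  nlinarith

theorem kap_eq_zero_of_three (s : IsStar I V F v l₁ e₁) (hr : 3 ≤ #(LensPaper.leaf I V v))
    {x z : E → ℤ} (hx : x ∈ Flows I (V : Set ℤ)) (hz : z ∈ Flows I (V : Set ℤ))
    (hx0 : ∀ l ∈ LensPaper.leaf I V v, x l = 0) (hz0 : ∀ l ∈ LensPaper.leaf I V v, z l = 0)
    (hn : x ⬝ᵥ x = 3) (hzx : (z ⬝ᵥ x) ^ 2 = 1) : kap I F v l₁ e₁ x = 0 := by
  have hxx := s.red_dot (flows_erase hx) (flows_erase hx) hx0 hx0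
  have hzx' := s.red_dot (flows_erase hz) (flows_erase hx) hz0 hx0
  rw [s.defect_eq_zero hx, hn] at hxx
  rw [s.defect_eq_zero hx, s.defect_eq_zero hz] at hzx'
  have h0 := dotProduct_self_nonneg' (red I V F v l₁ e₁ x)
  have h2 : (3 : ℤ) ≤ #(LensPaper.leaf I V v) := by exact_mod_cast hr
  generalize kap I F v l₁ e₁ x = t at *
  generalize kap I F v l₁ e₁ z = t' at *
  by_contra hne
  have h1 := sq_pos_of_ne_zero hne
  have h3 : (#(LensPaper.leaf I V v) : ℤ) * t ^ 2 ≤ 3 := by nlinarith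
  have h4 : t ^ 2 = 1 := by nlinarith
  have h5 : (#(LensPaper.leaf I V v) : ℤ) = 3 := by rw [h4] at h3; linarith
  have h6 : red I V F v l₁ e₁ x = 0 := by
    rw [← dotProduct_self_eq_zero, hxx, h5]
    linear_combination (-3) * h4
  rw [h6, dotProduct_zero, h5] at hzx'
  have h7 : z ⬝ᵥ x = 3 * (t' * t) := by linarith
  rw [h7] at hzx
  have : (9 : ℤ) ∣ 1 := ⟨(t' * t) ^ 2, by rw [← hzx]; ring⟩
  omega

end IsStar

/-- Vectors with the products of the reduced extensions at two neighbours of a vertex of weight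
five do not exist: the case in which both are defective. -/
theorem no_side_one {f₀ f₁ g₀ : J → ℤ} (h00 : f₀ ⬝ᵥ f₀ = 1) (h01 : f₀ ⬝ᵥ f₁ = 0)
    (h11 : f₁ ⬝ᵥ f₁ = 1 ∨ f₁ ⬝ᵥ f₁ = 2) (hg : g₀ ⬝ᵥ g₀ = 1) (hf0 : f₀ ⬝ᵥ g₀ = -1)
    (hf1 : f₁ ⬝ᵥ g₀ = -1) : False := by
  have h := dotProduct_self_nonneg' ((2 : ℤ) • (f₀ + g₀) + f₁)
  simp only [add_dotProduct, dotProduct_add, smul_dotProduct, dotProduct_smul, smul_eq_mul,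
    dotProduct_comm f₁ f₀, dotProduct_comm g₀ f₀, dotProduct_comm g₀ f₁, h00, h01, hg, hf0,
    hf1] at h
  omega

theorem no_side_two {f₀ f₁ g₀ g₁ : J → ℤ} (h00 : f₀ ⬝ᵥ f₀ = 1) (h01 : f₀ ⬝ᵥ f₁ = 0)
    (h11 : f₁ ⬝ᵥ f₁ = 1) (hg : g₀ ⬝ᵥ g₀ = 2) (hg01 : g₀ ⬝ᵥ g₁ = 1)
    (hg11 : g₁ ⬝ᵥ g₁ = 2 ∨ g₁ ⬝ᵥ g₁ = 3) (h00' : f₀ ⬝ᵥ g₀ = 1) (h01' : f₀ ⬝ᵥ g₁ = 1)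
    (h10' : f₁ ⬝ᵥ g₀ = 1) (h11' : f₁ ⬝ᵥ g₁ = 1) : False := by
  have h := dotProduct_self_nonneg' ((2 : ℤ) • (g₀ - f₀ - f₁) + g₁)
  simp only [add_dotProduct, dotProduct_add, sub_dotProduct, dotProduct_sub, smul_dotProduct,
    dotProduct_smul, smul_eq_mul, dotProduct_comm f₁ f₀, dotProduct_comm g₁ g₀,
    dotProduct_comm g₀ f₀, dotProduct_comm g₀ f₁, dotProduct_comm g₁ f₀, dotProduct_comm g₁ f₁,
    h00, h01, h11, hg, hg01, h00', h01', h10', h11'] at h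
  omega

theorem no_side_three {f₀ f₁ f₂ g₀ g₁ : J → ℤ} (h00 : f₀ ⬝ᵥ f₀ = 1) (h01 : f₀ ⬝ᵥ f₁ = 0)
    (h02 : f₀ ⬝ᵥ f₂ = 0) (h11 : f₁ ⬝ᵥ f₁ = 2) (h12 : f₁ ⬝ᵥ f₂ = 1) (h22 : f₂ ⬝ᵥ f₂ = 2)
    (hg : g₀ ⬝ᵥ g₀ = 2) (hg01 : g₀ ⬝ᵥ g₁ = 1) (hg11 : g₁ ⬝ᵥ g₁ = 2)
    (h00' : f₀ ⬝ᵥ g₀ = 1) (h01' : f₀ ⬝ᵥ g₁ = 1) (h10' : f₁ ⬝ᵥ g₀ = 1) (h11' : f₁ ⬝ᵥ g₁ = 1)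
    (h20' : f₂ ⬝ᵥ g₀ = 1) (h21' : f₂ ⬝ᵥ g₁ = 1) : False := by
  have h := dotProduct_self_nonneg' (f₁ + f₂ - (2 : ℤ) • (g₀ - f₀) - (2 : ℤ) • (g₁ - f₀))
  simp only [add_dotProduct, dotProduct_add, sub_dotProduct, dotProduct_sub, smul_dotProduct,
    dotProduct_smul, smul_eq_mul, dotProduct_comm f₁ f₀, dotProduct_comm f₂ f₀,
    dotProduct_comm f₂ f₁, dotProduct_comm g₁ g₀, dotProduct_comm g₀ f₀, dotProduct_comm g₀ f₁,
    dotProduct_comm g₁ f₀, dotProduct_comm g₁ f₁, dotProduct_comm g₀ f₂, dotProduct_comm g₁ f₂,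
    h00, h01, h02, h11, h12, h22, hg, hg01, hg11, h00', h01', h10', h11', h20', h21'] at h
  omega

theorem no_side_four {f₀ f₁ f₂ g₀ g₁ g₂ : J → ℤ} (h00 : f₀ ⬝ᵥ f₀ = 1) (h01 : f₀ ⬝ᵥ f₁ = 0)
    (h02 : f₀ ⬝ᵥ f₂ = 0) (h11 : f₁ ⬝ᵥ f₁ = 2) (h12 : f₁ ⬝ᵥ f₂ = 1) (h22 : f₂ ⬝ᵥ f₂ = 2)
    (hg : g₀ ⬝ᵥ g₀ = 2) (hg01 : g₀ ⬝ᵥ g₁ = 1) (hg02 : g₀ ⬝ᵥ g₂ = 1) (hg11 : g₁ ⬝ᵥ g₁ = 3)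
    (hg12 : g₁ ⬝ᵥ g₂ = 2) (hg22 : g₂ ⬝ᵥ g₂ = 3)
    (h00' : f₀ ⬝ᵥ g₀ = 1) (h01' : f₀ ⬝ᵥ g₁ = 1) (h02' : f₀ ⬝ᵥ g₂ = 1)
    (h10' : f₁ ⬝ᵥ g₀ = 1) (h11' : f₁ ⬝ᵥ g₁ = 1) (h12' : f₁ ⬝ᵥ g₂ = 1)
    (h20' : f₂ ⬝ᵥ g₀ = 1) (h21' : f₂ ⬝ᵥ g₁ = 1) (h22' : f₂ ⬝ᵥ g₂ = 1) : False := by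
  have h := dotProduct_self_nonneg' (g₁ + g₂ - (2 : ℤ) • f₀ - (2 : ℤ) • (f₁ - (g₀ - f₀)) -
    (2 : ℤ) • (f₂ - (g₀ - f₀)))
  simp only [add_dotProduct, dotProduct_add, sub_dotProduct, dotProduct_sub, smul_dotProduct,
    dotProduct_smul, smul_eq_mul, dotProduct_comm f₁ f₀, dotProduct_comm f₂ f₀,
    dotProduct_comm f₂ f₁, dotProduct_comm g₁ g₀, dotProduct_comm g₂ g₀, dotProduct_comm g₂ g₁,
    dotProduct_comm g₀ f₀, dotProduct_comm g₀ f₁, dotProduct_comm g₁ f₀, dotProduct_comm g₁ f₁,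
    dotProduct_comm g₀ f₂, dotProduct_comm g₁ f₂, dotProduct_comm g₂ f₀, dotProduct_comm g₂ f₁,
    dotProduct_comm g₂ f₂, h00, h01, h02, h11, h12, h22, hg, hg01, hg02, hg11, hg12, hg22, h00',
    h01', h02', h10', h11', h12', h20', h21', h22'] at h
  omega

end Reduced

section PathsAndStars
open scoped Matrix
open Finset

variable {E J : Type} [Fintype E] [DecidableEq E] [Fintype J]
  {I : ℤ → Finset E} {V : Finset ℤ} {F : (E → ℤ) → J → ℤ} {v : ℤ} {l₁ : E} {e₁ : J → ℤ}

theorem IsLine.exists_gap_right (h : IsLine I V) {m : ℤ}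
    (hm : m ∈ V) (hm1 : m + 1 ∈ V) (hl : (leaf I V m).Nonempty) : ∃ j, IsGap I V m j := by
  obtain ⟨i, hi⟩ := h.reflect.exists_gap_left (m := -m)
    (mem_image_neg.2 (by rwa [neg_neg]))
    (mem_image_neg.2 (by rwa [show -(-m - 1) = m + 1 by ring]))
    (by rwa [leaf_reflect, neg_neg])
  have hl := hi.left
  have hr := hi.right
  rw [leaf_reflect] at hl hr
  rw [neg_neg] at hr
  have hlt := hi.lt
  refine ⟨-i, by omega, fun l h1 h2 => ?_, hr, hl, fun l h1 h2 => ?_⟩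
  · have := mem_image_neg.1 (hi.icc (-l) (by omega) (by omega))
    rwa [neg_neg] at this
  · have := hi.ioo (-l) (by omega) (by omega)
    rwa [leaf_reflect, neg_neg] at this

theorem IsLine.leaf_erase_nonempty (h : IsLine I V) (hn : ∀ x ∈ nbr V v, (leaf I V x).Nonempty)
    {l : ℤ} (hv : v ∈ V) (hl : l ∈ V.erase v) :
    (leaf I (V.erase v) l).Nonempty ↔ (leaf I V l).Nonempty := by
  refine ⟨fun ⟨f, hf⟩ => ?_, fun hne => hne.mono (leaf_anti (erase_subset v V) l)⟩
  have hl' := mem_erase.1 hl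
  by_cases hfv : f ∈ I v
  · have h1 := h.eq_or hv hl'.2 hfv (mem_leaf.1 hf).1
    exact hn l (mem_nbr.2 ⟨hl'.2, by omega⟩)
  · refine ⟨f, mem_leaf.2 ⟨(mem_leaf.1 hf).1, fun j hj hfj => (mem_leaf.1 hf).2 j ?_ hfj⟩⟩
    exact mem_erase.2 ⟨fun hc => hfv (hc ▸ hfj), hj⟩

theorem IsLine.gap_of_erase (h : IsLine I V) (hn : ∀ x ∈ nbr V v, (leaf I V x).Nonempty)
    (hv : v ∈ V) {i j : ℤ} (hg : IsGap I (V.erase v) i j) :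
    IsGap I V i j ∧ (v < i ∨ j < v) := by
  have hlt := hg.lt
  refine ⟨⟨hg.lt, fun l h1 h2 => mem_of_mem_erase (hg.icc l h1 h2),
    (h.leaf_erase_nonempty hn hv (hg.icc i le_rfl hlt.le)).1 hg.left,
    (h.leaf_erase_nonempty hn hv (hg.icc j hlt.le le_rfl)).1 hg.right, fun l h1 h2 => ?_⟩, ?_⟩
  · rw [← not_nonempty_iff_eq_empty, ← h.leaf_erase_nonempty hn hv (hg.icc l h1.le h2.le),
      not_nonempty_iff_eq_empty]
    exact hg.ioo l h1 h2
  · by_contra! hc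
    have := hg.icc v hc.1 hc.2
    simp at this

/-- A path avoiding `v` is a path of the line without `v`. -/
theorem IsPath.erase {i j : ℤ} {e e' : E} {x : E → ℤ} (hx : IsPath I V i j e e' x) (hv : v ∈ V)
    (hvi : v < i ∨ j < v) : IsPath I (V.erase v) i j e e' x where
  left := leaf_anti (erase_subset v V) _ hx.left
  right := leaf_anti (erase_subset v V) _ hx.right
  le := hx.le
  ne := hx.ne
  icc l h1 h2 := mem_erase.2 ⟨by omega, hx.icc l h1 h2⟩
  mem := IsStar.flows_erase hx.mem
  one := hx.one
  sq := hx.sq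
  supp l hl := hx.supp l (mem_of_mem_erase hl)
  leaf_zero l f hf h1 h2 := by
    by_cases hfv : f ∈ I v
    · exact hx.supp v hv hvi f hfv
    · refine hx.leaf_zero l f (mem_leaf.2 ⟨(mem_leaf.1 hf).1, fun j hj hfj =>
        (mem_leaf.1 hf).2 j (mem_erase.2 ⟨fun hc => hfv (hc ▸ hfj), hj⟩) hfj⟩) h1 h2
  off f hf := by
    by_cases hfv : f ∈ I v
    · exact hx.supp v hv hvi f hfv
    · exact hx.off f fun l hl hfl => hf l (mem_erase.2 ⟨fun hc => hfv (hc ▸ hfl), hl⟩) hfl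
  norm := hx.norm

theorem IsPath.zero_of_mem_leaf {i j : ℤ} {e e' : E} {x : E → ℤ} (hx : IsPath I V i j e e' x)
    (hv : v ∈ V) (hvi : v < i ∨ j < v) {l : E} (hl : l ∈ leaf I V v) : x l = 0 :=
  hx.supp v hv hvi l (mem_leaf.1 hl).1

theorem IsPath.dot_of_meet {i p m : ℤ} {a c d : E} {x z : E → ℤ}
    (hx : IsPath I V i p a c x) (hz : IsPath I V p m c d z) (hip : i < p) :
    (x ⬝ᵥ z) ^ 2 = 1 := by
  have hp := hx.icc p hip.le le_rfl
  rw [dotProduct, sum_eq_single c, hz.one, mul_one, hx.sq]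
  · intro f _ hfc
    by_contra hne
    have hxf : x f ≠ 0 := left_ne_zero_of_mul hne
    have hzf : z f ≠ 0 := right_ne_zero_of_mul hne
    have hsx : ∀ l ∈ V, f ∈ I l → i ≤ l ∧ l ≤ p := fun l hl hfl => by
      by_contra hc
      exact hxf (hx.supp l hl (by omega) f hfl)
    have hsz : ∀ l ∈ V, f ∈ I l → p ≤ l ∧ l ≤ m := fun l hl hfl => by
      by_contra hc
      exact hzf (hz.supp l hl (by omega) f hfl)
    have hall : ∀ l ∈ V, f ∈ I l → l = p := fun l hl hfl => by
      have := hsx l hl hfl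
      have := hsz l hl hfl
      omega
    have hfp : f ∈ I p := by
      by_contra hc
      exact hxf (hx.off f fun l hl hfl => hc (hall l hl hfl ▸ hfl))
    refine hxf (hx.leaf_zero p f (mem_leaf.2 ⟨hfp, hall⟩) ?_ hfc)
    rintro rfl
    have := (mem_leaf.1 hx.left).2 p hp hfp
    omega
  · simp

/-- Across a gap between two vertices of weight at least three, the extension is isometric. -/
theorem IsStar.kap_path_eq_zero (s : IsStar I V F v l₁ e₁) (hr : 3 ≤ #(LensPaper.leaf I V v))
    {i : ℤ} {e e' : E} {x : E → ℤ} (hx : IsPath I V i (i + 1) e e' x) (hvi : v < i ∨ i + 1 < v)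
    (hi : 3 ≤ #(I i)) (hi1 : 3 ≤ #(I (i + 1))) : kap I F v l₁ e₁ x = 0 := by
  have h := s.line
  have hx0 := fun l hl => hx.zero_of_mem_leaf (l := l) s.mem hvi hl
  have hn : x ⬝ᵥ x = 3 := by rw [hx.norm]; ring
  have hiV := hx.icc i le_rfl (by omega)
  have hi1V := hx.icc (i + 1) (by omega) le_rfl
  have hee : ∀ f ∈ LensPaper.leaf I V i, f ∉ LensPaper.leaf I V (i + 1) := fun f hf hf' => by
    have := (mem_leaf.1 hf).2 _ hi1V (mem_leaf.1 hf').1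
    omega
  have hone : ∀ p ∈ V, p ≠ v → ∀ f ∈ LensPaper.leaf I V p, ∀ f' ∈ LensPaper.leaf I V p, f' ≠ f →
      x f ^ 2 = 1 → x f' = 0 → kap I F v l₁ e₁ x = 0 := by
    intro p hp hpv f hf f' hf' hff h1 h0
    refine s.kap_eq_zero_of_three hr hx.mem (unit_sub_mem hf hf') hx0 (fun l hl => ?_) hn ?_
    · have hne : ∀ g ∈ LensPaper.leaf I V p, l ≠ g := fun g hg hc =>
        hpv ((mem_leaf.1 hl).2 p hp (hc ▸ (mem_leaf.1 hg).1))
      simp [unit_ne (hne f hf), unit_ne (hne f' hf')]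
    · rw [sub_dotProduct, unit_dot, unit_dot, h0, sub_zero, h1]
  rcases hvi with hvi | hvi
  · rcases Nat.lt_or_ge 1 #(LensPaper.leaf I V (i + 1)) with hc | hc
    · obtain ⟨f, hf, hfe⟩ := exists_mem_ne hc e'
      exact hone (i + 1) hi1V (by omega) e' hx.right f hf hfe hx.sq
        (hx.leaf_zero _ f hf (fun hc => hee e hx.left (hc ▸ hf)) hfe)
    · have hcard := h.card_eq hi1V
      have hsub : nbr V (i + 1) ⊆ {i, i + 2} := fun y hy => by
        have := (mem_nbr.1 hy).2
        rw [mem_insert, mem_singleton]; omega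
      have hm : i + 1 + 1 ∈ V := by
        have h2 : #({i, i + 2} : Finset ℤ) ≤ 2 := card_le_two
        have := eq_of_subset_of_card_le hsub (by omega)
        have h3 : i + 2 ∈ nbr V (i + 1) := by rw [this]; simp
        rw [show i + 1 + 1 = i + 2 by ring]
        exact (mem_nbr.1 h3).1
      obtain ⟨m, hm⟩ := h.exists_gap_right hi1V hm ⟨e', hx.right⟩
      obtain ⟨d, hd⟩ := hm.right
      have hlt := hm.lt
      obtain ⟨z, hz⟩ := h.exists_path hlt.le hx.right hd (fun hc => by
        have := (mem_leaf.1 hx.right).2 m (hm.icc m hlt.le le_rfl) (hc ▸ (mem_leaf.1 hd).1)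
        omega) hm.icc
      refine s.kap_eq_zero_of_three hr hx.mem hz.mem hx0
        (fun l hl => hz.zero_of_mem_leaf s.mem (by omega) hl) hn ?_
      rw [dotProduct_comm]
      exact hx.dot_of_meet hz (by omega)
  · rcases Nat.lt_or_ge 1 #(LensPaper.leaf I V i) with hc | hc
    · obtain ⟨f, hf, hfe⟩ := exists_mem_ne hc e
      exact hone i hiV (by omega) e hx.left f hf hfe (by rw [hx.one, one_pow])
        (hx.leaf_zero _ f hf hfe (fun hc => hee f hf (hc ▸ hx.right)))
    · have hcard := h.card_eq hiV
      have hsub : nbr V i ⊆ {i - 1, i + 1} := fun y hy => by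
        have := (mem_nbr.1 hy).2
        rw [mem_insert, mem_singleton]; omega
      have hm : i - 1 ∈ V := by
        have h2 : #({i - 1, i + 1} : Finset ℤ) ≤ 2 := card_le_two
        have := eq_of_subset_of_card_le hsub (by omega)
        have h3 : i - 1 ∈ nbr V i := by rw [this]; simp
        exact (mem_nbr.1 h3).1
      obtain ⟨m, hm⟩ := h.exists_gap_left hiV hm ⟨e, hx.left⟩
      obtain ⟨d, hd⟩ := hm.left
      have hlt := hm.lt
      obtain ⟨z, hz⟩ := h.exists_path hlt.le hd hx.left (fun hc => by
        have := (mem_leaf.1 hx.left).2 m (hm.icc m le_rfl hlt.le) (hc ▸ (mem_leaf.1 hd).1)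
        omega) hm.icc
      refine s.kap_eq_zero_of_three hr hx.mem hz.mem hx0
        (fun l hl => hz.zero_of_mem_leaf s.mem (by omega) hl) hn ?_
      exact hz.dot_of_meet hx hlt

end PathsAndStars

section Sides
open scoped Matrix
open Finset

variable {E J : Type} [Fintype E] [DecidableEq E] [Fintype J]
  {I : ℤ → Finset E} {V : Finset ℤ} {F : (E → ℤ) → J → ℤ} {v : ℤ} {l₁ : E} {e₁ : J → ℤ}

/-- The three-term path across an edge. -/
theorem IsLine.unit_edge_mem (h : IsLine I V) {x y : ℤ} (hx : x ∈ V) (hy : y ∈ nbr V x) {e f g : E}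
    (he : e ∈ leaf I V x) (hf : f ∈ I x ∩ I y) (hg : g ∈ leaf I V y) :
    unit e - unit f + unit g ∈ Flows I (V : Set ℤ) := by
  intro j hj
  have hj : j ∈ V := hj
  rw [mem_nbr] at hy
  rw [mem_inter] at hf
  have h1 : e ∈ I j ↔ j = x := ⟨fun hc => (mem_leaf.1 he).2 j hj hc, fun hc => hc ▸
    (mem_leaf.1 he).1⟩
  have h2 : g ∈ I j ↔ j = y := ⟨fun hc => (mem_leaf.1 hg).2 j hj hc, fun hc => hc ▸
    (mem_leaf.1 hg).1⟩
  have h3 : f ∈ I j ↔ j = x ∨ j = y := by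
    refine ⟨fun hc => ?_, fun hc => ?_⟩
    · have := h.eq_or hx hj hf.1 hc
      have := h.eq_or hy.1 hj hf.2 hc
      omega
    · rcases hc with rfl | rfl
      exacts [hf.1, hf.2]
  simp only [Pi.add_apply, Pi.sub_apply, sum_add_distrib, sum_sub_distrib, sum_unit, h1, h2, h3]
  have hxy : x ≠ y := by omega
  by_cases hjx : j = x
  · simp [hjx, hxy]
  · by_cases hjy : j = y <;> simp [hjx, hjy, hxy.symm]

/-- `u` is a flow of the line without `v`, supported on the side of `v` containing `x` and of
defect one. -/
structure IsArm (I : ℤ → Finset E) (V : Finset ℤ) (v x : ℤ) (u : E → ℤ) : Prop where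
  mem : u ∈ Flows I (V.erase v : Set ℤ)
  zero : ∀ l ∈ leaf I V v, u l = 0
  defect : IsStar.defect I v u = 1
  supp : ∀ f, u f ≠ 0 → ∃ l ∈ V, f ∈ I l ∧ (l < v ↔ x < v) ∧ l ≠ v

theorem IsArm.dot_eq_zero (h : IsLine I V) {x y : ℤ} {u w : E → ℤ} (hu : IsArm I V v x u)
    (hw : IsArm I V v y w) (hxy : x < v ↔ ¬ y < v) : u ⬝ᵥ w = 0 := by
  refine sum_eq_zero fun f _ => ?_
  by_contra hne
  obtain ⟨l, hl, hfl, h1, h2⟩ := hu.supp f (left_ne_zero_of_mul hne)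
  obtain ⟨m, hm, hfm, h3, h4⟩ := hw.supp f (right_ne_zero_of_mul hne)
  have := h.eq_or hl hm hfl hfm
  omega

theorem IsLine.isArm_unit_sub (h : IsLine I V) (hv : v ∈ V) {x : ℤ} (hx : x ∈ nbr V v) {f e : E}
    (hf : f ∈ I v ∩ I x) (he : e ∈ leaf I V x) : IsArm I V v x (unit f - unit e) := by
  rw [mem_inter] at hf
  have hx' := mem_nbr.1 hx
  have hxv : x ≠ v := by omega
  have hev : e ∉ I v := fun hc => hxv ((mem_leaf.1 he).2 v hv hc).symm
  refine ⟨unit_sub_mem (h.leaf_erase_of_mem hv (mem_erase.2 ⟨hxv, hx'.1⟩) hf.1 hf.2)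
    (leaf_anti (erase_subset v V) _ he), fun l hl => ?_, ?_, fun g hg => ⟨x, hx'.1, ?_, Iff.rfl,
      hxv⟩⟩
  · have h1 : l ≠ f := fun hc => hxv ((mem_leaf.1 hl).2 x hx'.1 (hc ▸ hf.2))
    have h2 : l ≠ e := fun hc => hev (hc ▸ (mem_leaf.1 hl).1)
    simp [unit_ne h1, unit_ne h2]
  · rw [IsStar.defect_sub, IsStar.defect_unit, IsStar.defect_unit, if_pos hf.1, if_neg hev,
      sub_zero]
  · by_contra hc
    have h1 : g ≠ f := fun h' => hc (h' ▸ hf.2)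
    have h2 : g ≠ e := fun h' => hc (h' ▸ (mem_leaf.1 he).1)
    simp [unit_ne h1, unit_ne h2] at hg

theorem IsLine.isArm_add (h : IsLine I V) (hv : v ∈ V) {x y : ℤ} (hx : x ∈ nbr V v)
    (hy : y ∈ nbr V x) (hyv : y ≠ v) {u : E → ℤ} (hu : IsArm I V v x u) {e f g : E}
    (he : e ∈ leaf I V x) (hf : f ∈ I x ∩ I y) (hg : g ∈ leaf I V y) :
    IsArm I V v x (u + (unit e - unit f + unit g)) := by
  have hx' := mem_nbr.1 hx
  have hy' := mem_nbr.1 hy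
  have hw := h.unit_edge_mem hx'.1 hy he hf hg
  have hxv : x ≠ v := by omega
  rw [mem_inter] at hf
  have hnot : ∀ l ∈ leaf I V v, l ∉ I x ∧ l ∉ I y := fun l hl =>
    ⟨fun hc => hxv ((mem_leaf.1 hl).2 x hx'.1 hc), fun hc => hyv ((mem_leaf.1 hl).2 y hy'.1 hc)⟩
  refine ⟨add_mem hu.mem (IsStar.flows_erase hw), fun l hl => ?_, ?_, fun l hl => ?_⟩
  · have h1 : l ≠ e := fun hc => (hnot l hl).1 (hc ▸ (mem_leaf.1 he).1)
    have h2 : l ≠ f := fun hc => (hnot l hl).1 (hc ▸ hf.1)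
    have h3 : l ≠ g := fun hc => (hnot l hl).2 (hc ▸ (mem_leaf.1 hg).1)
    simp [hu.zero l hl, unit_ne h1, unit_ne h2, unit_ne h3]
  · rw [IsStar.defect_add, hu.defect, IsStar.defect, hw v hv, add_zero]
  · by_cases hul : u l = 0
    · rw [Pi.add_apply, hul, zero_add] at hl
      by_cases hlx : l ∈ I x
      · exact ⟨x, hx'.1, hlx, Iff.rfl, hxv⟩
      · refine ⟨y, hy'.1, ?_, by omega, hyv⟩
        by_contra hc
        have h1 : l ≠ e := fun h' => hlx (h' ▸ (mem_leaf.1 he).1)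
        have h2 : l ≠ f := fun h' => hlx (h' ▸ hf.1)
        have h3 : l ≠ g := fun h' => hc (h' ▸ (mem_leaf.1 hg).1)
        simp [unit_ne h1, unit_ne h2, unit_ne h3] at hl
    · exact hu.supp l hul

/-- A vertex at which the extension of any isometry is rigid. -/
def Deep (I : ℤ → Finset E) (V : Finset ℤ) (v : ℤ) : Prop :=
  v ∈ V ∧ ((5 ≤ #(I v) ∧ ∀ x ∈ nbr V v, 5 ≤ #(I x) ∨
    (#(I x) = 3 ∧ ∀ y ∈ nbr V x, #(I y) ≠ 2 ∧ #(I y) ≠ 3)) ∨ (#(I v) = 3 ∧ nbr V v = ∅))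

theorem Deep.three_le (hd : Deep I V v) (h : IsLine I V) : 3 ≤ #(leaf I V v) := by
  have hc := h.card_eq hd.1
  have := card_nbr_le V v
  rcases hd.2 with h1 | h1
  · omega
  · rw [h1.2, card_empty] at hc
    omega

theorem Deep.leafy (hd : Deep I V v) (h : IsLine I V) {x : ℤ} (hx : x ∈ nbr V v) :
    (leaf I V x).Nonempty := by
  have := h.card_eq (mem_nbr.1 hx).1
  have := card_nbr_le V x
  rw [← card_pos]
  rcases hd.2 with h1 | h1
  · rcases h1.2 x hx with h2 | h2 <;> omega
  · rw [h1.2] at hx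
    simp at hx

theorem Deep.exists_star (hd : Deep I V v) (h : IsLine I V)
    (hF : IsIsom (Flows I (V : Set ℤ)) F) : ∃ l₁ e₁, IsStar I V F v l₁ e₁ := by
  refine LensPaper.exists_star h hF hd.1 (hd.three_le h) ?_
  by_cases hn : nbr V v = ∅
  · left
    have := h.card_eq hd.1
    rw [hn, card_empty] at this
    rcases hd.2 with h1 | h1 <;> omega
  · obtain ⟨x, hx⟩ := nonempty_iff_ne_empty.2 hn
    exact Or.inr ⟨x, hx, hd.leafy h hx⟩

theorem IsStar.kap_unit_sub (s : IsStar I V F v l₁ e₁) (hr : 3 ≤ #(LensPaper.leaf I V v)) {x : ℤ}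
    (hx : x ∈ V) (hxv : x ≠ v) {e f : E} (he : e ∈ LensPaper.leaf I V x)
    (hf : f ∈ LensPaper.leaf I V x) (hef : e ≠ f) :
    kap I F v l₁ e₁ (LensPaper.unit e - LensPaper.unit f) = 0 := by
  have hm := unit_sub_mem he hf
  have hne : ∀ l ∈ LensPaper.leaf I V v, ∀ g ∈ LensPaper.leaf I V x, l ≠ g := fun l hl g hg hc =>
    hxv ((mem_leaf.1 hl).2 x hx (hc ▸ (mem_leaf.1 hg).1))
  refine s.kap_eq_zero_of_two hr (flows_erase hm) (fun l hl => ?_) (s.defect_eq_zero hm) ?_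
  · simp [unit_ne (hne l hl e he), unit_ne (hne l hl f hf)]
  · simp [sub_dotProduct, unit_ne hef, unit_ne hef.symm]

theorem IsStar.kap_unit_edge (s : IsStar I V F v l₁ e₁) (hr : 3 ≤ #(LensPaper.leaf I V v)) {x y : ℤ}
    (hx : x ∈ V) (hxv : x ≠ v) (hy : y ∈ nbr V x) (hyv : y ≠ v) {e f g g' : E}
    (he : e ∈ LensPaper.leaf I V x) (hf : f ∈ I x ∩ I y) (hg : g ∈ LensPaper.leaf I V y)
    (hg' : g' ∈ LensPaper.leaf I V y) (hgg : g ≠ g') :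
    kap I F v l₁ e₁ (LensPaper.unit e - LensPaper.unit f + LensPaper.unit g) = 0 := by
  have hy' := mem_nbr.1 hy
  have hw := s.line.unit_edge_mem hx hy he hf hg
  rw [mem_inter] at hf
  have hfx : ∀ d ∈ LensPaper.leaf I V x, f ≠ d := fun d hd hc => by
    have := (mem_leaf.1 hd).2 y hy'.1 (hc ▸ hf.2)
    omega
  have hfy : ∀ d ∈ LensPaper.leaf I V y, f ≠ d := fun d hd hc => by
    have := (mem_leaf.1 hd).2 x hx (hc ▸ hf.1)
    omega
  have hey : ∀ d ∈ LensPaper.leaf I V y, e ≠ d := fun d hd hc => by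
    have := (mem_leaf.1 he).2 y hy'.1 (hc ▸ (mem_leaf.1 hd).1)
    omega
  have hnot : ∀ l ∈ LensPaper.leaf I V v, l ∉ I x ∧ l ∉ I y := fun l hl =>
    ⟨fun hc => hxv ((mem_leaf.1 hl).2 x hx hc), fun hc => hyv ((mem_leaf.1 hl).2 y hy'.1 hc)⟩
  have hle : ∀ l ∈ LensPaper.leaf I V v, l ≠ e := fun l hl hc =>
    (hnot l hl).1 (hc ▸ (mem_leaf.1 he).1)
  have hlf : ∀ l ∈ LensPaper.leaf I V v, l ≠ f := fun l hl hc => (hnot l hl).1 (hc ▸ hf.1)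
  have hlg : ∀ l ∈ LensPaper.leaf I V v, ∀ d ∈ LensPaper.leaf I V y, l ≠ d := fun l hl d hd hc =>
    (hnot l hl).2 (hc ▸ (mem_leaf.1 hd).1)
  refine s.kap_eq_zero_of_three hr hw (unit_sub_mem hg hg') (fun l hl => ?_) (fun l hl => ?_) ?_ ?_
  · simp [unit_ne (hle l hl), unit_ne (hlf l hl), unit_ne (hlg l hl g hg)]
  · simp [unit_ne (hlg l hl g' hg'), unit_ne (hlg l hl g hg)]
  · simp [add_dotProduct, sub_dotProduct, unit_ne (hfx e he), unit_ne (hfx e he).symm,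
      unit_ne (hfy g hg), unit_ne (hfy g hg).symm, unit_ne (hey g hg), unit_ne (hey g hg).symm]
  · simp [sub_dotProduct, unit_ne (hfy g hg), unit_ne (hey g hg), unit_ne (hfy g' hg'),
      unit_ne (hey g' hg'), unit_ne hgg]

/-- The flows testing the rigidity on one side of a deep vertex. -/
theorem IsStar.exists_side (s : IsStar I V F v l₁ e₁) (hr : 3 ≤ #(LensPaper.leaf I V v)) {x : ℤ}
    (hx : x ∈ nbr V v) (hxw : 5 ≤ #(I x) ∨ (#(I x) = 3 ∧ ∀ y ∈ nbr V x, #(I y) ≠ 2 ∧ #(I y) ≠ 3))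
    {f e : E} (hf : f ∈ I v ∩ I x) (he : e ∈ LensPaper.leaf I V x) :
    ∃ u₁ u₂ : E → ℤ, ∃ δ : ℤ, (δ = 0 ∨ δ = 1) ∧ IsArm I V v x u₁ ∧ IsArm I V v x u₂ ∧
      kap I F v l₁ e₁ u₁ = kap I F v l₁ e₁ (LensPaper.unit f - LensPaper.unit e) ∧
      kap I F v l₁ e₁ u₂ = kap I F v l₁ e₁ (LensPaper.unit f - LensPaper.unit e) ∧
      (LensPaper.unit f - LensPaper.unit e) ⬝ᵥ u₁ = 1 ∧
      (LensPaper.unit f - LensPaper.unit e) ⬝ᵥ u₂ = 1 ∧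
      u₁ ⬝ᵥ u₁ = 2 + δ ∧ u₁ ⬝ᵥ u₂ = 2 ∧ u₂ ⬝ᵥ u₂ = 2 + δ := by
  have h := s.line
  have hx' := mem_nbr.1 hx
  have hxv : x ≠ v := by omega
  have hu := h.isArm_unit_sub s.mem hx hf he
  have hcard := h.card_eq hx'.1
  have hf' := mem_inter.1 hf
  have hfx : ∀ d ∈ LensPaper.leaf I V x, f ≠ d := fun d hd hc =>
    hxv ((mem_leaf.1 hd).2 v s.mem (hc ▸ hf'.1)).symm
  rcases Nat.lt_or_ge 1 #(LensPaper.leaf I V x) with hc | hc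
  · obtain ⟨d, hd, hde⟩ := exists_mem_ne hc e
    have hu' := h.isArm_unit_sub s.mem hx hf hd
    have hk : kap I F v l₁ e₁ (LensPaper.unit f - LensPaper.unit d) =
        kap I F v l₁ e₁ (LensPaper.unit f - LensPaper.unit e) := by
      have h0 := s.kap_unit_sub hr hx'.1 hxv he hd hde.symm
      rw [show LensPaper.unit e - LensPaper.unit d = (LensPaper.unit f - LensPaper.unit d) -
        (LensPaper.unit f - LensPaper.unit e) by abel, s.kap_sub hu'.mem hu.mem] at h0
      linarith
    refine ⟨_, _, 0, Or.inl rfl, hu', hu', hk, hk, ?_, ?_, ?_, ?_, ?_⟩ <;>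
    simp [sub_dotProduct, unit_ne (hfx e he), unit_ne (hfx d hd), unit_ne (hfx d hd).symm,
      unit_ne hde]
  · have hnb := card_nbr_le V x
    have hx3 : #(I x) = 3 ∧ ∀ y ∈ nbr V x, #(I y) ≠ 2 ∧ #(I y) ≠ 3 := by
      rcases hxw with h5 | h3
      · omega
      · exact h3
    obtain ⟨y, hy, hyv⟩ := exists_mem_ne (show 1 < #(nbr V x) by omega) v
    have hy' := mem_nbr.1 hy
    obtain ⟨d, hd⟩ := h.edge_nbr hx'.1 hy
    have hd : d ∈ I x ∩ I y := by rw [hd]; exact mem_singleton_self d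
    have hycard := h.card_eq hy'.1
    have hynb := card_nbr_le V y
    have hy2 := h.two_le y hy'.1
    have hy3 := hx3.2 y hy
    obtain ⟨g, hg, g', hg', hgg⟩ := one_lt_card.1 (show 1 < #(LensPaper.leaf I V y) by omega)
    have harm := fun a ha => h.isArm_add s.mem hx hy hyv hu (g := a) he hd ha
    have hkap : ∀ a ∈ LensPaper.leaf I V y, ∀ b ∈ LensPaper.leaf I V y, a ≠ b →
        kap I F v l₁ e₁ (LensPaper.unit f - LensPaper.unit e +
          (LensPaper.unit e - LensPaper.unit d + LensPaper.unit a)) =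
        kap I F v l₁ e₁ (LensPaper.unit f - LensPaper.unit e) := fun a ha b hb hab => by
      rw [s.kap_add hu.mem (flows_erase (h.unit_edge_mem hx'.1 hy he hd ha)),
        s.kap_unit_edge hr hx'.1 hxv hy hyv he hd ha hb hab, add_zero]
    have hd' := mem_inter.1 hd
    have hfd : f ≠ d := fun hc => by
      have := h.eq_or s.mem hy'.1 hf'.1 (hc ▸ hd'.2)
      omega
    have hed : e ≠ d := fun hc => by
      have := (mem_leaf.1 he).2 y hy'.1 (hc ▸ hd'.2)
      omega
    have hfg : ∀ a ∈ LensPaper.leaf I V y, f ≠ a := fun a ha hc =>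
      hyv ((mem_leaf.1 ha).2 v s.mem (hc ▸ hf'.1)).symm
    have heg : ∀ a ∈ LensPaper.leaf I V y, e ≠ a := fun a ha hc => by
      have := (mem_leaf.1 he).2 y hy'.1 (hc ▸ (mem_leaf.1 ha).1)
      omega
    have hdg : ∀ a ∈ LensPaper.leaf I V y, d ≠ a := fun a ha hc => by
      have := (mem_leaf.1 ha).2 x hx'.1 (hc ▸ hd'.1)
      omega
    refine ⟨_, _, 1, Or.inr rfl, harm g hg, harm g' hg', hkap g hg g' hg' hgg,
      hkap g' hg' g hg hgg.symm, ?_, ?_, ?_, ?_, ?_⟩ <;>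
    simp [sub_dotProduct, add_dotProduct, unit_ne (hfx e he), unit_ne (hfx e he).symm,
      unit_ne hfd, unit_ne hfd.symm, unit_ne hed, unit_ne hed.symm, unit_ne hgg.symm,
      unit_ne (hfg g hg), unit_ne (hfg g hg).symm, unit_ne (hfg g' hg'), unit_ne (hfg g' hg').symm,
      unit_ne (heg g hg), unit_ne (heg g hg).symm, unit_ne (heg g' hg'), unit_ne (heg g' hg').symm,
      unit_ne (hdg g hg), unit_ne (hdg g hg).symm, unit_ne (hdg g' hg'), unit_ne (hdg g' hg').symm]

end Sides

section Rigidity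
open scoped Matrix
open Finset

variable {E J : Type} [Fintype E] [DecidableEq E] [Fintype J]
  {I : ℤ → Finset E} {V : Finset ℤ} {F : (E → ℤ) → J → ℤ} {v : ℤ} {l₁ : E} {e₁ : J → ℤ}

theorem IsArm.red_dot (s : IsStar I V F v l₁ e₁) {x y : ℤ} {a b : E → ℤ} (ha : IsArm I V v x a)
    (hb : IsArm I V v y b) {κ κ' : ℤ} (hκ : IsStar.kap I F v l₁ e₁ a = κ)
    (hκ' : IsStar.kap I F v l₁ e₁ b = κ') :
    IsStar.red I V F v l₁ e₁ a ⬝ᵥ IsStar.red I V F v l₁ e₁ b =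
      a ⬝ᵥ b + κ' + κ - #(leaf I V v) * (κ * κ') := by
  rw [s.red_dot ha.mem hb.mem ha.zero hb.zero, ha.defect, hb.defect, hκ, hκ', one_mul, one_mul]

theorem IsArm.kap_cases (s : IsStar I V F v l₁ e₁) (hr : 3 ≤ #(leaf I V v)) {x : ℤ} {u : E → ℤ}
    (hu : IsArm I V v x u) (hn : u ⬝ᵥ u = 2) : IsStar.kap I F v l₁ e₁ u = 0 ∨
      (IsStar.kap I F v l₁ e₁ u = 1 ∧ #(leaf I V v) ≤ 4) := by
  have hb := s.bessel_zero hu.mem hu.zero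
  rw [hn, hu.defect, one_mul] at hb
  have h3 : (3 : ℤ) ≤ #(leaf I V v) := by exact_mod_cast hr
  generalize IsStar.kap I F v l₁ e₁ u = t at *
  have h9 := mul_le_mul_of_nonneg_right h3 (sq_nonneg t)
  have h1 : t ≤ 1 := by nlinarith
  have h2 : 0 ≤ t := by nlinarith
  rcases (show t = 0 ∨ t = 1 by omega) with rfl | rfl
  · exact Or.inl rfl
  · exact Or.inr ⟨rfl, by have : (#(leaf I V v) : ℤ) ≤ 4 := by linarith
                          exact_mod_cast this⟩

theorem Deep.kap_edge (hd : Deep I V v) (s : IsStar I V F v l₁ e₁) {x : ℤ} (hx : x ∈ nbr V v)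
    {f e : E} (hf : f ∈ I v ∩ I x) (he : e ∈ leaf I V x) :
    IsStar.kap I F v l₁ e₁ (unit f - unit e) = 0 := by
  have h := s.line
  have hr := hd.three_le h
  have hdn : 5 ≤ #(I v) ∧ ∀ x ∈ nbr V v, 5 ≤ #(I x) ∨
      (#(I x) = 3 ∧ ∀ y ∈ nbr V x, #(I y) ≠ 2 ∧ #(I y) ≠ 3) := by
    rcases hd.2 with h1 | h1
    · exact h1
    · rw [h1.2] at hx
      simp at hx
  have hnorm : ∀ y ∈ nbr V v, ∀ g ∈ I v ∩ I y, ∀ d ∈ leaf I V y,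
      (unit g - unit d) ⬝ᵥ (unit g - unit d) = 2 := by
    intro y hy g hg d hd
    have hgd : g ≠ d := fun hc => by
      have := (mem_leaf.1 hd).2 v s.mem (hc ▸ (mem_inter.1 hg).1)
      have := (mem_nbr.1 hy).2
      omega
    simp [sub_dotProduct, unit_ne hgd, unit_ne hgd.symm]
  have hu := h.isArm_unit_sub s.mem hx hf he
  have huu := hnorm x hx f hf e he
  rcases hu.kap_cases s hr huu with h0 | ⟨hκ, h4⟩
  · exact h0
  exfalso
  obtain ⟨u₁, u₂, δ, hδ, a₁, a₂, k₁, k₂, d₁, d₂, n₁, n₁₂, n₂⟩ := s.exists_side hr hx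
    (hdn.2 x hx) hf he
  rw [hκ] at k₁ k₂
  have f00 := hu.red_dot s hu hκ hκ
  have f01 := hu.red_dot s a₁ hκ k₁
  have f02 := hu.red_dot s a₂ hκ k₂
  have f11 := a₁.red_dot s a₁ k₁ k₁
  have f12 := a₁.red_dot s a₂ k₁ k₂
  have f22 := a₂.red_dot s a₂ k₂ k₂
  rw [huu] at f00
  rw [d₁] at f01
  rw [d₂] at f02
  rw [n₁] at f11
  rw [n₁₂] at f12
  rw [n₂] at f22
  rcases (show #(leaf I V v) = 4 ∨ #(leaf I V v) = 3 by omega) with hr4 | hr3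
  · rw [hr4] at f00 f01
    have hz : IsStar.red I V F v l₁ e₁ (unit f - unit e) = 0 := by
      rw [← dotProduct_self_eq_zero, f00]
      norm_num
    rw [hz, zero_dotProduct] at f01
    norm_num at f01
  · rw [hr3] at f00 f01 f02 f11 f12 f22
    have hcard := h.card_eq s.mem
    have hnb := card_nbr_le V v
    obtain ⟨y, hy, hyx⟩ := exists_mem_ne (show 1 < #(nbr V v) by omega) x
    obtain ⟨g, hg⟩ := h.edge_nbr s.mem hy
    have hg : g ∈ I v ∩ I y := by rw [hg]; exact mem_singleton_self g
    obtain ⟨d, hdy⟩ := hd.leafy h hy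
    have hw := h.isArm_unit_sub s.mem hy hg hdy
    have hww := hnorm y hy g hg d hdy
    have hxy : x < v ↔ ¬ y < v := by
      have := (mem_nbr.1 hx).2
      have := (mem_nbr.1 hy).2
      omega
    obtain ⟨w₁, w₂, ε, hε, b₁, b₂, j₁, j₂, e₁', e₂', m₁, m₁₂, m₂⟩ :=
      s.exists_side hr hy (hdn.2 y hy) hg hdy
    have z00 := hu.dot_eq_zero h hw hxy
    have z01 := hu.dot_eq_zero h b₁ hxy
    have z02 := hu.dot_eq_zero h b₂ hxy
    have z10 := a₁.dot_eq_zero h hw hxy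
    have z11 := a₁.dot_eq_zero h b₁ hxy
    have z12 := a₁.dot_eq_zero h b₂ hxy
    have z20 := a₂.dot_eq_zero h hw hxy
    have z21 := a₂.dot_eq_zero h b₁ hxy
    have z22 := a₂.dot_eq_zero h b₂ hxy
    rcases hw.kap_cases s hr hww with hκ' | ⟨hκ', -⟩
    · rw [hκ'] at j₁ j₂
      have g00 := hw.red_dot s hw hκ' hκ'
      have g01 := hw.red_dot s b₁ hκ' j₁
      have g02 := hw.red_dot s b₂ hκ' j₂
      have g11 := b₁.red_dot s b₁ j₁ j₁
      have g12 := b₁.red_dot s b₂ j₁ j₂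
      have g22 := b₂.red_dot s b₂ j₂ j₂
      have p00 := hu.red_dot s hw hκ hκ'
      have p01 := hu.red_dot s b₁ hκ j₁
      have p02 := hu.red_dot s b₂ hκ j₂
      have p10 := a₁.red_dot s hw k₁ hκ'
      have p11 := a₁.red_dot s b₁ k₁ j₁
      have p12 := a₁.red_dot s b₂ k₁ j₂
      have p20 := a₂.red_dot s hw k₂ hκ'
      have p21 := a₂.red_dot s b₁ k₂ j₁
      have p22 := a₂.red_dot s b₂ k₂ j₂
      rw [hww] at g00
      rw [e₁'] at g01
      rw [e₂'] at g02
      rw [m₁] at g11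
      rw [m₁₂] at g12
      rw [m₂] at g22
      rw [hr3] at g00 g01 g02 g11 g12 g22 p00 p01 p02 p10 p11 p12 p20 p21 p22
      rw [z00] at p00
      rw [z01] at p01
      rw [z02] at p02
      rw [z10] at p10
      rw [z11] at p11
      rw [z12] at p12
      rw [z20] at p20
      rw [z21] at p21
      rw [z22] at p22
      rcases hδ with rfl | rfl
      · exact no_side_two f00 f01 f11 g00 g01 (by rcases hε with rfl | rfl <;> simp [g11])
          p00 p01 p10 p11
      · rcases hε with rfl | rfl
        · exact no_side_three f00 f01 f02 f11 f12 f22 g00 g01 g11 p00 p01 p10 p11 p20 p21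
        · exact no_side_four f00 f01 f02 f11 f12 f22 g00 g01 g02 g11 g12 g22 p00 p01 p02 p10 p11
            p12 p20 p21 p22
    · have g00 := hw.red_dot s hw hκ' hκ'
      have p00 := hu.red_dot s hw hκ hκ'
      have p10 := a₁.red_dot s hw k₁ hκ'
      rw [hww] at g00
      rw [z00] at p00
      rw [z10] at p10
      rw [hr3] at g00 p00 p10
      exact no_side_one f00 f01 (by rcases hδ with rfl | rfl <;> simp [f11]) g00 p00 p10

theorem Deep.kap_unit_sub (hd : Deep I V v) (s : IsStar I V F v l₁ e₁) {x : ℤ} (hx : x ∈ V)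
    (hxv : x ≠ v) {e f : E} (he : e ∈ leaf I (V.erase v) x) (hf : f ∈ leaf I (V.erase v) x)
    (hef : e ≠ f) : IsStar.kap I F v l₁ e₁ (unit e - unit f) = 0 := by
  have h := s.line
  have hleaf : ∀ g ∈ leaf I (V.erase v) x, g ∉ I v → g ∈ leaf I V x := fun g hg hgv =>
    mem_leaf.2 ⟨(mem_leaf.1 hg).1, fun j hj hgj =>
      (mem_leaf.1 hg).2 j (mem_erase.2 ⟨fun hc => hgv (hc ▸ hgj), hj⟩) hgj⟩
  have hnbr : ∀ g ∈ leaf I (V.erase v) x, g ∈ I v → x ∈ nbr V v := fun g hg hgv => by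
    have := h.eq_or s.mem hx hgv (mem_leaf.1 hg).1
    exact mem_nbr.2 ⟨hx, by omega⟩
  by_cases hev : e ∈ I v
  · have hxn := hnbr e he hev
    have hfv : f ∉ I v := fun hfv => by
      obtain ⟨g, hg⟩ := h.edge_nbr s.mem hxn
      have h1 : e ∈ I v ∩ I x := mem_inter.2 ⟨hev, (mem_leaf.1 he).1⟩
      have h2 : f ∈ I v ∩ I x := mem_inter.2 ⟨hfv, (mem_leaf.1 hf).1⟩
      rw [hg, mem_singleton] at h1 h2
      exact hef (h1.trans h2.symm)
    exact hd.kap_edge s hxn (mem_inter.2 ⟨hev, (mem_leaf.1 he).1⟩) (hleaf f hf hfv)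
  · by_cases hfv : f ∈ I v
    · have h0 := hd.kap_edge s (hnbr f hf hfv) (mem_inter.2 ⟨hfv, (mem_leaf.1 hf).1⟩)
        (hleaf e he hev)
      rw [← neg_sub, s.kap_neg (unit_sub_mem hf he), h0, neg_zero]
    · exact s.kap_unit_sub (hd.three_le h) hx hxv (hleaf e he hev) (hleaf f hf hfv) hef

/-- In a minimal failing line, every deep vertex is detected by a path across a gap. -/
theorem Deep.exists_gap {k : ℕ} (hd : Deep I V v) (s : IsStar I V F v l₁ e₁)
    (hJ : Fintype.card J + k = Fintype.card E) (hmin : ∀ S ⊂ V, ¬ Fails k I (S : Set ℤ))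
    (p : ℤ → ℤ → E → ℤ) (hp : ∀ i j, IsGap I V i j → ∃ e e', IsPath I V i j e e' (p i j)) :
    ∃ i j, IsGap I V i j ∧ (v < i ∨ j < v) ∧ (∃ l, i ≤ l ∧ l ≤ j ∧ #(I l) = 2) ∧
      IsStar.kap I F v l₁ e₁ (p i j) ≠ 0 := by
  have h := s.line
  have hr := hd.three_le h
  by_contra! hcon
  refine hmin _ (erase_ssubset s.mem) (s.fails_erase hJ (by omega)
    (fun i hi hiv e he e' he' hee => hd.kap_unit_sub s hi hiv he he' hee) fun i j hg => ?_)
  obtain ⟨hg', hvi⟩ := h.gap_of_erase (fun x hx => hd.leafy h hx) s.mem hg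
  obtain ⟨e, e', hx⟩ := hp i j hg'
  refine ⟨e, e', _, hx.erase s.mem hvi, ?_⟩
  by_cases h2 : ∃ l, i ≤ l ∧ l ≤ j ∧ #(I l) = 2
  · exact hcon i j hg' hvi h2
  · push Not at h2
    have hlt := hg'.lt
    obtain rfl : j = i + 1 := by
      by_contra hne
      exact h2 (i + 1) (by omega) (by omega) (h.card_eq_two_of_ioo hg' (by omega) (by omega))
    have h3 : ∀ l, i ≤ l → l ≤ i + 1 → 3 ≤ #(I l) := fun l hl hl' => by
      have := h.two_le l (hg'.icc l hl hl')
      have := h2 l hl hl'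
      omega
    exact s.kap_path_eq_zero hr hx hvi (h3 i le_rfl (by omega)) (h3 _ (by omega) le_rfl)

end Rigidity

section DeepVertices
open scoped Matrix
open Finset

variable {E J : Type} [Fintype E] [DecidableEq E] [Fintype J]
  {I : ℤ → Finset E} {V : Finset ℤ} {F : (E → ℤ) → J → ℤ} {v : ℤ} {l₁ : E} {e₁ : J → ℤ}

theorem Deep.exists_unit_vectors {k : ℕ} (hd : Deep I V v) (h : IsLine I V)
    (hF : IsIsom (Flows I (V : Set ℤ)) F)
    (hJ : Fintype.card J + k = Fintype.card E) (hmin : ∀ S ⊂ V, ¬ Fails k I (S : Set ℤ))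
    (p : ℤ → ℤ → E → ℤ) (hp : ∀ i j, IsGap I V i j → ∃ e e', IsPath I V i j e e' (p i j)) :
    ∃ X : E → J → ℤ, ∃ g : ℤ × ℤ,
      (∀ l ∈ leaf I V v, ∀ l' ∈ leaf I V v, X l ⬝ᵥ X l' = if l = l' then 1 else 0) ∧
      (∀ l ∈ leaf I V v, ∀ l' ∈ leaf I V v, F (unit l - unit l') = X l - X l') ∧
      (∀ u ∈ V, u ≠ v → ∀ m ∈ leaf I V u, ∀ m' ∈ leaf I V u, ∀ l ∈ leaf I V v,
        F (unit m - unit m') ⬝ᵥ X l = 0) ∧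
      IsGap I V g.1 g.2 ∧ (∃ l, g.1 ≤ l ∧ l ≤ g.2 ∧ #(I l) = 2) ∧
      ∀ l ∈ leaf I V v, 1 ≤ (F (p g.1 g.2) ⬝ᵥ X l) ^ 2 := by
  obtain ⟨l₁, e₁, s⟩ := hd.exists_star h hF
  obtain ⟨i, j, hg, hvi, h2, hκ⟩ := hd.exists_gap s hJ hmin p hp
  refine ⟨fun l => IsStar.ext I F v l₁ e₁ (unit l), (i, j),
    fun l hl l' hl' => s.ext_leaf_dot_leaf hl hl', fun l hl l' hl' => ?_,
    fun u hu huv m hm m' hm' l hl => ?_, hg, h2, fun l hl => ?_⟩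
  · rw [← s.ext_sub (IsStar.leaf_erase hl) (IsStar.leaf_erase hl'),
      s.ext_of_mem (unit_sub_mem hl hl')]
  · by_cases hmm : m = m'
    · subst hmm
      rw [sub_self, hF.map_zero, zero_dotProduct]
    have hz : (unit m - unit m' : E → ℤ) l = 0 := by
      have hne : ∀ n ∈ leaf I V u, l ≠ n := fun n hn hc =>
        huv ((mem_leaf.1 hl).2 u hu (hc ▸ (mem_leaf.1 hn).1))
      rw [Pi.sub_apply, unit_ne (hne m hm), unit_ne (hne m' hm'), sub_zero]
    rw [← s.ext_of_mem (unit_sub_mem hm hm'), s.ext_dot_leaf (flows_anti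
      (coe_subset.2 (erase_subset v V)) (unit_sub_mem hm hm')) hl, hz,
      hd.kap_unit_sub s hu huv (leaf_anti (erase_subset v V) u hm)
        (leaf_anti (erase_subset v V) u hm') hmm, add_zero]
  · obtain ⟨e, e', hx⟩ := hp i j hg
    rw [← s.ext_of_mem hx.mem, s.ext_dot_leaf (flows_anti
      (coe_subset.2 (erase_subset v V)) hx.mem) hl, hx.zero_of_mem_leaf s.mem hvi hl, zero_add]
    have := sq_nonneg (IsStar.kap I F v l₁ e₁ (p i j))
    have := pow_ne_zero 2 hκ
    change 1 ≤ IsStar.kap I F v l₁ e₁ (p i j) ^ 2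
    omega

open Classical in
/-- The deep vertices of a minimal failing line can be distributed among the gaps containing a
vertex of weight two, in such a way that no gap receives too many of them. -/
theorem IsLine.exists_deep_gap {k : ℕ} (h : IsLine I V) (hf : Fails k I (V : Set ℤ))
    (hmin : ∀ S ⊂ V, ¬ Fails k I (S : Set ℤ)) :
    ∃ g : ℤ → ℤ × ℤ, (∀ v, Deep I V v → IsGap I V (g v).1 (g v).2 ∧
        ∃ l, (g v).1 ≤ l ∧ l ≤ (g v).2 ∧ #(I l) = 2) ∧
      ∀ q : ℤ × ℤ, IsGap I V q.1 q.2 → 3 * (#{v ∈ V | Deep I V v ∧ g v = q} : ℤ) ≤ q.2 - q.1 + 2 :=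
        by
  obtain ⟨J, _, F, hJ, hF⟩ := hf
  have hp : ∀ i j, ∃ x, IsGap I V i j → ∃ e e', IsPath I V i j e e' x := fun i j => by
    by_cases hg : IsGap I V i j
    · obtain ⟨e, e', x, hx⟩ := h.exists_path_of_gap hg
      exact ⟨x, fun _ => ⟨e, e', hx⟩⟩
    · exact ⟨0, fun hc => absurd hc hg⟩
  choose p hp using hp
  choose! X g h1 h2 h3 h4 h5 h6 using fun v (hd : Deep I V v) =>
    hd.exists_unit_vectors h hF hJ hmin p hp
  refine ⟨g, fun v hd => ⟨h4 v hd, h5 v hd⟩, fun q hq => ?_⟩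
  have horth : ∀ u v, Deep I V u → Deep I V v → u ≠ v → ∀ m ∈ leaf I V u, ∀ l ∈ leaf I V v,
      X u m ⬝ᵥ X v l = 0 := fun u v hu hv huv m hm l hl => by
    have hc : ∀ m' ∈ leaf I V u, X v l ⬝ᵥ X u m' = X u m ⬝ᵥ X v l := fun m' hm' => by
      have := h3 v hv u hu.1 huv m hm m' hm' l hl
      rw [h2 u hu m hm m' hm', sub_dotProduct] at this
      rw [dotProduct_comm]
      linarith
    have hb := bessel (leaf I V u) (X u) (h1 u hu) (X v l)
    rw [sum_congr rfl fun m' hm' => by rw [hc m' hm'], sum_const, nsmul_eq_mul,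
      h1 v hv l hl l hl, if_pos rfl] at hb
    have hr : (3 : ℤ) ≤ #(leaf I V u) := by exact_mod_cast hu.three_le h
    nlinarith [sq_nonneg (X u m ⬝ᵥ X v l)]
  set T := V.filter fun v => Deep I V v ∧ g v = q
  have hT : ∀ {v}, v ∈ T → Deep I V v ∧ g v = q := fun hv => (mem_filter.1 hv).2
  have hb := bessel (T.sigma fun v => leaf I V v) (fun a => X a.1 a.2) (fun a ha b hb => by
    rw [mem_sigma] at ha hb
    obtain ⟨u, m⟩ := a
    obtain ⟨v, l⟩ := b
    by_cases huv : u = v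
    · subst huv
      rw [h1 u (hT ha.1).1 m ha.2 l hb.2]
      simp
    · rw [horth u v (hT ha.1).1 (hT hb.1).1 huv m ha.2 l hb.2, if_neg]
      exact fun hc => huv (congrArg Sigma.fst hc)) (F (p q.1 q.2))
  obtain ⟨e, e', hx⟩ := hp q.1 q.2 hq
  rw [hF _ hx.mem _ hx.mem, hx.norm, sum_sigma] at hb
  refine le_trans ?_ hb
  have : ∀ v ∈ T, (3 : ℤ) ≤ ∑ l ∈ leaf I V v, (F (p q.1 q.2) ⬝ᵥ X v l) ^ 2 := fun v hv => by
    have hle := card_nsmul_le_sum (leaf I V v) (fun l => (F (p q.1 q.2) ⬝ᵥ X v l) ^ 2) 1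
      fun l hl => by
        have := h6 v (hT hv).1 l hl
        rwa [(hT hv).2] at this
    have hr : (3 : ℤ) ≤ #(leaf I V v) := by exact_mod_cast (hT hv).1.three_le h
    rw [nsmul_eq_mul, mul_one] at hle
    exact hr.trans hle
  have hle := card_nsmul_le_sum T _ 3 this
  rw [nsmul_eq_mul, mul_comm] at hle
  exact hle

end DeepVertices

section Pieces
open Finset

variable {E : Type} [Fintype E] [DecidableEq E] {I : ℤ → Finset E} {V : Finset ℤ}

/-- The vertices of weight two. -/
def twos (I : ℤ → Finset E) (V : Finset ℤ) : Finset ℤ := V.filter fun i => #(I i) = 2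

theorem mem_twos {i : ℤ} : i ∈ twos I V ↔ i ∈ V ∧ #(I i) = 2 := mem_filter

/-- The interval `[q.1, q.2]` is a maximal run of vertices of weight two. -/
structure IsRun (I : ℤ → Finset E) (V : Finset ℤ) (q : ℤ × ℤ) : Prop where
  le : q.1 ≤ q.2
  mem : ∀ l, q.1 ≤ l → l ≤ q.2 → l ∈ twos I V
  left : q.1 - 1 ∉ twos I V
  right : q.2 + 1 ∉ twos I V

theorem IsRun.eq_of_meet {p q : ℤ × ℤ} (hp : IsRun I V p) (hq : IsRun I V q) (h1 : q.1 ≤ p.2 + 1)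
    (h2 : p.1 ≤ q.2 + 1) : p = q := by
  have := hp.le
  have := hq.le
  refine Prod.ext (le_antisymm ?_ ?_) (le_antisymm ?_ ?_)
  · by_contra hc
    exact hp.left (hq.mem _ (by omega) (by omega))
  · by_contra hc
    exact hq.left (hp.mem _ (by omega) (by omega))
  · by_contra hc
    exact hq.right (hp.mem _ (by omega) (by omega))
  · by_contra hc
    exact hp.right (hq.mem _ (by omega) (by omega))

theorem exists_isRun {i : ℤ} (hi : i ∈ twos I V) : ∃ q, IsRun I V q ∧ q.1 ≤ i ∧ i ≤ q.2 := by
  let R := (twos I V).filter fun d => i ≤ d ∧ ∀ l, i ≤ l → l ≤ d → l ∈ twos I V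
  let L := (twos I V).filter fun c => c ≤ i ∧ ∀ l, c ≤ l → l ≤ i → l ∈ twos I V
  have hR : i ∈ R := mem_filter.2 ⟨hi, le_rfl, fun l h1 h2 => le_antisymm h1 h2 ▸ hi⟩
  have hL : i ∈ L := mem_filter.2 ⟨hi, le_rfl, fun l h1 h2 => le_antisymm h1 h2 ▸ hi⟩
  obtain ⟨d, hd, hdm⟩ := R.exists_max_image id ⟨i, hR⟩
  obtain ⟨c, hc, hcm⟩ := L.exists_min_image id ⟨i, hL⟩
  simp only [R, L, mem_filter, id] at hd hc hdm hcm
  refine ⟨(c, d), ⟨hc.2.1.trans hd.2.1, fun l h1 h2 => ?_, fun h => ?_, fun h => ?_⟩, hc.2.1,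
    hd.2.1⟩
  · rcases le_total l i with h | h
    · exact hc.2.2 l h1 h
    · exact hd.2.2 l h h2
  · have := hcm (c - 1) ⟨h, by have := hc.2.1; omega, fun l h1 h2 => by
      rcases eq_or_lt_of_le h1 with rfl | h1
      · exact h
      · exact hc.2.2 l (by omega) h2⟩
    omega
  · have := hdm (d + 1) ⟨h, by have := hd.2.1; omega, fun l h1 h2 => by
      rcases eq_or_lt_of_le h2 with rfl | h2
      · exact h
      · exact hd.2.2 l h1 (by omega)⟩
    omega

theorem IsGap.not_succ_mem {i j : ℤ} (h : IsLine I V) (hg : IsGap I V i j) (hj : #(I j) = 2) :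
    j + 1 ∉ V := fun hj1 => by
  have hlt := hg.lt
  have hc := h.card_eq (hg.icc j hlt.le le_rfl)
  have hr := hg.right.card_pos
  have hs : {j - 1, j + 1} ⊆ nbr V j := fun l hl => by
    rw [mem_insert, mem_singleton] at hl
    rw [mem_nbr]
    rcases hl with rfl | rfl
    · exact ⟨hg.icc _ (by omega) (by omega), Or.inl rfl⟩
    · exact ⟨hj1, Or.inr rfl⟩
  have := card_le_card hs
  rw [card_pair (by omega)] at this
  omega

theorem IsGap.fst_le_of_run {i j i' j' l l' : ℤ} (h : IsLine I V) (hg : IsGap I V i j)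
    (hg' : IsGap I V i' j') {q : ℤ × ℤ} (hq : IsRun I V q) (hl : l ≤ j)
    (hl' : i' ≤ l') (hlq : q.1 ≤ l) (hlq' : l' ≤ q.2) : i' ≤ i := by
  by_contra! hc
  have := hg.lt
  have := hg'.lt
  have hj : j ≤ i' := by
    by_contra! hj
    exact (hg'.left).ne_empty (hg.ioo i' hc hj)
  refine hg.not_succ_mem h (mem_twos.1 (hq.mem j (by omega) (by omega))).2 ?_
  rcases eq_or_lt_of_le hj with rfl | hlt
  · exact hg'.icc _ (by omega) (by omega)
  · exact (mem_twos.1 (hq.mem _ (by omega) (by omega))).1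

theorem IsGap.snd_le_of_fst {i j j' : ℤ} (hg : IsGap I V i j) (hg' : IsGap I V i j') : j ≤ j' := by
  by_contra! hc
  exact hg'.right.ne_empty (hg.ioo j' hg'.lt hc)

open Classical in
theorem IsLine.exists_deep_run {k : ℕ} (h : IsLine I V) (hf : Fails k I (V : Set ℤ))
    (hmin : ∀ S ⊂ V, ¬ Fails k I (S : Set ℤ)) :
    ∃ r : ℤ → ℤ × ℤ, (∀ v, Deep I V v → IsRun I V (r v)) ∧
      ∀ q : ℤ × ℤ, IsRun I V q →
        3 * (#{v ∈ V | Deep I V v ∧ r v = q} : ℤ) ≤ q.2 - q.1 + 4 := by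
  obtain ⟨g, hg, hb⟩ := h.exists_deep_gap hf hmin
  have hr : ∀ v, ∃ q, Deep I V v → IsRun I V q ∧
      ∃ l, (g v).1 ≤ l ∧ l ≤ (g v).2 ∧ q.1 ≤ l ∧ l ≤ q.2 := fun v => by
    by_cases hd : Deep I V v
    · obtain ⟨hgv, l, h1, h2, h3⟩ := hg v hd
      obtain ⟨q, hq, hql⟩ := exists_isRun (mem_twos.2 ⟨hgv.icc l h1 h2, h3⟩)
      exact ⟨q, fun _ => ⟨hq, l, h1, h2, hql⟩⟩
    · exact ⟨0, fun hc => absurd hc hd⟩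
  choose r hr using hr
  refine ⟨r, fun v hd => (hr v hd).1, fun q hq => ?_⟩
  rcases (filter (fun v => Deep I V v ∧ r v = q) V).eq_empty_or_nonempty with he | ⟨v, hv⟩
  · rw [he]
    have := hq.le
    simp
    omega
  obtain ⟨hd, rfl⟩ := (mem_filter.1 hv).2
  obtain ⟨-, l, h1, h2, h3, h4⟩ := hr v hd
  have hsub : {u ∈ V | Deep I V u ∧ r u = r v} ⊆ {u ∈ V | Deep I V u ∧ g u = g v} := fun u hu => by
    simp only [mem_filter] at hu ⊢
    refine ⟨hu.1, hu.2.1, ?_⟩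
    obtain ⟨-, l', h1', h2', h3', h4'⟩ := hr u hu.2.1
    rw [hu.2.2] at h3' h4'
    have hu1 := (hg u hu.2.1).1
    have hv1 := (hg v hd).1
    have he : (g u).1 = (g v).1 := le_antisymm
      (hv1.fst_le_of_run h hu1 hq h2 h1' h3 h4') (hu1.fst_le_of_run h hv1 hq h2' h1 h3' h4)
    refine Prod.ext he (le_antisymm ?_ ?_)
    · rw [he] at hu1
      exact hu1.snd_le_of_fst hv1
    · rw [he] at hu1
      exact hv1.snd_le_of_fst hu1
  have hv1 := (hg v hd).1
  have hc : (#{u ∈ V | Deep I V u ∧ r u = r v} : ℤ) ≤ #{u ∈ V | Deep I V u ∧ g u = g v} := by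
    exact_mod_cast card_le_card hsub
  have hin : ∀ m, (g v).1 < m → m < (g v).2 → m ∈ twos I V := fun m hm hm' =>
    mem_twos.2 ⟨hv1.icc m hm.le hm'.le, h.card_eq_two_of_ioo hv1 hm hm'⟩
  have hlo : (r v).1 ≤ (g v).1 + 1 := by
    by_contra! hlt
    exact hq.left (hin _ (by omega) (by omega))
  have hhi : (g v).2 - 1 ≤ (r v).2 := by
    by_contra! hlt
    exact hq.right (hin _ (by omega) (by omega))
  have := hb _ hv1
  omega

end Pieces

section Pieces
open Finset

variable {E : Type} [Fintype E] [DecidableEq E] {I : ℤ → Finset E} {V : Finset ℤ}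

/-- An interval of vertices on which the lattice of flows is easy to compress. -/
def Piece (I : ℤ → Finset E) (V : Finset ℤ) (q : ℤ × ℤ) : Prop :=
  IsRun I V q ∨ (q.1 = q.2 ∧ q.1 ∈ V ∧ #(I q.1) = 4) ∨
    (q.2 = q.1 + 1 ∧ q.1 ∈ V ∧ q.2 ∈ V ∧ #(I q.1) = 3 ∧ #(I q.2) = 3)

theorem Piece.le {q : ℤ × ℤ} (h : Piece I V q) : q.1 ≤ q.2 := by
  rcases h with h | h | h
  · exact h.le
  · exact h.1.le
  · have := h.1; omega

theorem Piece.mem {q : ℤ × ℤ} (h : Piece I V q) {l : ℤ} (h1 : q.1 ≤ l) (h2 : l ≤ q.2) : l ∈ V := by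
  rcases h with h | h | h
  · exact (mem_twos.1 (h.mem l h1 h2)).1
  · have := h.1
    obtain rfl : l = q.1 := by omega
    exact h.2.1
  · rcases (show l = q.1 ∨ l = q.2 by have := h.1; omega) with rfl | rfl
    · exact h.2.1
    · exact h.2.2.1

/-- The number of vertices of an interval. -/
def len (q : ℤ × ℤ) : ℕ := (q.2 + 1 - q.1).toNat

/-- The saving, up to one unit altogether, contributed by a piece. -/
def gain (I : ℤ → Finset E) (q : ℤ × ℤ) : ℕ :=
  if #(I q.1) = 2 ∧ 3 ≤ len q then 3 * ((len q + 1) / 4) else 1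

def Separated (p q : ℤ × ℤ) : Prop := p.2 + 1 < q.1 ∨ q.2 + 1 < p.1

/-- The vertices lying in one of the intervals of the family. -/
noncomputable def hull (B : Finset (ℤ × ℤ)) : Finset ℤ := B.biUnion fun q => Icc q.1 q.2

theorem hull_insert (q : ℤ × ℤ) (B : Finset (ℤ × ℤ)) : hull (insert q B) = Icc q.1 q.2 ∪ hull B :=
  biUnion_insert

theorem mem_hull {B : Finset (ℤ × ℤ)} {l : ℤ} : l ∈ hull B ↔ ∃ q ∈ B, q.1 ≤ l ∧ l ≤ q.2 := by
  simp [hull]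

/-- A separated family of pieces. -/
structure IsFamily (I : ℤ → Finset E) (V : Finset ℤ) (A : Finset (ℤ × ℤ)) : Prop where
  piece : ∀ q ∈ A, Piece I V q
  sep : ∀ p ∈ A, ∀ q ∈ A, p ≠ q → Separated p q

theorem IsFamily.mono {A B : Finset (ℤ × ℤ)} (h : IsFamily I V A) (hB : B ⊆ A) : IsFamily I V B :=
  ⟨fun q hq => h.piece q (hB hq), fun p hp q hq => h.sep p (hB hp) q (hB hq)⟩

theorem IsFamily.hull_subset {A : Finset (ℤ × ℤ)} (h : IsFamily I V A) : hull A ⊆ V := fun l hl =>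
    by
  obtain ⟨q, hq, h1, h2⟩ := mem_hull.1 hl
  exact (h.piece q hq).mem h1 h2

theorem IsLine.disjoint_of_separated {A : Finset (ℤ × ℤ)} (h : IsLine I V) (hA : IsFamily I V A)
    {q : ℤ × ℤ} (hq : q ∈ A) {B : Finset (ℤ × ℤ)} (hB : B ⊆ A) (hqB : q ∉ B) :
    Disjoint ((Icc q.1 q.2).biUnion I) ((hull B).biUnion I) := by
  rw [disjoint_biUnion_left]
  intro i hi
  rw [disjoint_biUnion_right]
  intro j hj
  obtain ⟨p, hp, h1, h2⟩ := mem_hull.1 hj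
  rw [mem_Icc] at hi
  have hiV := (hA.piece q hq).mem hi.1 hi.2
  have hjV := (hA.piece p (hB hp)).mem h1 h2
  rcases hA.sep q hq p (hB hp) fun hc => hqB (hc ▸ hp) with hs | hs
  · exact h.far i hiV j hjV (by omega)
  · exact (h.far j hjV i hiV (by omega)).symm

theorem IsLine.rigid_of_isRun (h : IsLine I V) {q : ℤ × ℤ} (hq : IsRun I V q) :
    ∃ e₀, Rigid I (Icc q.1 q.2) (len q + 1) e₀ := by
  have hle := hq.le
  have ht : q.2 = q.1 + ((q.2 - q.1).toNat : ℕ) := by omega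
  obtain ⟨e₀, he⟩ := h.rigid_run (s := q.1) (t := (q.2 - q.1).toNat) fun l h1 h2 =>
    mem_twos.1 (hq.mem l h1 (by omega))
  refine ⟨e₀, ?_⟩
  rw [← ht] at he
  rwa [show len q + 1 = (q.2 - q.1).toNat + 2 by unfold len; omega]

theorem IsLine.sav_gain (h : IsLine I V) {q : ℤ × ℤ} (hq : Piece I V q)
    (hs : ¬ (#(I q.1) = 2 ∧ len q < 3)) : Sav (gain I q) I (Icc q.1 q.2) := by
  unfold gain
  rcases hq with hr | hr | hr
  · have h2 := (mem_twos.1 (hr.mem q.1 le_rfl hr.le)).2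
    rw [if_pos ⟨h2, by omega⟩]
    obtain ⟨e₀, he⟩ := h.rigid_of_isRun hr
    exact he.sav
  · rw [if_neg (by omega), ← hr.1, Icc_self]
    exact sav_four hr.2.2
  · rw [if_neg (by omega)]
    have : Icc q.1 q.2 = {q.1, q.1 + 1} := by
      ext l
      rw [mem_Icc, mem_insert, mem_singleton]
      have := hr.1
      omega
    rw [this]
    have h2 := hr.1
    exact h.sav_three_three hr.2.1 (h2 ▸ hr.2.2.1) hr.2.2.2.1 (h2 ▸ hr.2.2.2.2)

/-- The gains of the pieces of a separated family add up, with a loss of at most one. -/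
theorem IsLine.exists_sav (h : IsLine I V) {A : Finset (ℤ × ℤ)} (hA : IsFamily I V A) :
    ∃ σ, Sav σ I (hull A) ∧ ∑ q ∈ A, gain I q ≤ σ + 1 := by
  induction hn : #A using Nat.strong_induction_on generalizing A with
  | _ n ih =>
  subst hn
  by_cases hbig : ∃ q ∈ A, ¬ (#(I q.1) = 2 ∧ len q < 3)
  · obtain ⟨q, hq, hqs⟩ := hbig
    obtain ⟨σ, hσ, hs⟩ := ih _ (card_erase_lt_of_mem hq) (hA.mono (erase_subset q A)) rfl
    refine ⟨gain I q + σ, ?_, ?_⟩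
    · rw [← insert_erase hq, hull_insert]
      exact (h.sav_gain (hA.piece q hq) hqs).union hσ
        (h.disjoint_of_separated hA hq (erase_subset q A) (notMem_erase q A))
    · rw [← add_sum_erase A _ hq]
      omega
  push Not at hbig
  have hone : ∀ q ∈ A, gain I q = 1 := fun q hq => by
    have := hbig q hq
    exact if_neg (by omega)
  have hsum : ∑ q ∈ A, gain I q = #A := by
    rw [sum_congr rfl hone, sum_const, smul_eq_mul, mul_one]
  rcases Nat.lt_or_ge 1 #A with hc | hc
  · obtain ⟨p, hp, q, hq, hpq⟩ := one_lt_card.1 hc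
    have hqp : q ∈ A.erase p := mem_erase.2 ⟨hpq.symm, hq⟩
    have hlt : #((A.erase p).erase q) < #A :=
      (card_erase_lt_of_mem hqp).trans (card_erase_lt_of_mem hp)
    have hsub : (A.erase p).erase q ⊆ A := (erase_subset _ _).trans (erase_subset _ _)
    obtain ⟨σ, hσ, hs⟩ := ih _ hlt (hA.mono hsub) rfl
    have hrun : ∀ r ∈ A, IsRun I V r := fun r hr => by
      have := hbig r hr
      rcases hA.piece r hr with h1 | h1 | h1
      · exact h1
      · omega
      · omega
    obtain ⟨e₀, he⟩ := h.rigid_of_isRun (hrun p hp)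
    obtain ⟨f₀, hf⟩ := h.rigid_of_isRun (hrun q hq)
    have hlen : ∀ r ∈ A, 1 ≤ len r := fun r hr => by
      have := (hA.piece r hr).le
      unfold len
      omega
    have hd1 := h.disjoint_of_separated hA hp (erase_subset p A) (notMem_erase p A)
    have hd2 := h.disjoint_of_separated hA hq hsub (notMem_erase q _)
    rw [← insert_erase hqp, hull_insert, union_biUnion, disjoint_union_right] at hd1
    refine ⟨2 + σ, ?_, ?_⟩
    · rw [← insert_erase hp, hull_insert, ← insert_erase hqp, hull_insert, ← union_assoc]
      refine (he.sav_pair hf (by have := hlen p hp; omega) (by have := hlen q hq; omega)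
        hd1.1).union hσ ?_
      rw [union_biUnion, disjoint_union_left]
      exact ⟨hd1.2, hd2⟩
    · rw [← add_sum_erase A _ hp, ← add_sum_erase _ _ hqp, hone p hp, hone q hq]
      omega
  · exact ⟨0, Sav.zero I _, by omega⟩

end Pieces

section Counting
open Finset

variable {E : Type} [Fintype E] [DecidableEq E] {I : ℤ → Finset E} {V : Finset ℤ}

theorem exists_maximal_family (I : ℤ → Finset E) (V : Finset ℤ) :
    ∃ A, IsFamily I V A ∧ (∀ q, IsRun I V q → q ∈ A) ∧
      ∀ q, Piece I V q → ∃ p ∈ A, p.1 ≤ q.2 + 1 ∧ q.1 ≤ p.2 + 1 := by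
  classical
  have hVV : ∀ q, Piece I V q → q ∈ V ×ˢ V := fun q hq =>
    mem_product.2 ⟨hq.mem le_rfl hq.le, hq.mem hq.le le_rfl⟩
  let R := (V ×ˢ V).filter fun q => IsRun I V q
  have hR : IsFamily I V R := by
    refine ⟨fun q hq => Or.inl (mem_filter.1 hq).2, fun p hp q hq hpq => ?_⟩
    by_contra hc
    unfold Separated at hc
    exact hpq ((mem_filter.1 hp).2.eq_of_meet (mem_filter.1 hq).2 (by omega) (by omega))
  have hfin : {A : Finset (ℤ × ℤ) | IsFamily I V A}.Finite :=
    ((V ×ˢ V).powerset.finite_toSet).subset fun A hA =>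
      mem_coe.2 (mem_powerset.2 fun q hq => hVV q (hA.piece q hq))
  obtain ⟨A, hRA, hA⟩ := hfin.exists_le_maximal hR
  refine ⟨A, hA.prop, fun q hq => hRA (mem_filter.2 ⟨hVV q (Or.inl hq), hq⟩), fun q hq => ?_⟩
  by_contra! hc
  have hqA : q ∉ A := fun h => by
    have := hc q h (by have := hq.le; omega)
    have := hq.le
    omega
  have hsep : ∀ p ∈ A, Separated p q := fun p hp => by
    have := hc p hp
    unfold Separated
    omega
  have hins : IsFamily I V (insert q A) := by
    refine ⟨fun p hp => ?_, fun p hp r hr hpr => ?_⟩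
    · rcases mem_insert.1 hp with rfl | hp
      · exact hq
      · exact hA.prop.piece p hp
    · rcases mem_insert.1 hp with rfl | hp <;> rcases mem_insert.1 hr with rfl | hr
      · exact absurd rfl hpr
      · exact (hsep r hr).symm
      · exact hsep p ‹_›
      · exact hA.prop.sep p hp r hr hpr
  exact hqA (hA.le_of_ge hins (subset_insert q A) (mem_insert_self q A))

/-- The vertex `i` is at distance at most `r` from a member of the family. -/
def Near (A : Finset (ℤ × ℤ)) (r i : ℤ) : Prop := ∃ p ∈ A, p.1 - r ≤ i ∧ i ≤ p.2 + r

theorem Near.of_nbr {A : Finset (ℤ × ℤ)} {r i x : ℤ} (h : Near A r x) (hx : x ∈ nbr V i) :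
    Near A (r + 1) i := by
  obtain ⟨p, hp, h1, h2⟩ := h
  have := (mem_nbr.1 hx).2
  exact ⟨p, hp, by omega, by omega⟩

theorem Near.mono {A : Finset (ℤ × ℤ)} {r s i : ℤ} (h : Near A r i) (hs : r ≤ s) : Near A s i := by
  obtain ⟨p, hp, h1, h2⟩ := h
  exact ⟨p, hp, by omega, by omega⟩

/-- Every vertex is close to a piece of a maximal family or to a deep vertex. -/
theorem IsLine.near_or_deep (h : IsLine I V) {A : Finset (ℤ × ℤ)} (hR : ∀ q, IsRun I V q → q ∈ A)
    (hA : ∀ q, Piece I V q → ∃ p ∈ A, p.1 ≤ q.2 + 1 ∧ q.1 ≤ p.2 + 1) {i : ℤ} (hi : i ∈ V) :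
    Near A 4 i ∨ ∃ v, Deep I V v ∧ v - 1 ≤ i ∧ i ≤ v + 1 := by
  have htwo : ∀ i ∈ V, #(I i) = 2 → Near A 0 i := fun i hi h2 => by
    obtain ⟨q, hq, h1, h3⟩ := exists_isRun (mem_twos.2 ⟨hi, h2⟩)
    exact ⟨q, hR q hq, by omega, by omega⟩
  have hfour : ∀ i ∈ V, #(I i) = 4 → Near A 1 i := fun i hi h4 => by
    obtain ⟨p, hp, h1, h2⟩ := hA (i, i) (Or.inr (Or.inl ⟨rfl, hi, h4⟩))
    exact ⟨p, hp, by omega, by omega⟩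
  have hthree : ∀ i ∈ V, #(I i) = 3 → (∃ y ∈ nbr V i, #(I y) = 2 ∨ #(I y) = 3) → Near A 2 i := by
    rintro i hi h3 ⟨y, hy, hy2 | hy3⟩
    · exact ((htwo y (mem_nbr.1 hy).1 hy2).of_nbr hy).mono (by omega)
    · have hyV := (mem_nbr.1 hy).1
      rcases (mem_nbr.1 hy).2 with rfl | rfl
      · obtain ⟨p, hp, h1, h2⟩ := hA (i - 1, i) (Or.inr (Or.inr ⟨by simp, hyV, hi, hy3, h3⟩))
        exact ⟨p, hp, by omega, by omega⟩
      · obtain ⟨p, hp, h1, h2⟩ := hA (i, i + 1) (Or.inr (Or.inr ⟨rfl, hi, hyV, h3, hy3⟩))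
        exact ⟨p, hp, by omega, by omega⟩
  have hfive : ∀ i ∈ V, 5 ≤ #(I i) → Near A 3 i ∨ Deep I V i := fun i hi h5 => by
    by_contra! hc
    refine hc.2 ⟨hi, Or.inl ⟨h5, fun x hx => ?_⟩⟩
    have hxV := (mem_nbr.1 hx).1
    have hxn : ¬ Near A 2 x := fun hn => hc.1 (hn.of_nbr hx)
    have := h.two_le x hxV
    have h2 : #(I x) ≠ 2 := fun h2 => hxn ((htwo x hxV h2).mono (by omega))
    have h4 : #(I x) ≠ 4 := fun h4 => hxn ((hfour x hxV h4).mono (by omega))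
    by_cases h3 : #(I x) = 3
    · refine Or.inr ⟨h3, fun y hy => ⟨fun hy2 => ?_, fun hy3 => ?_⟩⟩
      · exact hxn (hthree x hxV h3 ⟨y, hy, Or.inl hy2⟩)
      · exact hxn (hthree x hxV h3 ⟨y, hy, Or.inr hy3⟩)
    · left; omega
  have := h.two_le i hi
  rcases (show #(I i) = 2 ∨ #(I i) = 3 ∨ #(I i) = 4 ∨ 5 ≤ #(I i) by omega) with h2 | h3 | h4 | h5
  · exact Or.inl ((htwo i hi h2).mono (by omega))
  · rcases (nbr V i).eq_empty_or_nonempty with he | ⟨x, hx⟩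
    · exact Or.inr ⟨i, ⟨hi, Or.inr ⟨h3, he⟩⟩, by omega, by omega⟩
    · have hxV := (mem_nbr.1 hx).1
      have := h.two_le x hxV
      rcases (show (#(I x) = 2 ∨ #(I x) = 3) ∨ #(I x) = 4 ∨ 5 ≤ #(I x) by omega) with h2 | h4 | h5
      · exact Or.inl ((hthree i hi h3 ⟨x, hx, h2⟩).mono (by omega))
      · exact Or.inl (((hfour x hxV h4).of_nbr hx).mono (by omega))
      · rcases hfive x hxV h5 with hn | hd
        · exact Or.inl (hn.of_nbr hx)
        · have := (mem_nbr.1 hx).2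
          exact Or.inr ⟨x, hd, by omega, by omega⟩
  · exact Or.inl ((hfour i hi h4).mono (by omega))
  · rcases hfive i hi h5 with hn | hd
    · exact Or.inl (hn.mono (by omega))
    · exact Or.inr ⟨i, hd, by omega, by omega⟩

theorem card_hull_le (A : Finset (ℤ × ℤ)) : #(hull A) ≤ ∑ q ∈ A, len q :=
  card_biUnion_le.trans (sum_le_sum fun _ _ => (Int.card_Icc _ _).le)

theorem Piece.len_le_gain {q : ℤ × ℤ} (h : Piece I V q) : len q ≤ 2 * gain I q := by
  have h2 := fun (hr : IsRun I V q) => (mem_twos.1 (hr.mem q.1 le_rfl hr.le)).2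
  unfold gain len
  rcases h with h | h | h
  · have := h2 h
    split_ifs <;> omega
  · rw [if_neg (by omega)]; omega
  · rw [if_neg (by omega)]; omega

/-- If a minimal failing line is not exhausted by a maximal family of pieces, then its size is
controlled by the gains. -/
theorem IsLine.card_le_gain {k : ℕ} (h : IsLine I V) (hf : Fails k I (V : Set ℤ))
    (hmin : ∀ S ⊂ V, ¬ Fails k I (S : Set ℤ)) {A : Finset (ℤ × ℤ)} (hA : IsFamily I V A)
    (hR : ∀ q, IsRun I V q → q ∈ A)
    (hmax : ∀ q, Piece I V q → ∃ p ∈ A, p.1 ≤ q.2 + 1 ∧ q.1 ≤ p.2 + 1) :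
    #V ≤ 13 * ∑ q ∈ A, gain I q := by
  classical
  obtain ⟨r, hr, hb⟩ := h.exists_deep_run hf hmin
  let D := fun q => {v ∈ V | Deep I V v ∧ r v = q}
  let N := fun q : ℤ × ℤ => Icc (q.1 - 4) (q.2 + 4) ∪ (D q).biUnion fun v => Icc (v - 1) (v + 1)
  have hcov : V ⊆ A.biUnion N := fun i hi => by
    rw [mem_biUnion]
    rcases h.near_or_deep hR hmax hi with ⟨p, hp, h1, h2⟩ | ⟨v, hv, h1, h2⟩
    · exact ⟨p, hp, mem_union_left _ (mem_Icc.2 ⟨h1, h2⟩)⟩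
    · exact ⟨r v, hR _ (hr v hv), mem_union_right _ (mem_biUnion.2
        ⟨v, mem_filter.2 ⟨hv.1, hv, rfl⟩, mem_Icc.2 ⟨h1, h2⟩⟩)⟩
  refine (card_le_card hcov).trans (card_biUnion_le.trans ?_)
  rw [mul_sum]
  refine sum_le_sum fun q hq => (card_union_le _ _).trans ?_
  have h1 : #((D q).biUnion fun v => Icc (v - 1) (v + 1)) ≤ #(D q) * 3 :=
    card_biUnion_le_card_mul _ _ _ fun v _ => by rw [Int.card_Icc]; omega
  rw [Int.card_Icc]
  have h2 := fun (hr : IsRun I V q) => (mem_twos.1 (hr.mem q.1 le_rfl hr.le)).2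
  have h0 : #(I q.1) ≠ 2 → #(D q) = 0 := fun hne => card_eq_zero.2 <| filter_eq_empty_iff.2
    fun v _ hv => hne (h2 (hv.2 ▸ hr v hv.1))
  have hle := (hA.piece q hq).le
  unfold gain len
  rcases hA.piece q hq with hp | hp | hp
  · have := h2 hp
    have := hb q hp
    change 3 * (#(D q) : ℤ) ≤ _ at this
    split_ifs <;> omega
  · have := h0 (by omega)
    rw [if_neg (by omega)]; omega
  · have := h0 (by omega)
    rw [if_neg (by omega)]; omega

/-- A minimal failing line has at most `13 k` vertices. -/
theorem IsLine.card_le {k : ℕ} (h : IsLine I V) (hk : 0 < k) (hf : Fails k I (V : Set ℤ))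
    (hmin : ∀ S ⊂ V, ¬ Fails k I (S : Set ℤ)) : #V ≤ 13 * k := by
  obtain ⟨A, hA, hR, hmax⟩ := exists_maximal_family I V
  have hsmall : ∀ B ⊆ A, hull B ≠ V → ∑ q ∈ B, gain I q ≤ k := fun B hB hne => by
    obtain ⟨σ, hσ, hs⟩ := h.exists_sav (hA.mono hB)
    by_contra! hc
    exact hmin _ (ssubset_of_subset_of_ne (hA.mono hB).hull_subset hne) (hσ.fails (by omega))
  by_cases hV : hull A = V
  · rcases A.eq_empty_or_nonempty with rfl | ⟨z, hz⟩
    · rw [← hV]; simp [hull]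
    have hle : #V ≤ 2 * ∑ q ∈ A, gain I q := by
      rw [← hV, mul_sum]
      exact (card_hull_le A).trans (sum_le_sum fun q hq => (hA.piece q hq).len_le_gain)
    by_cases hz2 : ∃ y ∈ A, y ≠ z
    · obtain ⟨y, hy, hyz⟩ := hz2
      have hout : ∀ p ∈ A, ∀ B ⊆ A, p ∉ B → hull B ≠ V := fun p hp B hB hpB hc => by
        have hpp := hA.piece p hp
        have := hc.ge (hpp.mem le_rfl hpp.le)
        obtain ⟨q, hq, h1, h2⟩ := mem_hull.1 this
        have hs := hA.sep p hp q (hB hq) fun hc => hpB (hc ▸ hq)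
        have := hpp.le
        unfold Separated at hs
        omega
      have h1 := hsmall {z} (singleton_subset_iff.2 hz)
        (hout y hy _ (singleton_subset_iff.2 hz) (by simpa using hyz))
      have h2 := hsmall (A.erase z) (erase_subset z A)
        (hout z hz _ (erase_subset z A) (notMem_erase z A))
      rw [sum_singleton] at h1
      rw [← add_sum_erase A _ hz] at hle
      omega
    · push Not at hz2
      obtain rfl : A = {z} := eq_singleton_iff_unique_mem.2 ⟨hz, hz2⟩
      have hVz : V = Icc z.1 z.2 := by rw [← hV]; simp [hull]
      have hcard : #V = len z := by rw [hVz, Int.card_Icc, len]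
      rcases hA.piece z hz with hp | hp | hp
      · have hzle := hp.le
        by_cases hl : len z < 3
        · omega
        have ht : z.2 - 1 = z.1 + ((len z - 2 : ℕ) : ℤ) := by unfold len at *; omega
        obtain ⟨e₀, he⟩ := h.rigid_run (s := z.1) (t := len z - 2) fun l h1 h2 =>
          mem_twos.1 (hp.mem l h1 (by omega))
        rw [← ht] at he
        have : ¬ k ≤ 3 * ((len z - 2 + 2) / 4) := fun hc => by
          refine hmin _ ?_ (he.sav.fails hc)
          rw [hVz]
          exact Icc_ssubset_Icc_right hzle le_rfl (by omega)
        omega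
      · unfold len at hcard; omega
      · unfold len at hcard; omega
  · have := hsmall A subset_rfl hV
    have := h.card_le_gain hf hmin hA hR hmax
    omega

end Counting

section Duality
open scoped Matrix
open Finset

/-- The recursive description of dual sequences. -/
inductive DualRec : List ℤ → List ℤ → Prop
  | base : DualRec [2] [2]
  | incr {a b : ℤ} {A B : List ℤ} : DualRec (a :: A) (b :: B) →
      DualRec ((a + 1) :: A) (2 :: b :: B)
  | cons {a b : ℤ} {A B : List ℤ} : DualRec (a :: A) (b :: B) →
      DualRec (2 :: a :: A) ((b + 1) :: B)

theorem DualRec.symm {a b : List ℤ} (h : DualRec a b) : DualRec b a := by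
  induction h with
  | base => exact .base
  | incr _ ih => exact ih.cons
  | cons _ ih => exact ih.incr

theorem DualRec.two_le {a b : List ℤ} (h : DualRec a b) : ∀ x ∈ a, 2 ≤ x := by
  induction h with
  | base => simp
  | incr _ ih =>
    simp only [List.mem_cons, forall_eq_or_imp] at ih ⊢
    exact ⟨by omega, ih.2⟩
  | cons _ ih =>
    simp only [List.mem_cons, forall_eq_or_imp] at ih ⊢
    exact ⟨le_rfl, ih⟩

theorem DualRec.ne_nil {a b : List ℤ} (h : DualRec a b) : a ≠ [] := by
  cases h <;> simp

variable {E : Type} [Fintype E] [DecidableEq E]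

/-- The sets `Is 0, Is 1, …` have the sizes prescribed by `a` and meet like the edges of a path. -/
structure PathModel (Is : ℕ → Finset E) (a : List ℤ) : Prop where
  card : ∀ i < a.length, (#(Is i) : ℤ) = a.getD i 0
  adj : ∀ i, i + 1 < a.length → #(Is i ∩ Is (i + 1)) = 1
  far : ∀ i j, i + 1 < j → j < a.length → Disjoint (Is i) (Is j)

theorem PathModel.exists_mem {Is : ℕ → Finset E} {a : List ℤ} (hm : PathModel Is a) (T : Finset E)
    (hT : #T + 1 < #(Is 0)) :
    ∃ m ∈ Is 0, m ∉ T ∧ ∀ i, 0 < i → i < a.length → m ∉ Is i := by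
  have hcap : #((Is 0 ∩ Is 1).filter fun _ => 1 < a.length) ≤ 1 := by
    by_cases ha : 1 < a.length
    · exact (card_filter_le _ _).trans (hm.adj 0 ha).le
    · simp [ha]
  have hlt : #((Is 0 ∩ Is 1).filter fun _ => 1 < a.length) + #T < #(Is 0) := by omega
  obtain ⟨m, hm0, hm1⟩ := exists_mem_notMem_of_card_lt_card ((card_union_le _ _).trans_lt hlt)
  simp only [mem_union, mem_filter, mem_inter, not_or] at hm1
  refine ⟨m, hm0, hm1.2, fun i hi hia hmi => ?_⟩
  obtain rfl | hi1 : i = 1 ∨ 1 < i := by omega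
  · exact hm1.1 ⟨⟨hm0, hmi⟩, hia⟩
  · exact disjoint_left.1 (hm.far 0 i (by omega) hia) hm0 hmi

/-- The vectors `X 0, X 1, …` form a basis of the lattice of flows of a path, with Gram matrix
prescribed by the dual sequence `b`. -/
structure FlowBasis (Is : ℕ → Finset E) (n : ℕ) (b : List ℤ) (X : ℕ → E → ℤ) : Prop where
  supp : ∀ j < b.length, ∀ e, (∀ i < n, e ∉ Is i) → X j e = 0
  flow : ∀ j < b.length, ∀ i < n, ∑ e ∈ Is i, X j e = 0
  norm : ∀ j < b.length, X j ⬝ᵥ X j = b.getD j 0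
  adj : ∀ j, j + 1 < b.length → X j ⬝ᵥ X (j + 1) = -1
  far : ∀ i j, i + 1 < j → j < b.length → X i ⬝ᵥ X j = 0
  span : ∀ x : E → ℤ, (∀ i < n, ∑ e ∈ Is i, x e = 0) →
    ∃ c : ℕ → ℤ, ∀ i < n, ∀ e ∈ Is i, x e = ∑ j ∈ range b.length, c j * X j e
  card : #((range n).biUnion Is) = n + b.length

theorem DualRec.exists_flowBasis {a b : List ℤ} (h : DualRec a b) :
    ∀ {Is : ℕ → Finset E}, PathModel Is a → ∀ l ∈ Is 0, (∀ i, 0 < i → i < a.length → l ∉ Is i) →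
      ∃ X, FlowBasis Is a.length b X ∧ X 0 l ^ 2 = 1 ∧
        ∀ j, 0 < j → j < b.length → X j l = 0 := by
  induction h with
  | base =>
    intro Is hm l hl _
    have hc := hm.card 0 (by simp)
    simp only [List.getD_cons_zero] at hc
    obtain ⟨m, hml, hI⟩ : ∃ m, m ≠ l ∧ Is 0 = {l, m} := by
      obtain ⟨x, y, hxy, hI⟩ := card_eq_two.1 (by exact_mod_cast hc : #(Is 0) = 2)
      rw [hI, mem_insert, mem_singleton] at hl
      rcases hl with rfl | rfl
      · exact ⟨y, hxy.symm, hI⟩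
      · exact ⟨x, hxy, by rw [hI, pair_comm]⟩
    refine ⟨fun _ => unit l - unit m, ⟨?_, ?_, ?_, ?_, ?_, ?_, ?_⟩, ?_, ?_⟩
    · intro j _ e he
      have := he 0 (by simp)
      rw [hI, mem_insert, mem_singleton, not_or] at this
      simp [unit_ne this.1, unit_ne this.2]
    · intro j _ i hi
      obtain rfl : i = 0 := by simpa using hi
      rw [hI, sum_pair hml.symm]
      simp [unit_ne hml, unit_ne hml.symm]
    · intro j hj
      obtain rfl : j = 0 := by simpa using hj
      simp [sub_dotProduct, unit_ne hml, unit_ne hml.symm]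
    · simp
    · intro i j h1 h2
      simp at h2
      omega
    · intro x hx
      refine ⟨fun _ => x l, fun i hi e he => ?_⟩
      obtain rfl : i = 0 := by simpa using hi
      have h0 := hx 0 (by simp)
      rw [hI, sum_pair hml.symm] at h0
      rw [hI, mem_insert, mem_singleton] at he
      rcases he with rfl | rfl
      · simp [unit_ne hml.symm]
      · simp [unit_ne hml]
        linarith
    · simp [hI, card_pair hml.symm]
    · simp [unit_ne hml.symm]
    · intro j h1 h2
      simp at h2
      omega
  | @incr a b A B hd ih =>
    intro Is hm l hl hout
    have ha : 2 ≤ a := hd.two_le a (by simp)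
    have hc0 := hm.card 0 (by simp)
    simp only [List.getD_cons_zero] at hc0
    simp only [List.length_cons] at hout ⊢
    obtain ⟨m, hm0, hml, hm1⟩ := hm.exists_mem {l} (by rw [card_singleton]; omega)
    rw [mem_singleton] at hml
    simp only [List.length_cons] at hm1
    have hlm : l ≠ m := Ne.symm hml
    set Is' : ℕ → Finset E := Function.update Is 0 ((Is 0).erase l) with hIs'
    have h0' : Is' 0 = (Is 0).erase l := by simp [hIs']
    have hs' : ∀ i, 0 < i → Is' i = Is i := fun i hi => by simp [hIs', hi.ne']
    have hsub : ∀ i, Is' i ⊆ Is i := fun i => by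
      rcases i.eq_zero_or_pos with rfl | hi
      · exact h0' ▸ erase_subset _ _
      · exact (hs' i hi).subset
    have hl' : ∀ i < A.length + 1, l ∉ Is' i := fun i hi => by
      rcases i.eq_zero_or_pos with rfl | hi'
      · simp [h0']
      · exact hs' i hi' ▸ hout i hi' hi
    have hm' : PathModel Is' (a :: A) := by
      refine ⟨fun i hi => ?_, fun i hi => ?_, fun i j hij hj =>
        (hm.far i j hij (by simpa using hj)).mono (hsub i) (hsub j)⟩
      · rcases i with _ | i
        · rw [h0', card_erase_of_mem hl]
          simp
          omega
        · rw [hs' _ i.succ_pos, hm.card (i + 1) (by simpa using hi)]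
          simp
      · rw [hs' _ i.succ_pos, ← hm.adj i (by simpa using hi)]
        congr 1
        rcases i.eq_zero_or_pos with rfl | hi'
        · rw [h0', erase_inter, erase_eq_of_notMem]
          exact fun h => hout 1 one_pos (by simpa using hi) (mem_inter.1 h).2
        · rw [hs' i hi']
    obtain ⟨X, hX, hXm, hXj⟩ := ih hm' m (h0' ▸ mem_erase.2 ⟨hml, hm0⟩) fun i hi hi' =>
      hs' i hi ▸ hm1 i hi (by simpa using hi')
    simp only [List.length_cons] at hX hXj
    have hXl : ∀ j < B.length + 1, X j l = 0 := fun j hj =>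
      hX.supp j (by simpa using hj) l hl'
    set s := X 0 m with hs
    set Y : ℕ → E → ℤ := fun j => Nat.casesOn j (s • (unit l - unit m)) X with hY
    have hY0 : Y 0 = s • (unit l - unit m) := rfl
    have hYs : ∀ j, Y (j + 1) = X j := fun j => rfl
    have hYdot : ∀ x : E → ℤ, Y 0 ⬝ᵥ x = s * (x l - x m) := fun x => by
      rw [hY0, smul_dotProduct, sub_dotProduct, unit_dot, unit_dot, smul_eq_mul]
    have hY0flow : ∀ i < A.length + 1, ∑ e ∈ Is i, Y 0 e = 0 := fun i hi => by
      simp only [hY0, Pi.smul_apply, Pi.sub_apply, smul_eq_mul, ← mul_sum, sum_sub_distrib,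
        sum_unit]
      rcases i.eq_zero_or_pos with rfl | hi'
      · simp [hl, hm0]
      · simp [hout i hi' hi, hm1 i hi' hi]
    have hunion : (range (A.length + 1)).biUnion Is =
        insert l ((range (A.length + 1)).biUnion Is') := by
      ext e
      simp only [mem_biUnion, mem_range, mem_insert]
      constructor
      · rintro ⟨i, hi, he⟩
        by_cases hel : e = l
        · exact .inl hel
        refine .inr ⟨i, hi, ?_⟩
        rcases i.eq_zero_or_pos with rfl | hi'
        · exact h0' ▸ mem_erase.2 ⟨hel, he⟩
        · exact (hs' i hi').symm ▸ he
      · rintro (rfl | ⟨i, hi, he⟩)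
        · exact ⟨0, by omega, hl⟩
        · exact ⟨i, hi, hsub i he⟩
    refine ⟨Y, ⟨?_, ?_, ?_, ?_, ?_, ?_, ?_⟩, ?_, ?_⟩
    · rintro (_ | j) hj e he
      · have h1 := he 0 (by omega)
        rw [hY0, Pi.smul_apply, Pi.sub_apply, unit_ne (ne_of_mem_of_not_mem hl h1).symm,
          unit_ne (ne_of_mem_of_not_mem hm0 h1).symm]
        simp
      · exact hX.supp j (by simpa using hj) e fun i hi h => he i hi (hsub i h)
    · rintro (_ | j) hj i hi
      · exact hY0flow i hi
      · have h1 := hX.flow j (by simpa using hj) i hi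
        rcases i.eq_zero_or_pos with rfl | hi'
        · rw [h0'] at h1
          rw [← add_sum_erase _ _ hl, hYs, h1, hXl j (by simpa using hj), add_zero]
        · rwa [hs' i hi'] at h1
    · rintro (_ | j) hj
      · rw [hYdot, hY0]
        simp [unit_ne hml, unit_ne hlm]
        linarith
      · simpa [hYs] using hX.norm j (by simpa using hj)
    · rintro (_ | j) hj
      · rw [hYdot, hYs, hXl 0 (by omega), ← hs]
        linarith
      · exact hX.adj j (by simpa using hj)
    · rintro (_ | i) (_ | j) hij hj
      · omega
      · rw [hYdot, hYs, hXl j (by simpa using hj), hXj j (by omega) (by simpa using hj)]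
        ring
      · omega
      · exact hX.far i j (by omega) (by simpa using hj)
    · intro x hx
      set y : E → ℤ := x - (s * x l) • Y 0 with hy
      have hyl : y l = 0 := by
        simp only [hy, hY0, Pi.sub_apply, Pi.smul_apply, unit_self, unit_ne hlm, smul_eq_mul]
        linear_combination -(x l) * hXm
      have hyflow : ∀ i < A.length + 1, ∑ e ∈ Is i, y e = 0 := fun i hi => by
        simp only [hy, Pi.sub_apply, Pi.smul_apply, smul_eq_mul, sum_sub_distrib, ← mul_sum,
          hx i hi, hY0flow i hi]
        ring
      obtain ⟨c, hc⟩ := hX.span y fun i hi => by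
        rcases i.eq_zero_or_pos with rfl | hi'
        · rw [h0', ← hyflow 0 hi, ← add_sum_erase _ _ hl, hyl, zero_add]
        · rw [hs' i hi', hyflow i hi]
      refine ⟨fun j => Nat.casesOn j (s * x l) c, fun i hi e he => ?_⟩
      have hye : y e = ∑ j ∈ range (B.length + 1), c j * X j e := by
        by_cases hel : e = l
        · rw [hel, hyl, sum_eq_zero]
          exact fun j hj => by rw [hXl j (mem_range.1 hj), mul_zero]
        · refine hc i hi e ?_
          rcases i.eq_zero_or_pos with rfl | hi'
          · exact h0' ▸ mem_erase.2 ⟨hel, he⟩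
          · exact (hs' i hi').symm ▸ he
      simp only [List.length_cons]
      rw [sum_range_succ']
      simp only [hYs, ← hye]
      simp [hy]
    · rw [hunion, card_insert_of_notMem, hX.card]
      · simp only [List.length_cons]
        omega
      · simpa using hl'
    · simpa [hY0, unit_ne hlm] using hXm
    · rintro (_ | j) h1 hj
      · omega
      · exact hXl j (by simpa using hj)
  | @cons a b A B hd ih =>
    intro Is hm l hl hout
    simp only [List.length_cons] at hout ⊢
    have hc0 := hm.card 0 (by simp)
    simp only [List.getD_cons_zero] at hc0
    obtain ⟨h, hh⟩ := card_eq_one.1 (hm.adj 0 (by simp))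
    have hh0 : h ∈ Is 0 ∩ Is 1 := hh ▸ mem_singleton_self h
    rw [mem_inter] at hh0
    have hlh : l ≠ h := fun e => hout 1 one_pos (by omega) (e ▸ hh0.2)
    have hI : Is 0 = {l, h} := by
      refine (eq_of_subset_of_card_le ?_ ?_).symm
      · simp [insert_subset_iff, hl, hh0.1]
      · rw [card_pair hlh]
        exact_mod_cast hc0.le
    have hm' : PathModel (fun i => Is (i + 1)) (a :: A) :=
      ⟨fun i hi => by simpa using hm.card (i + 1) (by simpa using hi),
        fun i hi => hm.adj (i + 1) (by simpa using hi),
        fun i j hij hj => hm.far (i + 1) (j + 1) (by omega) (by simpa using hj)⟩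
    obtain ⟨X, hX, hXh, hXj⟩ := ih hm' h hh0.2 fun i hi hi' =>
      disjoint_left.1 (hm.far 0 (i + 1) (by omega) (by simpa using hi')) hh0.1
    simp only [List.length_cons] at hX hXj
    have hl' : ∀ i < A.length + 1, l ∉ Is (i + 1) := fun i hi => hout _ i.succ_pos (by omega)
    have hXl : ∀ j < B.length + 1, X j l = 0 := fun j hj =>
      hX.supp j (by simpa using hj) l hl'
    set Y : ℕ → E → ℤ := Function.update X 0 (X 0 - X 0 h • unit l) with hY
    have hY0 : Y 0 = X 0 - X 0 h • unit l := by simp [hY]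
    have hYs : ∀ j, 0 < j → Y j = X j := fun j hj => by simp [hY, hj.ne']
    have hYe : ∀ j, ∀ e ≠ l, Y j e = X j e := fun j e he => by
      rcases j.eq_zero_or_pos with rfl | hj
      · simp [hY0, unit_ne he]
      · rw [hYs j hj]
    have hYl : ∀ j < B.length + 1, Y j l = -X j h := fun j hj => by
      rcases j.eq_zero_or_pos with rfl | hj'
      · simp [hY0, hXl 0 hj]
      · rw [hYs j hj', hXl j hj, hXj j hj' hj, neg_zero]
    have hYdot : ∀ j < B.length + 1, 0 < j → Y 0 ⬝ᵥ Y j = X 0 ⬝ᵥ X j := fun j hj hj' => by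
      rw [hY0, hYs j hj', sub_dotProduct, smul_dotProduct, unit_dot, hXl j hj]
      simp
    have hunion : (range (A.length + 1 + 1)).biUnion Is =
        insert l ((range (A.length + 1)).biUnion fun i => Is (i + 1)) := by
      ext e
      simp only [mem_biUnion, mem_range, mem_insert]
      constructor
      · rintro ⟨_ | i, hi, he⟩
        · rw [hI, mem_insert, mem_singleton] at he
          exact he.imp id fun he : e = h => ⟨0, by omega, he ▸ hh0.2⟩
        · exact .inr ⟨i, by omega, he⟩
      · rintro (rfl | ⟨i, hi, he⟩)
        · exact ⟨0, by omega, hl⟩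
        · exact ⟨i + 1, by omega, he⟩
    refine ⟨Y, ⟨?_, ?_, ?_, ?_, ?_, ?_, ?_⟩, ?_, ?_⟩
    · intro j hj e he
      rw [hYe j e (fun h => he 0 (by omega) (h ▸ hl))]
      exact hX.supp j (by simpa using hj) e fun i hi => he (i + 1) (by omega)
    · rintro j hj (_ | i) hi
      · rw [hI, sum_pair hlh, hYl j (by simpa using hj), hYe j h hlh.symm, neg_add_cancel]
      · rw [← hX.flow j (by simpa using hj) i (by omega)]
        exact sum_congr rfl fun e he => hYe j e fun h => hl' i (by omega) (h ▸ he)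
    · rintro (_ | j) hj
      · have h1 := hX.norm 0 (by simp)
        simp only [List.getD_cons_zero] at h1
        rw [hY0, sub_dotProduct, dotProduct_sub, dotProduct_sub, h1]
        simp only [smul_dotProduct, dotProduct_smul, unit_dot, dot_unit, hXl 0 (by omega),
          unit_self, smul_eq_mul, List.getD_cons_zero]
        linarith
      · rw [hYs _ j.succ_pos]
        simpa using hX.norm (j + 1) (by simpa using hj)
    · rintro (_ | j) hj
      · rw [hYdot _ (by simpa using hj) (by omega)]
        exact hX.adj 0 (by simpa using hj)
      · rw [hYs _ j.succ_pos, hYs _ (by omega)]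
        exact hX.adj _ (by simpa using hj)
    · rintro (_ | i) j hij hj
      · rw [hYdot _ (by simpa using hj) (by omega)]
        exact hX.far 0 j hij (by simpa using hj)
      · rw [hYs _ i.succ_pos, hYs _ (by omega)]
        exact hX.far _ j hij (by simpa using hj)
    · intro x hx
      obtain ⟨c, hc⟩ := hX.span x fun i hi => hx (i + 1) (by omega)
      simp only [List.length_cons] at hc ⊢
      have key : ∀ e ≠ l, ∑ j ∈ range (B.length + 1), c j * Y j e =
          ∑ j ∈ range (B.length + 1), c j * X j e := fun e he =>
        sum_congr rfl fun j _ => by rw [hYe j e he]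
      have hh1 := hc 0 (by omega) h hh0.2
      refine ⟨c, ?_⟩
      rintro (_ | i) hi e he
      · have h0 := hx 0 (by omega)
        rw [hI, sum_pair hlh] at h0
        rw [hI, mem_insert, mem_singleton] at he
        rcases he with rfl | rfl
        · rw [sum_congr rfl fun j hj => by rw [hYl j (mem_range.1 hj), mul_neg],
            sum_neg_distrib, ← hh1]
          linarith
        · rw [key _ hlh.symm, hh1]
      · have hel : e ≠ l := fun h => hl' i (by omega) (h ▸ he)
        rw [key e hel, hc i (by omega) e he]
    · rw [hunion, card_insert_of_notMem, hX.card]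
      · simp only [List.length_cons]
        omega
      · simpa using hl'
    · rw [hYl 0 (by omega)]
      linarith
    · intro j h1 hj
      rw [hYl j hj, hXj j h1 hj, neg_zero]

end Duality

section DualSequences

theorem one_lt_negCF : ∀ {l : List ℤ}, l ≠ [] → (∀ x ∈ l, 2 ≤ x) → 1 < negCF l
  | [], h, _ => absurd rfl h
  | [a], _, h => by
    have h2 : (2 : ℚ) ≤ a := by exact_mod_cast h a (by simp)
    simp only [negCF, div_zero, sub_zero]
    linarith
  | a :: b :: l, _, h => by
    have h2 : (2 : ℚ) ≤ a := by exact_mod_cast h a (by simp)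
    have h1 := one_lt_negCF (List.cons_ne_nil b l) fun x hx => h x (List.mem_cons_of_mem a hx)
    have h3 := (div_lt_one (by linarith)).2 h1
    rw [negCF]
    linarith

theorem negCF_add_one (a : ℤ) (l : List ℤ) : negCF ((a + 1) :: l) = negCF (a :: l) + 1 := by
  simp only [negCF, Int.cast_add, Int.cast_one]
  ring

theorem DualRec.inv_add_inv {a b : List ℤ} (h : DualRec a b) :
    (negCF a)⁻¹ + (negCF b)⁻¹ = 1 := by
  have step : ∀ {a b : ℤ} {A B : List ℤ}, DualRec (a :: A) (b :: B) →
      (negCF (a :: A))⁻¹ + (negCF (b :: B))⁻¹ = 1 →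
      (negCF ((a + 1) :: A))⁻¹ + (negCF (2 :: b :: B))⁻¹ = 1 := fun {a b A B} h ih => by
    have hx := one_lt_negCF h.ne_nil h.two_le
    rw [negCF_add_one, show negCF (2 :: b :: B) = 2 - 1 / negCF (b :: B) from rfl, one_div,
      eq_sub_of_add_eq' ih]
    generalize negCF (a :: A) = x at *
    have : 2 - (1 - x⁻¹) = (x + 1) / x := by field_simp; ring
    rw [this, inv_div]
    field_simp
    ring
  induction h with
  | base => norm_num [negCF]
  | incr h ih => exact step h ih
  | cons h ih => rw [add_comm] at ih ⊢; exact step h.symm ih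

theorem two_lt_negCF {a : ℤ} {l : List ℤ} (ha : 3 ≤ a) (hl : ∀ x ∈ l, 2 ≤ x) :
    2 < negCF (a :: l) := by
  have h : 1 < negCF ((a - 1) :: l) := one_lt_negCF (by simp) <| by
    simp only [List.mem_cons, forall_eq_or_imp]
    exact ⟨by omega, hl⟩
  have h' := negCF_add_one (a - 1) l
  rw [sub_add_cancel] at h'
  linarith

theorem negCF_two_cons_le {l : List ℤ} (hl : ∀ x ∈ l, 2 ≤ x) : negCF (2 :: l) ≤ 2 := by
  rcases eq_or_ne l [] with rfl | h
  · norm_num [negCF]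
  · have := one_div_pos.2 (one_pos.trans (one_lt_negCF h hl))
    rw [negCF]
    push_cast
    linarith

theorem negCF_two_cons_lt {l : List ℤ} (h : l ≠ []) (hl : ∀ x ∈ l, 2 ≤ x) :
    negCF (2 :: l) < 2 := by
  have := one_div_pos.2 (one_pos.trans (one_lt_negCF h hl))
  rw [negCF]
  push_cast
  linarith

theorem dualRec_of_inv_add_inv {a b : List ℤ} (ha : a ≠ []) (hb : b ≠ []) (ha2 : ∀ x ∈ a, 2 ≤ x)
    (hb2 : ∀ x ∈ b, 2 ≤ x) (hab : (negCF a)⁻¹ + (negCF b)⁻¹ = 1) : DualRec a b := by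
  induction hn : a.length + b.length using Nat.strong_induction_on generalizing a b with
  | _ n ih =>
  subst hn
  have step : ∀ {b₀ : ℤ} {A B : List ℤ}, A.length + B.length + 2 = a.length + b.length →
      (∀ x ∈ A, 2 ≤ x) → (∀ x ∈ B, 2 ≤ x) → 3 ≤ b₀ →
      (negCF (2 :: A))⁻¹ + (negCF (b₀ :: B))⁻¹ = 1 → DualRec (2 :: A) (b₀ :: B) := by
    intro b₀ A B hlen hA hB hb₀ h
    have hB' : ∀ x ∈ (b₀ - 1) :: B, 2 ≤ x := by
      simp only [List.mem_cons, forall_eq_or_imp]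
      exact ⟨by omega, hB⟩
    have hy : 1 < negCF ((b₀ - 1) :: B) := one_lt_negCF (by simp) hB'
    have hy' := negCF_add_one (b₀ - 1) B
    rw [sub_add_cancel] at hy'
    rw [hy'] at h
    match A, hlen, hA, h with
    | [], _, _, h =>
      simp only [negCF, div_zero, sub_zero] at h
      rw [← negCF] at h
      generalize negCF ((b₀ - 1) :: B) = y at *
      have : y + 1 ≠ 0 := by linarith
      field_simp at h
      push_cast at h
      linarith
    | a₁ :: A, hlen, hA, h =>
      have hx := one_lt_negCF (List.cons_ne_nil a₁ A) hA
      have := ih _ (by simp at hlen ⊢; omega) (List.cons_ne_nil a₁ A) (List.cons_ne_nil _ _) hA hB'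
        (by
          rw [negCF] at h
          push_cast at h
          generalize negCF (a₁ :: A) = x at *
          generalize negCF ((b₀ - 1) :: B) = y at *
          rw [show 2 - 1 / x = (2 * x - 1) / x by field_simp] at h
          have hx0 : 2 * x - 1 ≠ 0 := by linarith
          field_simp at h ⊢
          linarith) rfl
      simpa using this.cons
  obtain ⟨a₀, A, rfl⟩ := List.exists_cons_of_ne_nil ha
  obtain ⟨b₀, B, rfl⟩ := List.exists_cons_of_ne_nil hb
  have hlen : A.length + B.length + 2 = (a₀ :: A).length + (b₀ :: B).length := by
    simp only [List.length_cons]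
    omega
  have hx := one_lt_negCF ha ha2
  have hy := one_lt_negCF hb hb2
  simp only [List.mem_cons, forall_eq_or_imp] at ha2 hb2
  obtain ⟨ha₀, hA⟩ := ha2
  obtain ⟨hb₀, hB⟩ := hb2
  obtain rfl | ha₀ : a₀ = 2 ∨ 3 ≤ a₀ := by omega
  · obtain rfl | hb₀ : b₀ = 2 ∨ 3 ≤ b₀ := by omega
    · have hx2 := negCF_two_cons_le hA
      have hy2 := negCF_two_cons_le hB
      have hA0 : A = [] := by
        by_contra h
        have h1 := inv_strictAnti₀ (by linarith) (negCF_two_cons_lt h hA)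
        have h2 := inv_anti₀ (by linarith) hy2
        norm_num at h1 h2
        linarith
      have hB0 : B = [] := by
        by_contra h
        have h1 := inv_strictAnti₀ (by linarith) (negCF_two_cons_lt h hB)
        have h2 := inv_anti₀ (by linarith) hx2
        norm_num at h1 h2
        linarith
      subst hA0 hB0
      exact .base
    · exact step hlen hA hB hb₀ hab
  · obtain rfl | hb₀ : b₀ = 2 ∨ 3 ≤ b₀ := by omega
    · exact (step (by omega) hB hA ha₀ (by rwa [add_comm])).symm
    · have h1 := inv_strictAnti₀ two_pos (two_lt_negCF ha₀ hA)
      have h2 := inv_strictAnti₀ two_pos (two_lt_negCF hb₀ hB)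
      norm_num at h1 h2
      linarith

theorem DualSeqs.dualRec {a b : List ℤ} (h : DualSeqs a b) : DualRec a b := by
  obtain ⟨ha, hb, ha2, hb2, p, q, hq, hpq, -, hpa, hpb⟩ := h
  refine dualRec_of_inv_add_inv ha hb ha2 hb2 ?_
  have hp : (p : ℚ) ≠ 0 := by exact_mod_cast (hq.trans hpq).ne'
  rw [hpa, hpb, inv_div, inv_div]
  field_simp
  ring

theorem DualRec.dualSeqs {a b : List ℤ} (h : DualRec a b) : DualSeqs a b := by
  have ha := one_lt_negCF h.ne_nil h.two_le
  have hab := h.inv_add_inv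
  refine ⟨h.ne_nil, h.symm.ne_nil, h.two_le, h.symm.two_le, (negCF a).num, (negCF a).den,
    by exact_mod_cast (negCF a).pos, ?_, (negCF a).reduced, ((negCF a).num_div_den).symm, ?_⟩
  · rw [← Rat.num_div_den (negCF a), one_lt_div (by exact_mod_cast (negCF a).pos)] at ha
    exact_mod_cast ha
  · rw [← inv_inj, inv_div, eq_sub_of_add_eq' hab, sub_div, div_self, Int.cast_natCast,
      ← inv_div, Rat.num_div_den]
    exact_mod_cast (Rat.num_pos.2 (one_pos.trans ha)).ne'

theorem exists_dualRec {a : List ℤ} (ha : a ≠ []) (ha2 : ∀ x ∈ a, 2 ≤ x) : ∃ b, DualRec a b := by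
  have step : ∀ {a : ℤ} {A b : List ℤ}, DualRec (a :: A) b → ∀ n : ℕ,
      ∃ b', DualRec ((a + n) :: A) b' := fun {a A b} h n => by
    induction n with
    | zero => exact ⟨b, by simpa using h⟩
    | succ n ih =>
      obtain ⟨b', h'⟩ := ih
      obtain ⟨c, C, rfl⟩ := List.exists_cons_of_ne_nil h'.symm.ne_nil
      exact ⟨_, by simpa [add_assoc] using h'.incr⟩
  induction a with
  | nil => exact absurd rfl ha
  | cons x A ih =>
    simp only [List.mem_cons, forall_eq_or_imp] at ha2
    obtain ⟨n, rfl⟩ := Int.le.dest ha2.1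
    rcases eq_or_ne A [] with rfl | hA
    · exact step .base n
    · obtain ⟨b, hb⟩ := ih hA ha2.2
      obtain ⟨c, C, rfl⟩ := List.exists_cons_of_ne_nil hb.symm.ne_nil
      obtain ⟨a, A, rfl⟩ := List.exists_cons_of_ne_nil hA
      exact step hb.cons n

end DualSequences

section ConfigBasis
open scoped Matrix
open Finset

variable {E : Type} [Fintype E] [DecidableEq E]

theorem flows_comp {ι κ : Type} (I : κ → Finset E) (f : ι → κ) (S : Set ι) :
    Flows (I ∘ f) S = Flows I (f '' S) := by
  ext x
  simp [mem_flows]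

theorem fails_comp {ι κ : Type} {k : ℕ} {I : κ → Finset E} {f : ι → κ} {S : Set ι} :
    Fails k (I ∘ f) S ↔ Fails k I (f '' S) := by
  simp only [Fails, flows_comp]

/-- The sets `I v` have the sizes prescribed by the weights of `C` and meet like the edges at the
vertices of `C`. -/
structure IsModel (C : Config) (I : C.V → Finset E) : Prop where
  card : ∀ v, (#(I v) : ℤ) = -C.w v
  adj : ∀ u v, C.graph.Adj u v → #(I u ∩ I v) = 1
  far : ∀ u v, u ≠ v → ¬C.graph.Adj u v → Disjoint (I u) (I v)

/-- The vectors `X d` form a basis of the lattice of flows, with Gram matrix prescribed by `Γ`. -/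
structure IsFlowBasis {ι : Type} [Fintype ι] (I : ι → Finset E) (Γ : Config) (X : Γ.V → E → ℤ) :
    Prop where
  supp : ∀ d e, e ∉ univ.biUnion I → X d e = 0
  flow : ∀ d, X d ∈ Flows I Set.univ
  gram : ∀ u v, X u ⬝ᵥ X v = if u = v then Γ.w u else if Γ.graph.Adj u v then -1 else 0
  span : ∀ x ∈ Flows I Set.univ, ∃ c : Γ.V → ℤ, ∀ e ∈ univ.biUnion I, x e = ∑ d, c d * X d e

theorem exists_of_dotProduct_self_eq_one {J : Type} [Fintype J] [DecidableEq J] {x : J → ℤ}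
    (hx : x ⬝ᵥ x = 1) : ∃ j, x j ≠ 0 ∧ ∀ i, i ≠ j → x i = 0 := by
  obtain ⟨j, hj⟩ : ∃ j, x j ≠ 0 := by
    by_contra! h
    simp [funext h] at hx
  refine ⟨j, hj, fun i hi => ?_⟩
  have h1 := add_sum_erase univ (fun i => x i * x i) (mem_univ j)
  have h2 : ∑ i ∈ univ.erase j, x i * x i ≤ 0 := by
    have : 0 < x j * x j := mul_self_pos.2 hj
    change _ = x ⬝ᵥ x at h1
    rw [hx] at h1
    linarith
  have h3 := (sum_eq_zero_iff_of_nonneg fun i _ => mul_self_nonneg (x i)).1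
    (h2.antisymm (sum_nonneg fun i _ => mul_self_nonneg (x i))) i (by simp [hi])
  exact mul_self_eq_zero.1 h3

theorem dotProduct_sum_smul {J K ι : Type} [Fintype J] [Fintype K] [Fintype ι] {φ : ι → J → ℤ}
    {X : ι → K → ℤ} (h : ∀ u v, φ u ⬝ᵥ φ v = X u ⬝ᵥ X v) (c c' : ι → ℤ) :
    (∑ d, c d • φ d) ⬝ᵥ (∑ d, c' d • φ d) = (∑ d, c d • X d) ⬝ᵥ (∑ d, c' d • X d) := by
  simp only [sum_dotProduct, dotProduct_sum, smul_dotProduct, dotProduct_smul, h]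

variable {ι : Type} [Fintype ι] {I : ι → Finset E} {Γ : Config} {X : Γ.V → E → ℤ} {k n : ℕ}

theorem IsFlowBasis.fails_of_embedding (hX : IsFlowBasis I Γ X) (hn : #(univ.biUnion I) = n)
    (hk : k ≤ n) {φ : Γ.V → Fin (n - k) → ℤ} (hφ : Γ.IsEmbedding _ φ) :
    Fails k I Set.univ := by
  classical
  choose! c hc using hX.span
  have hdot : ∀ u v, φ u ⬝ᵥ φ v = X u ⬝ᵥ X v := fun u v => by rw [hX.gram]; exact hφ u v
  refine ⟨Fin (n - k) ⊕ {e // e ∉ univ.biUnion I}, inferInstance,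
    fun x => Sum.elim (∑ d, c x d • φ d) fun e => x e, ?_, fun x hx y hy => ?_⟩
  · have := card_le_univ (univ.biUnion I)
    have h2 := Fintype.card_subtype_compl (fun e => e ∈ univ.biUnion I)
    rw [Fintype.card_coe] at h2
    rw [Fintype.card_sum, Fintype.card_fin, h2]
    omega
  · rw [sumElim_dotProduct_sumElim, dotProduct_sum_smul hdot]
    have h1 : (∑ d, c x d • X d) ⬝ᵥ (∑ d, c y d • X d) =
        ∑ e ∈ univ.biUnion I, x e * y e := by
      rw [dotProduct, ← sum_subset (subset_univ (univ.biUnion I))]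
      · refine sum_congr rfl fun e he => ?_
        simp [hc x hx e he, hc y hy e he]
      · intro e _ he
        simp [hX.supp _ e he]
    rw [h1, dotProduct, dotProduct, ← sum_add_sum_compl (univ.biUnion I)]
    congr 1
    exact (sum_subtype _ (by simp) fun e => x e * y e).symm

theorem IsFlowBasis.exists_embedding (hX : IsFlowBasis I Γ X) (hn : #(univ.biUnion I) = n)
    (hf : Fails k I Set.univ) :
    k ≤ n ∧ ∃ φ : Γ.V → Fin (n - k) → ℤ, Γ.IsEmbedding _ φ := by
  classical
  obtain ⟨J, _, F, hJ, hF⟩ := hf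
  have hu : ∀ e : {e // e ∉ univ.biUnion I}, unit e.1 ∈ Flows I Set.univ := fun e =>
    unit_mem fun i _ he => e.2 (mem_biUnion.2 ⟨i, mem_univ i, he⟩)
  choose c hc0 hc using fun e : {e // e ∉ univ.biUnion I} =>
    exists_of_dotProduct_self_eq_one (x := F (unit e.1)) (by rw [hF _ (hu e) _ (hu e)]; simp)
  have hdot : ∀ e (y : J → ℤ), F (unit e.1) ⬝ᵥ y = F (unit e.1) (c e) * y (c e) := fun e y =>
    sum_eq_single _ (fun i _ hi => by rw [hc e i hi, zero_mul]) (by simp)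
  have hinj : Function.Injective c := fun e e' hee => by
    by_contra hne
    have h := hF _ (hu e) _ (hu e')
    rw [hdot, hee, unit_dot, unit_ne (fun h => hne (Subtype.ext h)), mul_eq_zero] at h
    exact h.elim (hee ▸ hc0 e) (hc0 e')
  have hXc : ∀ d e, F (X d) (c e) = 0 := fun d e => by
    have h := hF _ (hu e) _ (hX.flow d)
    rw [hdot, unit_dot, hX.supp d _ e.2, mul_eq_zero] at h
    exact h.resolve_left (hc0 e)
  have hcard : Fintype.card {j // j ∉ Set.range c} + (Fintype.card E - n) = Fintype.card J := by
    have h1 := Fintype.card_subtype_compl (fun e => e ∈ univ.biUnion I)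
    rw [Fintype.card_coe, hn] at h1
    have h2 := Fintype.card_subtype_compl (fun j => j ∈ Set.range c)
    have h3 : Fintype.card {j // j ∈ Set.range c} = _ := Set.card_range_of_injective hinj
    have h4 := Fintype.card_le_of_injective c hinj
    omega
  have hnE : n ≤ Fintype.card E := hn ▸ card_le_univ _
  refine ⟨by omega, ?_⟩
  let σ : Fin (n - k) ≃ {j // j ∉ Set.range c} := (Fintype.equivFinOfCardEq (by omega)).symm
  refine ⟨fun d i => F (X d) (σ i), fun u v => ?_⟩
  rw [← hX.gram, ← hF _ (hX.flow u) _ (hX.flow v), dot,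
    σ.sum_comp fun j => F (X u) j * F (X v) j, dotProduct,
    ← Fintype.sum_subtype_add_sum_subtype (· ∈ Set.range c), right_eq_add]
  refine sum_eq_zero ?_
  rintro ⟨_, e, rfl⟩ -
  rw [hXc, zero_mul]

end ConfigBasis

section Assembly
open scoped Matrix
open Finset

variable {E : Type} [Fintype E] [DecidableEq E]

/-- The `j`-th vertex of the `i`-th component. -/
def vtx {L : List (List ℤ)} (i : Fin L.length) (j : Fin (L.get i).length) : (ofList L).V := ⟨i, j⟩

theorem exists_vtx {L : List (List ℤ)} (d : (ofList L).V) : ∃ i j, d = vtx i j := ⟨d.1, d.2, rfl⟩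

theorem vtx_inj {L : List (List ℤ)} {i i' : Fin L.length} {j : Fin (L.get i).length}
    {j' : Fin (L.get i').length} : vtx i j = vtx i' j' ↔ i = i' ∧ (j : ℕ) = j' := by
  refine ⟨fun h => ?_, fun ⟨h, h'⟩ => ?_⟩
  · obtain ⟨rfl, h⟩ := Sigma.mk.inj_iff.1 h
    exact ⟨rfl, congrArg Fin.val (eq_of_heq h)⟩
  · subst h
    rw [Fin.ext h']

theorem adj_vtx {L : List (List ℤ)} {i i' : Fin L.length} {j : Fin (L.get i).length}
    {j' : Fin (L.get i').length} : (ofList L).graph.Adj (vtx i j) (vtx i' j') ↔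
      i = i' ∧ ((j : ℕ) + 1 = j' ∨ (j' : ℕ) + 1 = j) := Iff.rfl

theorem w_vtx {L : List (List ℤ)} (i : Fin L.length) (j : Fin (L.get i).length) :
    (ofList L).w (vtx i j) = (L.get i).get j := rfl

theorem sum_ofList {M : Type} [AddCommMonoid M] {L : List (List ℤ)} (f : (ofList L).V → M) :
    ∑ d, f d = ∑ i, ∑ j, f (vtx i j) :=
  Fintype.sum_sigma (α := fun i : Fin L.length => Fin (L.get i).length) f

theorem sum_length (L : List (List ℤ)) : ∑ i : Fin L.length, (L.get i).length = totalLen L :=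
  Fin.sum_univ_fun_getElem L List.length

theorem card_ofList (L : List (List ℤ)) : Fintype.card (ofList L).V = totalLen L := by
  rw [← card_univ, card_eq_sum_ones, sum_ofList, ← sum_length]
  simp

theorem exists_isFlowBasis {P D : List (List ℤ)} (h : IsDualPair P D)
    {I : (ofList P).V → Finset E} (hI : IsModel (ofList P) I) :
    ∃ X, IsFlowBasis I (ofList D) X ∧ #(univ.biUnion I) = totalLen P + totalLen D := by
  obtain ⟨hlen, hd⟩ := h
  let Is : Fin P.length → ℕ → Finset E := fun i j =>
    if h : j < (P.get i).length then I (vtx i ⟨j, h⟩) else ∅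
  have hIs : ∀ i j (hj : j < (P.get i).length), Is i j = I (vtx i ⟨j, hj⟩) := fun i j hj =>
    dif_pos hj
  have hmem : ∀ i, ∀ j < (P.get i).length, ∀ e ∈ Is i j, ∃ j', e ∈ I (vtx i j') :=
    fun i j hj e he => ⟨⟨j, hj⟩, hIs i j hj ▸ he⟩
  have hsep : ∀ {i j i' j' e}, e ∈ I (vtx i j) → e ∈ I (vtx i' j') → i = i' :=
    fun {i j i' j' e} he he' => by
      by_contra hne
      exact disjoint_left.1 (hI.far _ _ (fun h => hne (vtx_inj.1 h).1)
        fun h => hne (adj_vtx.1 h).1) he he'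
  have hcomp : ∀ i, ∃ X, FlowBasis (Is i) (P.get i).length (D.get (Fin.cast hlen i)) X := by
    intro i
    set a := (P.get i).map fun x => -x with ha
    have hal : a.length = (P.get i).length := List.length_map _
    have hdr : DualRec a (D.get (Fin.cast hlen i)) := (hd i).dualRec
    have hpath : PathModel (Is i) a := by
      refine ⟨fun j hj => ?_, fun j hj => ?_, fun j j' hjj hj' => ?_⟩
      · rw [hIs i j (hal ▸ hj), hI.card, List.getD_eq_getElem _ _ hj]
        simp [ha, w_vtx]
      · rw [hIs i j (by omega), hIs i (j + 1) (by omega)]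
        exact hI.adj _ _ (adj_vtx.2 ⟨rfl, .inl rfl⟩)
      · rw [hIs i j (by omega), hIs i j' (by omega)]
        refine hI.far _ _ (fun h => ?_) fun h => ?_
        · have := (vtx_inj.1 h).2
          dsimp only at this
          omega
        · have := (adj_vtx.1 h).2
          dsimp only at this
          omega
    have h0 : 0 < a.length := List.length_pos_iff.2 hdr.ne_nil
    have hc := hpath.card 0 h0
    rw [List.getD_eq_getElem _ _ h0] at hc
    have := hdr.two_le _ (List.getElem_mem h0)
    obtain ⟨l, hl, -, hl'⟩ := hpath.exists_mem ∅ (by rw [card_empty]; omega)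
    obtain ⟨X, hX, -⟩ := hdr.exists_flowBasis hpath l hl hl'
    exact ⟨X, hal ▸ hX⟩
  choose X hX using hcomp
  let σ : Fin D.length → Fin P.length := Fin.cast hlen.symm
  have hσ : Function.Bijective σ := (finCongr hlen.symm).bijective
  have hY : ∀ i, FlowBasis (Is (σ i)) (P.get (σ i)).length (D.get i) (X (σ i)) := fun i => hX (σ i)
  have hXe : ∀ i (j : Fin (D.get i).length) e, X (σ i) j e ≠ 0 → ∃ j', e ∈ I (vtx (σ i) j') := by
    intro i j e he
    by_contra! hc
    exact he ((hY i).supp j j.2 e fun j' hj' he' => (hmem _ j' hj' e he').elim hc)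
  refine ⟨fun d => X (σ d.1) d.2, ⟨?_, ?_, ?_, ?_⟩, ?_⟩
  · intro d e he
    by_contra hne
    obtain ⟨j', hj'⟩ := hXe d.1 d.2 e hne
    exact he (mem_biUnion.2 ⟨_, mem_univ _, hj'⟩)
  · intro d v _
    obtain ⟨i, j, rfl⟩ := exists_vtx d
    obtain ⟨i', j', rfl⟩ := exists_vtx v
    change ∑ e ∈ I (vtx i' j'), X (σ i) j e = 0
    by_cases hi : σ i = i'
    · subst hi
      rw [← hIs (σ i) j' j'.2]
      exact (hY i).flow j j.2 j' j'.2
    · refine sum_eq_zero fun e he => ?_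
      by_contra hne
      obtain ⟨j'', hj''⟩ := hXe i j e hne
      exact hi (hsep hj'' he)
  · intro d d'
    obtain ⟨i, j, rfl⟩ := exists_vtx d
    obtain ⟨i', j', rfl⟩ := exists_vtx d'
    simp only [vtx_inj, adj_vtx, w_vtx]
    change X (σ i) j ⬝ᵥ X (σ i') j' = _
    by_cases hi : i = i'
    · subst hi
      have key : ∀ {a b : ℕ}, a < b → b < (D.get i).length →
          X (σ i) a ⬝ᵥ X (σ i) b = if a + 1 = b then -1 else 0 := fun {a b} hab hb => by
        split_ifs with h
        · subst h
          exact (hY i).adj a hb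
        · exact (hY i).far a b (by omega) hb
      rcases lt_trichotomy (j : ℕ) j' with h | h | h
      · rw [if_neg fun h' => h.ne h'.2, key h j'.2]
        exact if_congr (by omega) rfl rfl
      · simp only [h, true_and, if_true]
        rw [← h, (hY i).norm j j.2, List.getD_eq_getElem _ _ j.2]
        rfl
      · rw [if_neg fun h' => h.ne' h'.2, dotProduct_comm, key h j.2]
        exact if_congr (by omega) rfl rfl
    · rw [if_neg fun h => hi h.1, if_neg fun h => hi h.1]
      refine sum_eq_zero fun e _ => ?_
      by_contra hne
      obtain ⟨a, ha⟩ := hXe i j e (left_ne_zero_of_mul hne)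
      obtain ⟨b, hb⟩ := hXe i' j' e (right_ne_zero_of_mul hne)
      exact hi (hσ.1 (hsep ha hb))
  · intro x hx
    choose c hc using fun i => (hY i).span x fun j hj => by
      rw [hIs _ j hj]
      exact hx _ trivial
    refine ⟨fun d => c d.1 d.2, fun e he => ?_⟩
    obtain ⟨v, -, he⟩ := mem_biUnion.1 he
    obtain ⟨i', j', rfl⟩ := exists_vtx v
    obtain ⟨i, rfl⟩ := hσ.2 i'
    rw [hc i j' j'.2 e (by rwa [hIs _ j' j'.2])]
    rw [sum_ofList, Fintype.sum_eq_single i, sum_range]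
    · rfl
    intro i₁ hi₁
    refine sum_eq_zero fun j₁ _ => ?_
    by_contra hne
    obtain ⟨j'', hj''⟩ := hXe i₁ j₁ e (right_ne_zero_of_mul hne)
    exact hi₁ (hσ.1 (hsep hj'' he))
  · have hU : univ.biUnion I = univ.biUnion fun i => (range (P.get i).length).biUnion (Is i) := by
      ext e
      simp only [mem_biUnion, mem_univ, true_and, mem_range]
      constructor
      · rintro ⟨v, he⟩
        obtain ⟨i, j, rfl⟩ := exists_vtx v
        exact ⟨i, j, j.2, by rwa [hIs _ j j.2]⟩
      · rintro ⟨i, j, hj, he⟩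
        exact (hmem i j hj e he).imp' _ fun _ h => h
    rw [hU, card_biUnion, sum_congr rfl fun i _ => (hX i).card, sum_add_distrib, sum_length]
    · congr 1
      exact ((finCongr hlen).sum_comp fun i => (D.get i).length).trans (sum_length D)
    · intro i _ i' _ hne
      refine disjoint_left.2 fun e he he' => ?_
      simp only [mem_biUnion, mem_range] at he he'
      obtain ⟨j, hj, he⟩ := he
      obtain ⟨j', hj', he'⟩ := he'
      obtain ⟨_, h1⟩ := hmem i j hj e he
      obtain ⟨_, h2⟩ := hmem i' j' hj' e he'
      exact hne (hsep h1 h2)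

theorem failsX_iff {P D : List (List ℤ)} (h : IsDualPair P D) {I : (ofList P).V → Finset E}
    (hI : IsModel (ofList P) I) {k : ℕ} : FailsX k P D ↔ Fails k I Set.univ := by
  obtain ⟨X, hX, hn⟩ := exists_isFlowBasis h hI
  exact ⟨fun ⟨hk, _, hφ⟩ => hX.fails_of_embedding hn hk hφ, hX.exists_embedding hn⟩

end Assembly

section Positions
open Finset

/-- The vertices of `C` sit at distinct integers, adjacent vertices being consecutive. -/
structure IsPos (C : Config) (pos : C.V → ℤ) : Prop where
  inj : Function.Injective pos
  adj : ∀ u v, C.graph.Adj u v ↔ pos u + 1 = pos v ∨ pos v + 1 = pos u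

theorem isPos_ofList {L : List (List ℤ)} {s : Fin L.length → ℤ}
    (h : ∀ i i', i < i' → s i' + (L.get i).length < s i) :
    IsPos (ofList L) fun d => s d.1 - ((d.2 : ℕ) : ℤ) := by
  have key : ∀ (d d' : (ofList L).V), d.1 < d'.1 →
      s d'.1 - ((d'.2 : ℕ) : ℤ) + 1 < s d.1 - ((d.2 : ℕ) : ℤ) := fun d d' hlt => by
    have := h _ _ hlt
    have := d.2.2
    omega
  refine ⟨fun d d' hd => ?_, fun d d' => ?_⟩
  · rcases lt_trichotomy d.1 d'.1 with hlt | heq | hlt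
    · have := key d d' hlt
      omega
    · refine vtx_inj.2 ⟨heq, ?_⟩
      have := congrArg s heq
      omega
    · have := key d' d hlt
      omega
  · obtain ⟨i, j, rfl⟩ := exists_vtx d
    obtain ⟨i', j', rfl⟩ := exists_vtx d'
    rw [adj_vtx]
    rcases lt_trichotomy i i' with hlt | heq | hlt
    · have := key (vtx i j) (vtx i' j') hlt
      simp only [hlt.ne, false_and, false_iff]
      omega
    · subst heq
      simp only [vtx, true_and]
      omega
    · have := key (vtx i' j') (vtx i j) hlt
      simp only [hlt.ne', false_and, false_iff]
      omega

theorem exists_isPos (L : List (List ℤ)) : ∃ pos, IsPos (ofList L) pos := by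
  refine ⟨_, isPos_ofList (s := fun i => -(((i : ℕ) : ℤ) * (totalLen L + 1))) fun i i' h => ?_⟩
  have h1 : (L.get i).length ≤ totalLen L :=
    sum_length L ▸ single_le_sum (f := fun i => (L.get i).length) (fun _ _ => Nat.zero_le _)
      (mem_univ i)
  have h2 : ((i : ℕ) : ℤ) + 1 ≤ (i' : ℕ) := by exact_mod_cast h
  have h3 : ((L.get i).length : ℤ) ≤ totalLen L := by exact_mod_cast h1
  have h4 := mul_le_mul_of_nonneg_right h2 (by positivity : (0 : ℤ) ≤ totalLen L + 1)
  linarith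

theorem IsPos.exists_isModel {C : Config} {pos : C.V → ℤ} (hp : IsPos C pos)
    (hw : ∀ v, C.w v ≤ -2) :
    ∃ (E : Type) (_ : Fintype E) (_ : DecidableEq E) (I : C.V → Finset E), IsModel C I := by
  classical
  have hprev : ∀ v, #(univ.filter fun u => pos u + 1 = pos v) ≤ 1 := fun v =>
    card_le_one.2 fun a ha b hb => by
    simp only [mem_filter, mem_univ, true_and] at ha hb
    exact hp.inj (by omega)
  obtain ⟨W, hW⟩ : ∃ W : ℕ, ∀ v, (-C.w v).toNat ≤ W :=
    ⟨∑ v, (-C.w v).toNat, fun v => single_le_sum (f := fun v => (-C.w v).toNat)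
      (fun _ _ => Nat.zero_le _) (mem_univ v)⟩
  set n : C.V → ℕ := fun v => (-C.w v).toNat - #(univ.filter fun u => pos u + 1 = pos v) with hn
  have hn1 : ∀ v, 0 < n v := fun v => by
    have := hw v
    have := hprev v
    simp only [hn]
    omega
  set I : C.V → Finset (C.V × Fin (W + 1)) := fun v =>
    ({v} ×ˢ univ.filter fun p : Fin (W + 1) => (p : ℕ) < n v) ∪
      (univ.filter fun u => pos u + 1 = pos v) ×ˢ {0} with hI
  have hmem : ∀ v x p, (x, p) ∈ I v ↔ x = v ∧ (p : ℕ) < n v ∨ pos x + 1 = pos v ∧ p = 0 :=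
    fun v x p => by
    simp only [hI, mem_union, mem_product, mem_singleton, mem_filter, mem_univ, true_and]
  refine ⟨C.V × Fin (W + 1), inferInstance, inferInstance, I, ⟨fun v => ?_, ?_, ?_⟩⟩
  · rw [hI, card_union_of_disjoint, card_product, card_product, card_singleton, card_singleton,
      Fin.card_filter_val_lt]
    · have := hw v
      have := hprev v
      have := hW v
      simp only [hn]
      omega
    · rw [disjoint_left]
      rintro ⟨x, p⟩ h1 h2
      simp only [mem_product, mem_singleton, mem_filter, mem_univ, true_and] at h1 h2
      have := h2.1
      rw [h1.1] at this
      omega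
  · have key : ∀ u v, pos u + 1 = pos v → #(I u ∩ I v) = 1 := fun u v huv => by
      refine card_eq_one.2 ⟨(u, 0), ?_⟩
      ext ⟨x, p⟩
      rw [mem_inter, hmem, hmem, mem_singleton, Prod.mk.injEq]
      constructor
      · rintro ⟨⟨rfl, h1⟩ | ⟨h1, h1'⟩, ⟨rfl, h2⟩ | ⟨h2, h2'⟩⟩
        · omega
        · exact ⟨rfl, h2'⟩
        · omega
        · omega
      · rintro ⟨rfl, rfl⟩
        exact ⟨.inl ⟨rfl, hn1 x⟩, .inr ⟨huv, rfl⟩⟩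
    intro u v huv
    rcases (hp.adj u v).1 huv with h | h
    · exact key u v h
    · rw [inter_comm, key v u h]
  · intro u v huv hadj
    rw [hp.adj] at hadj
    have hne : pos u ≠ pos v := fun h => huv (hp.inj h)
    rw [disjoint_left]
    rintro ⟨x, p⟩ h1 h2
    rw [hmem] at h1 h2
    rcases h1 with ⟨rfl, -⟩ | ⟨h1, -⟩ <;> rcases h2 with ⟨rfl, -⟩ | ⟨h2, -⟩
    · exact huv rfl
    · omega
    · omega
    · omega

/-- A finite set of integers is a union of runs of consecutive integers, no two of which are
contiguous; a run is recorded by its largest element and its length minus one. -/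
theorem exists_runs (T : Finset ℤ) :
    ∃ Q : List (ℤ × ℕ), Q.Pairwise (fun p q : ℤ × ℕ => q.1 + 1 < p.1 - p.2) ∧
      ∀ x, x ∈ T ↔ ∃ p ∈ Q, p.1 - p.2 ≤ x ∧ x ≤ p.1 := by
  induction T using Finset.induction_on_max with
  | empty => exact ⟨[], by simp⟩
  | insert m T hm ih =>
    obtain ⟨Q, hQ, hT⟩ := ih
    have hlt : ∀ q ∈ Q, q.1 < m := fun q hq => hm _ ((hT _).2 ⟨q, hq, by omega, le_rfl⟩)
    by_cases h1 : m - 1 ∈ T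
    · cases Q with
      | nil => simp [hT] at h1
      | cons q Q =>
        rw [List.pairwise_cons] at hQ
        have hq : q.1 = m - 1 := by
          obtain ⟨p, hp, hp1, hp2⟩ := (hT _).1 h1
          have := hlt q (by simp)
          rcases List.mem_cons.1 hp with rfl | hp
          · omega
          · have := hQ.1 p hp
            omega
        refine ⟨(m, q.2 + 1) :: Q, List.pairwise_cons.2 ⟨fun p hp => ?_, hQ.2⟩, fun x => ?_⟩
        · have := hQ.1 p hp
          push_cast
          omega
        · simp only [mem_insert, hT, List.mem_cons, exists_eq_or_imp, ← or_assoc]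
          refine or_congr_left ?_
          push_cast
          omega
    · refine ⟨(m, 0) :: Q, List.pairwise_cons.2 ⟨fun p hp => ?_, hQ⟩, fun x => ?_⟩
      · have h2 := hlt p hp
        have h3 : p.1 ≠ m - 1 := fun h => h1 ((hT _).2 ⟨p, hp, by omega, by omega⟩)
        push_cast
        omega
      · simp only [mem_insert, hT, List.mem_cons, exists_eq_or_imp]
        refine or_congr_left ?_
        push_cast
        omega

theorem exists_isDualPair {L : List (List ℤ)} (hL : ∀ l ∈ L, l ≠ [])
    (hL2 : ∀ l ∈ L, ∀ x ∈ l, x ≤ -2) : ∃ D, IsDualPair L D := by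
  have : ∀ l : List ℤ, l ∈ L → ∃ b, DualRec (l.map fun x => -x) b := fun l hl => by
    refine exists_dualRec (by simpa using hL l hl) fun x hx => ?_
    obtain ⟨y, hy, rfl⟩ := List.mem_map.1 hx
    have := hL2 l hl y hy
    omega
  choose! β hβ using this
  refine ⟨L.map β, by simp, fun i => ?_⟩
  have := (hβ _ (List.get_mem L i)).dualSeqs
  simpa using this

end Positions

section Induced
open Finset

theorem IsDualPair.w_le {P D : List (List ℤ)} (h : IsDualPair P D) (v : (ofList P).V) :
    (ofList P).w v ≤ -2 := by
  obtain ⟨hlen, hd⟩ := h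
  obtain ⟨i, j, rfl⟩ := exists_vtx v
  have := (hd i).2.2.1 _ (List.mem_map_of_mem (List.get_mem (P.get i) j))
  rw [w_vtx]
  omega

theorem IsDualPair.ne_nil {P D : List (List ℤ)} (h : IsDualPair P D) : ∀ c ∈ P, c ≠ [] := by
  obtain ⟨hlen, hd⟩ := h
  intro c hc
  obtain ⟨i, rfl⟩ := List.mem_iff_get.1 hc
  simpa using (hd i).1

theorem exists_isInducedOn {C : Config} {pos : C.V → ℤ} (hp : IsPos C pos)
    (hw : ∀ v, C.w v ≤ -2) (S : Set C.V) :
    ∃ P D, IsDualPair P D ∧ IsInducedOn (ofList P) C S := by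
  classical
  obtain ⟨Q, hQ, hT⟩ := exists_runs ((univ.filter fun v => v ∈ S).image pos)
  set w : ℤ → ℤ := Function.extend pos C.w fun _ => -2 with hwd
  have hwp : ∀ v, w (pos v) = C.w v := fun v => hp.inj.extend_apply _ _ v
  have hw2 : ∀ x, w x ≤ -2 := fun x => by
    by_cases h : ∃ v, pos v = x
    · obtain ⟨v, rfl⟩ := h
      exact hwp v ▸ hw v
    · exact (Function.extend_apply' _ _ _ h).le
  set L : List (List ℤ) := Q.map fun p => (List.range (p.2 + 1)).map fun j => w (p.1 - (j : ℕ))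
    with hL
  obtain ⟨D, hD⟩ : ∃ D, IsDualPair L D := by
    refine exists_isDualPair (fun l hl => ?_) fun l hl x hx => ?_
    · obtain ⟨p, -, rfl⟩ := List.mem_map.1 hl
      simp
    · obtain ⟨p, -, rfl⟩ := List.mem_map.1 hl
      obtain ⟨j, -, rfl⟩ := List.mem_map.1 hx
      exact hw2 _
  refine ⟨L, D, hD, ?_⟩
  have hLQ : L.length = Q.length := List.length_map _
  have hlen : ∀ i : Fin L.length, (L.get i).length = (Q.get (Fin.cast hLQ i)).2 + 1 := fun i => by
    simp [hL]
  set g : (ofList L).V → ℤ := fun d => (Q.get (Fin.cast hLQ d.1)).1 - ((d.2 : ℕ) : ℤ) with hgd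
  have hg : IsPos (ofList L) g := isPos_ofList (s := fun i => (Q.get (Fin.cast hLQ i)).1)
    fun i i' h => by
      have := List.pairwise_iff_get.1 hQ (Fin.cast hLQ i) (Fin.cast hLQ i') h
      rw [hlen]
      push_cast
      linarith
  have hgw : ∀ d, (ofList L).w d = w (g d) := fun d => by
    obtain ⟨i, j, rfl⟩ := exists_vtx d
    rw [w_vtx]
    simp [hL, hgd, vtx]
  have hgT : ∀ d, ∃ v ∈ S, pos v = g d := fun d => by
    have hj := d.2.2.trans_eq (hlen d.1)
    have := (hT (g d)).2 ⟨_, List.get_mem Q (Fin.cast hLQ d.1), by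
      simp only [hgd]
      omega, by
      simp only [hgd]
      omega⟩
    simpa using this
  choose f hfS hf using hgT
  refine ⟨f, fun d d' h => hg.inj ?_, fun d => ?_, fun d d' => ?_, ?_⟩
  · rw [← hf, ← hf, h]
  · rw [hgw, ← hf, hwp]
  · rw [hg.adj, hp.adj, hf, hf]
  · ext v
    constructor
    · rintro ⟨d, rfl⟩
      exact hfS d
    · intro hv
      obtain ⟨p, hpQ, h1, h2⟩ := (hT (pos v)).1 (mem_image_of_mem _ (by simpa using hv))
      obtain ⟨i, rfl⟩ := List.mem_iff_get.1 hpQ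
      have hj : (Q.get i).1 - pos v < (L.get (Fin.cast hLQ.symm i)).length := by
        rw [hlen]
        push_cast
        simp only [Fin.cast_cast, Fin.cast_eq_self]
        linarith
      refine ⟨vtx (Fin.cast hLQ.symm i) ⟨((Q.get i).1 - pos v).toNat, by omega⟩, hp.inj ?_⟩
      rw [hf]
      simp only [hgd, vtx, Fin.cast_cast, Fin.cast_eq_self]
      omega

variable {E : Type} [Fintype E] [DecidableEq E] {k : ℕ}

theorem IsModel.comp {A C : Config} {I : C.V → Finset E} (hI : IsModel C I) {f : A.V → C.V}
    (hf : Function.Injective f) (hw : ∀ v, C.w (f v) = A.w v)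
    (hadj : ∀ u v, A.graph.Adj u v ↔ C.graph.Adj (f u) (f v)) : IsModel A (I ∘ f) :=
  ⟨fun v => hw v ▸ hI.card (f v), fun u v h => hI.adj _ _ ((hadj u v).1 h),
    fun u v hne h => hI.far _ _ (hf.ne hne) ((hadj u v).not.1 h)⟩

theorem failsX_iff_of_isInducedOn {C : Config} {I : C.V → Finset E} (hI : IsModel C I)
    {P D : List (List ℤ)} (h : IsDualPair P D) {S : Set C.V} (hS : IsInducedOn (ofList P) C S) :
    FailsX k P D ↔ Fails k I S := by
  obtain ⟨f, hf, hw, hadj, rfl⟩ := hS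
  rw [failsX_iff h (hI.comp hf hw hadj), fails_comp, Set.image_univ]

theorem isInducedOn_range {A C : Config} {f : A.V → C.V} (hf : Function.Injective f)
    (hw : ∀ v, C.w (f v) = A.w v) (hadj : ∀ u v, A.graph.Adj u v ↔ C.graph.Adj (f u) (f v)) :
    IsInducedOn A C (Set.range f) := ⟨f, hf, hw, hadj, rfl⟩

theorem memSk_iff {P D : List (List ℤ)} (h : IsDualPair P D) {I : (ofList P).V → Finset E}
    (hI : IsModel (ofList P) I) :
    MemSk k P D ↔ Fails k I Set.univ ∧ ∀ S, S ≠ Set.univ → ¬Fails k I S := by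
  refine ⟨fun ⟨_, hf, hm⟩ => ⟨(failsX_iff h hI).1 hf, fun S hS hfS => ?_⟩, fun ⟨hf, hm⟩ =>
    ⟨h, (failsX_iff h hI).2 hf, fun S hS P' D' h' hi hfS =>
      hm S hS ((failsX_iff_of_isInducedOn hI h' hi).1 hfS)⟩⟩
  obtain ⟨pos, hp⟩ := exists_isPos P
  obtain ⟨P', D', h', hi⟩ := exists_isInducedOn hp h.w_le S
  exact hm S hS P' D' h' hi ((failsX_iff_of_isInducedOn hI h' hi).2 hfS)

theorem IsDualPair.exists_isModel {P D : List (List ℤ)} (h : IsDualPair P D) :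
    ∃ (E : Type) (_ : Fintype E) (_ : DecidableEq E) (I : (ofList P).V → Finset E),
      IsModel (ofList P) I := by
  obtain ⟨pos, hp⟩ := exists_isPos P
  exact hp.exists_isModel h.w_le

theorem IsDualPair.failsX_iff_exists_memSk {P D : List (List ℤ)} (h : IsDualPair P D) :
    FailsX k P D ↔ ∃ P' D' : List (List ℤ), MemSk k P' D' ∧
      IsInducedSubgraph (ofList P') (ofList P) := by
  obtain ⟨E, _, _, I, hI⟩ := h.exists_isModel
  rw [failsX_iff h hI]
  constructor
  · intro hf
    obtain ⟨S, -, hS⟩ := exists_minimal_le_of_wellFoundedLT (fun S => Fails k I S) Set.univ hf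
    obtain ⟨pos, hp⟩ := exists_isPos P
    obtain ⟨P', D', h', f, hfi, hw, hadj, rfl⟩ := exists_isInducedOn hp h.w_le S
    refine ⟨P', D', (memSk_iff h' (hI.comp hfi hw hadj)).2 ⟨?_, fun T hT hfT => hT ?_⟩,
      f, hfi, hw, hadj⟩
    · rw [fails_comp, Set.image_univ]
      exact hS.prop
    · rw [fails_comp] at hfT
      have := hS.le_of_le hfT (Set.image_subset_range f T)
      rw [← Set.image_univ] at this
      exact Set.univ_subset_iff.1 ((Set.image_subset_image_iff hfi).1 this)
  · rintro ⟨P', D', ⟨h', hf, -⟩, f, hfi, hw, hadj⟩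
    exact ((failsX_iff_of_isInducedOn hI h' (isInducedOn_range hfi hw hadj)).1 hf).mono
      (Set.subset_univ _)

theorem MemSk.bounds {P D : List (List ℤ)} (hk : 0 < k) (h : MemSk k P D) :
    (∀ v, |(ofList P).w v| ≤ 2 * (k : ℤ) + 7) ∧ totalLen P ≤ 13 * k := by
  have hd := h.1
  obtain ⟨pos, hp⟩ := exists_isPos P
  obtain ⟨E, _, _, I, hI⟩ := hp.exists_isModel hd.w_le
  obtain ⟨hf, hmin⟩ := (memSk_iff hd hI).1 h
  set J : ℤ → Finset E := Function.extend pos I fun _ => ∅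
  have hJp : ∀ v, J (pos v) = I v := fun v => hp.inj.extend_apply _ _ v
  have hcomp : J ∘ pos = I := funext hJp
  have hline : IsLine J (univ.image pos) := by
    refine ⟨fun i hi => ?_, fun i hi hi' => ?_, fun i hi j hj hij => ?_⟩
    · obtain ⟨v, -, rfl⟩ := mem_image.1 hi
      have := hI.card v
      have := hd.w_le v
      rw [hJp]
      omega
    · obtain ⟨v, -, rfl⟩ := mem_image.1 hi
      obtain ⟨u, -, hu⟩ := mem_image.1 hi'
      rw [← hu, hJp, hJp]
      exact hI.adj _ _ ((hp.adj _ _).2 (.inl hu.symm))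
    · obtain ⟨v, -, rfl⟩ := mem_image.1 hi
      obtain ⟨u, -, rfl⟩ := mem_image.1 hj
      rw [hJp, hJp]
      refine hI.far _ _ (fun h => ?_) fun h => ?_
      · subst h
        omega
      · have := (hp.adj _ _).1 h
        omega
  have hfJ : Fails k J ((univ.image pos : Finset ℤ) : Set ℤ) := by
    rwa [coe_image, coe_univ, ← fails_comp, hcomp]
  have hminJ : ∀ S ⊂ univ.image pos, ¬Fails k J (S : Set ℤ) := fun S hS hfS => by
    have hpre : pos '' (pos ⁻¹' (S : Set ℤ)) = S := Set.image_preimage_eq_iff.2 fun x hx => by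
      simpa using hS.1 hx
    rw [← hpre, ← fails_comp, hcomp] at hfS
    refine hmin _ (fun hu => hS.2 fun x hx => ?_) hfS
    obtain ⟨v, -, rfl⟩ := mem_image.1 hx
    exact (Set.eq_univ_iff_forall.1 hu v :)
  refine ⟨fun v => ?_, ?_⟩
  · have h1 := hline.weight_le hk hfJ hminJ (mem_image_of_mem pos (mem_univ v))
    have h2 := hI.card v
    have := hd.w_le v
    rw [hJp] at h1
    rw [abs_of_nonpos (by omega)]
    omega
  · have := hline.card_le hk hfJ hminJ
    rwa [card_image_of_injective _ hp.inj, card_univ, card_ofList] at this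

theorem MemSk.abs_le {P D : List (List ℤ)} (hk : 0 < k) (h : MemSk k P D) :
    ∀ c ∈ P, ∀ x ∈ c, |x| ≤ 2 * (k : ℤ) + 7 := by
  intro c hc x hx
  obtain ⟨i, rfl⟩ := List.mem_iff_get.1 hc
  obtain ⟨j, rfl⟩ := List.mem_iff_get.1 hx
  exact (h.bounds hk).1 (vtx i j)

theorem finite_setOf_length_le {α : Type} {T : Set α} (hT : T.Finite) (n : ℕ) :
    {l : List α | l.length ≤ n ∧ ∀ x ∈ l, x ∈ T}.Finite := by
  have := hT.to_subtype
  refine ((List.finite_length_le T n).image (List.map Subtype.val)).subset fun l hl => ?_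
  lift l to List T using hl.2
  exact ⟨l, by simpa using hl.1, rfl⟩

theorem length_le_totalLen {P : List (List ℤ)} (h : ∀ c ∈ P, c ≠ []) : P.length ≤ totalLen P := by
  have := List.length_le_sum_of_one_le (P.map List.length) fun n hn => by
    obtain ⟨c, hc, rfl⟩ := List.mem_map.1 hn
    exact List.length_pos_iff.2 (h c hc)
  simpa [totalLen] using this

theorem finite_memSk (hk : 0 < k) :
    {P : List (List ℤ) | ∃ D : List (List ℤ), MemSk k P D}.Finite := by
  refine (finite_setOf_length_le (finite_setOf_length_le
    (Set.finite_Icc (-(2 * (k : ℤ) + 7)) (2 * (k : ℤ) + 7)) (13 * k)) (13 * k)).subset ?_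
  rintro P ⟨D, h⟩
  have htot := (h.bounds hk).2
  exact ⟨(length_le_totalLen h.1.ne_nil).trans htot, fun c hc =>
    ⟨(List.le_sum_of_mem (List.mem_map_of_mem hc)).trans htot, fun x hx =>
      abs_le.1 (h.abs_le hk c hc x hx)⟩⟩

end Induced

/-- Theorem A: the minimal forbidden configurations `S_k` characterize Property `X_k`,
their weights are bounded by `2k + 7` in absolute value, they have at most `13k`
vertices, and there are only finitely many of them. -/
theorem statement19 (k : ℕ) (hk : 0 < k) :
    (∀ P D : List (List ℤ), IsDualPair P D →
      (FailsX k P D ↔ ∃ P' D' : List (List ℤ), MemSk k P' D' ∧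
        IsInducedSubgraph (ofList P') (ofList P))) ∧
    (∀ P D : List (List ℤ), MemSk k P D → ∀ c ∈ P, ∀ x ∈ c, |x| ≤ 2 * (k : ℤ) + 7) ∧
    (∀ P D : List (List ℤ), MemSk k P D → totalLen P ≤ 13 * k) ∧
    {P : List (List ℤ) | ∃ D : List (List ℤ), MemSk k P D}.Finite :=
  ⟨fun _ _ h => h.failsX_iff_exists_memSk, fun _ _ h => h.abs_le hk,
    fun _ _ h => (h.bounds hk).2, finite_memSk hk⟩

end LensPaper
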